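/- Fix integers k ≥ 2 and p ≥ 1. For each n ≥ 1, let w_1, …, w_p be given by p independent simple random walks of length n on F_k. Then with probability going to 1 exponentially fast as n → ∞, the subgroup H = ⟨w_1, …, w_p⟩ is Aut-malnormal in F_k; in particular every automorphism of F_k leaving H invariant is conjugation by an element of H. -/

import Mathlib

open MeasureTheory

noncomputable section

/-- Every set of a free group is measurable (discrete σ-algebra). -/
instance freeGroupMeasurableSpace {α : Type*} : MeasurableSpace (FreeGroup α) := ⊤

/-- The length `|g|` of the reduced word representing `g`. -/
def wlen {k : ℕ} (g : FreeGroup (Fin k)) : ℕ := (FreeGroup.toWord g).length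

/-- A family of "failure probabilities" decays exponentially: the corresponding events
hold with probability going to 1 exponentially fast as `n → ∞`. -/
def ExpDecay (f : ℕ → ENNReal) : Prop :=
  ∃ C : ℝ, 0 < C ∧ ∃ κ : ℝ, 1 < κ ∧ ∀ n : ℕ, f n ≤ ENNReal.ofReal (C / κ ^ n)

/-- `H` is Aut-malnormal: any automorphism `α` with `α(H) ∩ H ≠ {1}` is conjugation by an
element of `H`. -/
def AutMalnormal {k : ℕ} (H : Subgroup (FreeGroup (Fin k))) : Prop :=
  ∀ α : FreeGroup (Fin k) ≃* FreeGroup (Fin k),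
    (∃ x : FreeGroup (Fin k), x ≠ 1 ∧ x ∈ H ∧ α.symm x ∈ H) →
    ∃ h, h ∈ H ∧ ∀ g, α g = h * g * h⁻¹

/-- The distribution of the simple random walk of length `n` on `F_k`: the product
`s_1 ⋯ s_n` of `n` letters chosen independently and uniformly among the `2k` letters
`X^{±1}` (encoded as `Fin k × Bool`). -/
noncomputable def walkMeasure (k n : ℕ) : Measure (FreeGroup (Fin k)) :=
  Measure.map (fun s : Fin n → Fin k × Bool => (List.ofFn fun j => FreeGroup.mk [s j]).prod)
    ((Fintype.card (Fin n → Fin k × Bool) : ENNReal)⁻¹ • Measure.count)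

namespace RandomSubgroup

open FreeGroup Filter

section Words

variable {α : Type*}

/-- The inverse of a letter. -/
def linv (x : α × Bool) : α × Bool := (x.1, !x.2)

@[simp] theorem linv_linv (x : α × Bool) : linv (linv x) = x := by simp [linv]

theorem linv_injective : Function.Injective (linv : α × Bool → α × Bool) :=
  fun x y h => by rw [← linv_linv x, h, linv_linv]

@[simp] theorem linv_inj {x y : α × Bool} : linv x = linv y ↔ x = y := linv_injective.eq_iff

theorem linv_ne_self (x : α × Bool) : linv x ≠ x := by
  obtain ⟨a, b⟩ := x
  cases b <;> simp [linv]

theorem ne_linv_iff {a b : α × Bool} : b ≠ linv a ↔ (a.1 = b.1 → a.2 = b.2) := by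
  obtain ⟨a, s⟩ := a
  obtain ⟨b, t⟩ := b
  cases s <;> cases t <;> simp [linv, eq_comm]

theorem isReduced_cons_iff {a : α × Bool} {l : List (α × Bool)} :
    IsReduced (a :: l) ↔ (∀ b ∈ l.head?, b ≠ linv a) ∧ IsReduced l := by
  simp only [FreeGroup.IsReduced, List.isChain_cons, ne_linv_iff]

theorem _root_.FreeGroup.IsReduced.of_isInfix {L₁ L₂ : List (α × Bool)}
    (h : FreeGroup.IsReduced L₂) (hL : L₁ <:+: L₂) : FreeGroup.IsReduced L₁ := by
  obtain ⟨s, t, rfl⟩ := hL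
  exact List.IsChain.right_of_append (List.IsChain.left_of_append h)

theorem isReduced_append_iff {l m : List (α × Bool)} :
    IsReduced (l ++ m) ↔ IsReduced l ∧ IsReduced m ∧
      ∀ a ∈ l.getLast?, ∀ b ∈ m.head?, b ≠ linv a := by
  simp only [FreeGroup.IsReduced, List.isChain_append, ne_linv_iff]

theorem isReduced_concat_iff {l : List (α × Bool)} {t : α × Bool} :
    IsReduced (l ++ [t]) ↔ IsReduced l ∧ ∀ a ∈ l.getLast?, t ≠ linv a := by
  rw [isReduced_append_iff]
  simp [IsReduced.singleton]

theorem mk_append (l m : List (α × Bool)) : mk (l ++ m) = mk l * mk m := mul_mk.symm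

theorem mk_cons (x : α × Bool) (m : List (α × Bool)) : mk (x :: m) = mk [x] * mk m := by
  rw [← mk_append]; rfl

theorem mk_nil : mk ([] : List (α × Bool)) = 1 := rfl

theorem mk_linv (x : α × Bool) : mk [linv x] = (mk [x])⁻¹ := by
  simp [inv_mk, invRev, linv]

theorem invRev_concat (l : List (α × Bool)) (x : α × Bool) :
    invRev (l ++ [x]) = linv x :: invRev l := by
  simp [invRev, linv]

theorem invRev_cons' (l : List (α × Bool)) (x : α × Bool) :
    invRev (x :: l) = invRev l ++ [linv x] := by
  simp [invRev, linv]

theorem tendsto_mul_left_cofinite (v : FreeGroup α) :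
    Tendsto (fun g => v * g) cofinite cofinite :=
  (mul_right_injective v).tendsto_cofinite

variable [DecidableEq α]

theorem toWord_mk_of_isReduced {l : List (α × Bool)} (h : IsReduced l) : (mk l).toWord = l := by
  rw [toWord_mk, h.reduce_eq]

theorem mk_injOn_isReduced {l m : List (α × Bool)} (hl : IsReduced l) (hm : IsReduced m)
    (h : mk l = mk m) : l = m := by
  rw [← toWord_mk_of_isReduced hl, h, toWord_mk_of_isReduced hm]

theorem isReduced_invRev {l : List (α × Bool)} (h : IsReduced l) : IsReduced (invRev l) := by
  apply IsReduced.of_reduce_eq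
  rw [reduce_invRev, h.reduce_eq]

/-- The set of elements whose reduced word begins with `l`. -/
def cyl (l : List (α × Bool)) : Set (FreeGroup α) := {g | l <+: g.toWord}

theorem mem_cyl {l : List (α × Bool)} {g : FreeGroup α} : g ∈ cyl l ↔ l <+: g.toWord := Iff.rfl

theorem mem_cyl_singleton {t : α × Bool} {g : FreeGroup α} :
    g ∈ cyl [t] ↔ g.toWord.head? = some t := by
  rw [mem_cyl]
  rcases g.toWord with _ | ⟨x, l⟩
  · simp
  · simp [List.cons_prefix_cons, eq_comm]

theorem cyl_nil : cyl ([] : List (α × Bool)) = Set.univ := by ext; simp [mem_cyl]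

theorem cyl_mono {l m : List (α × Bool)} (h : l <+: m) : cyl m ⊆ cyl l :=
  fun _ hg => h.trans hg

theorem isReduced_of_mem_cyl {l : List (α × Bool)} {g : FreeGroup α} (h : g ∈ cyl l) :
    IsReduced l := isReduced_toWord.of_isInfix (List.IsPrefix.isInfix h)

theorem mk_mem_cyl {l m : List (α × Bool)} (h : IsReduced (l ++ m)) : mk (l ++ m) ∈ cyl l := by
  rw [mem_cyl, toWord_mk_of_isReduced h]
  exact List.prefix_append _ _

/-- A group element in `cyl l` is `mk l` or lies in the cylinder of a one-letter extension. -/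
theorem mem_cyl_cases {l : List (α × Bool)} {g : FreeGroup α} (h : g ∈ cyl l) :
    g = mk l ∨ ∃ t, IsReduced (l ++ [t]) ∧ g ∈ cyl (l ++ [t]) := by
  obtain ⟨r, hr⟩ := h
  rcases r with _ | ⟨t, r⟩
  · left
    rw [← mk_toWord (x := g), ← hr, List.append_nil]
  · right
    have : g ∈ cyl (l ++ [t]) := ⟨r, by rw [← hr]; simp⟩
    exact ⟨t, isReduced_of_mem_cyl this, this⟩

theorem mem_cyl_append_iff {l m : List (α × Bool)} (h : IsReduced (l ++ m)) (hm : m ≠ [])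
    {g : FreeGroup α} : g ∈ cyl (l ++ m) ↔ (mk l)⁻¹ * g ∈ cyl m := by
  constructor
  · rintro ⟨r, hr⟩
    have hg : g = mk l * mk (m ++ r) := by
      rw [← mk_append, ← List.append_assoc, hr, mk_toWord]
    rw [hg, inv_mul_cancel_left]
    apply mk_mem_cyl
    have : IsReduced (l ++ m ++ r) := hr ▸ isReduced_toWord
    exact this.of_isInfix ⟨l, [], by simp⟩
  · rintro ⟨r, hr⟩
    have hg : g = mk (l ++ m ++ r) := by
      rw [List.append_assoc, mk_append, hr, mk_toWord, mul_inv_cancel_left]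
    rw [hg]
    apply mk_mem_cyl
    exact h.append_overlap (hr ▸ isReduced_toWord) hm

theorem mem_cyl_linv_getLast_iff {l : List (α × Bool)} {x : α × Bool} (h : IsReduced (l ++ [x]))
    {g : FreeGroup α} : (mk (l ++ [x]))⁻¹ * g ∈ cyl [linv x] ↔ g ∉ cyl (l ++ [x]) := by
  constructor
  · rintro hs ⟨r, hr⟩
    have hred : IsReduced (l ++ [x] ++ r) := hr ▸ isReduced_toWord
    have hg : (mk (l ++ [x]))⁻¹ * g = mk r := by
      rw [← mk_toWord (x := g), ← hr, mk_append _ r, inv_mul_cancel_left]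
    rw [hg, mem_cyl_singleton, toWord_mk_of_isReduced (hred.of_isInfix ⟨l ++ [x], [], by simp⟩)] at hs
    rw [isReduced_append_iff] at hred
    exact hred.2.2 x (by simp) _ hs rfl
  · intro hg
    by_contra hs
    apply hg
    set w := ((mk (l ++ [x]))⁻¹ * g).toWord with hw
    have hred : IsReduced (l ++ [x] ++ w) := by
      rw [isReduced_append_iff]
      refine ⟨h, isReduced_toWord, ?_⟩
      intro a ha b hb hab
      apply hs
      rw [mem_cyl_singleton]
      simp only [List.getLast?_append, List.getLast?_singleton, Option.some_or, Option.mem_def,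
        Option.some.injEq] at ha
      rw [← hw, hb, hab, ha]
    have : g = mk (l ++ [x] ++ w) := by
      rw [mk_append _ w, hw, mk_toWord, mul_inv_cancel_left]
    rw [this]
    exact mk_mem_cyl hred

theorem cyl_singleton_infinite (t : α × Bool) : (cyl [t]).Infinite := by
  have hred : ∀ n, IsReduced (List.replicate n t) := fun n =>
    List.isChain_replicate_of_rel n (fun _ => rfl)
  apply Set.infinite_of_injective_forall_mem (f := fun n : ℕ => mk (List.replicate (n + 1) t))
  · intro m n hmn
    have := congrArg List.length (mk_injOn_isReduced (hred _) (hred _) hmn)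
    simpa using this
  · intro n
    rw [mem_cyl_singleton, toWord_mk_of_isReduced (hred _)]
    simp [List.replicate_succ]

theorem cyl_infinite [Nonempty α] {l : List (α × Bool)} (h : IsReduced l) : (cyl l).Infinite := by
  rcases List.eq_nil_or_concat l with rfl | ⟨l, x, rfl⟩
  · inhabit α
    exact (cyl_singleton_infinite (default, true)).mono (cyl_mono (by simp))
  · rw [List.concat_eq_append] at h ⊢
    have : cyl (l ++ [x]) = (fun g => mk l * g) '' cyl [x] := by
      ext g
      rw [mem_cyl_append_iff h (by simp)]
      constructor
      · exact fun hg => ⟨_, hg, mul_inv_cancel_left _ _⟩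
      · rintro ⟨g, hg, rfl⟩
        rwa [inv_mul_cancel_left]
    rw [this]
    exact (cyl_singleton_infinite x).image (mul_right_injective _).injOn

theorem not_eventually_notMem_cyl [Nonempty α] {l : List (α × Bool)} (h : IsReduced l) :
    ¬ ∀ᶠ g in cofinite, g ∉ cyl l := by
  rw [eventually_cofinite]
  simpa using cyl_infinite h

theorem exists_mem_cyl_of_eventually [Nonempty α] {l : List (α × Bool)} (h : IsReduced l)
    {p : FreeGroup α → Prop} (hp : ∀ᶠ g in cofinite, p g) : ∃ g ∈ cyl l, p g := by
  by_contra! hcon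
  exact not_eventually_notMem_cyl h (hp.mono fun g hg hl => hcon g hl hg)

theorem disjoint_cyl_concat {l : List (α × Bool)} {t t' : α × Bool} (h : t ≠ t')
    {g : FreeGroup α} (hg : g ∈ cyl (l ++ [t])) : g ∉ cyl (l ++ [t']) := by
  intro hg'
  have := List.prefix_of_prefix_length_le hg hg' (by simp)
  have := this.eq_of_length (by simp)
  simp at this
  exact h this

end Words

section Colorings

variable {α κ : Type*}

/-- A coloring of the free group is almost invariant if every right translation changes the color
of only finitely many elements. -/
def AlmostInvariant (c : FreeGroup α → κ) : Prop :=
  ∀ x, ∀ᶠ g in cofinite, c g = c (g * x)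

variable [DecidableEq α]

/-- All but finitely many elements of the cylinder of `l` have color `x`. -/
def PureColor (c : FreeGroup α → κ) (l : List (α × Bool)) (x : κ) : Prop :=
  ∀ᶠ g in cofinite, g ∈ cyl l → c g = x

/-- The coloring is not almost constant on the cylinder of `l`. -/
def Mixed (c : FreeGroup α → κ) (l : List (α × Bool)) : Prop := ∀ x, ¬ PureColor c l x

theorem PureColor.unique [Nonempty α] {c : FreeGroup α → κ} {l : List (α × Bool)} {x y : κ}
    (hx : PureColor c l x) (hl : FreeGroup.IsReduced l) (hy : PureColor c l y) : x = y := by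
  obtain ⟨g, hg, h1, h2⟩ := exists_mem_cyl_of_eventually hl (hx.and hy)
  rw [← h1 hg, ← h2 hg]

theorem pureColor_of_forall_concat [Finite α] {c : FreeGroup α → κ} {l : List (α × Bool)} {x : κ}
    (h : ∀ t, FreeGroup.IsReduced (l ++ [t]) → PureColor c (l ++ [t]) x) : PureColor c l x := by
  have h1 : ∀ᶠ g in cofinite, ∀ t, FreeGroup.IsReduced (l ++ [t]) → g ∈ cyl (l ++ [t]) →
      c g = x := by
    rw [eventually_all]
    intro t
    by_cases ht : FreeGroup.IsReduced (l ++ [t])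
    · filter_upwards [h t ht] with g hg _ using hg
    · exact Eventually.of_forall fun g hg => absurd hg ht
  filter_upwards [h1, (Set.finite_singleton (FreeGroup.mk l)).eventually_cofinite_notMem]
    with g hg hgl hgc
  rcases mem_cyl_cases hgc with h | ⟨t, ht, hgt⟩
  · exact absurd h hgl
  · exact hg t ht hgt

theorem exists_ne_mul_letter {c : FreeGroup α → κ} {l : List (α × Bool)}
    (h : ∀ g ∈ cyl l, ∀ t, c g = c (g * FreeGroup.mk [t])) (r : List (α × Bool)) :
    FreeGroup.IsReduced (l ++ r) → c (FreeGroup.mk (l ++ r)) = c (FreeGroup.mk l) := by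
  induction r using List.reverseRecOn with
  | nil => simp
  | append_singleton r t ih =>
    intro hr
    have hr' : FreeGroup.IsReduced (l ++ r) := hr.of_isInfix ⟨[], [t], by simp⟩
    rw [← ih hr', h _ (mk_mem_cyl hr') t, ← mk_append, List.append_assoc]

theorem finite_mixed [Finite α] {c : FreeGroup α → κ} (hc : AlmostInvariant c) :
    {l | Mixed c l}.Finite := by
  have hfin : (⋃ t : α × Bool, {g | ¬ c g = c (g * FreeGroup.mk [t])}).Finite :=
    Set.finite_iUnion fun t => hc _
  refine (hfin.biUnion (t := fun g => {l | l <+: g.toWord}) ?_).subset ?_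
  · intro g _
    exact (List.finite_toSet g.toWord.inits).subset fun l hl => by simpa using hl
  · intro l hl
    by_contra hcon
    simp only [Set.mem_iUnion, Set.mem_ofPred_eq, exists_prop, not_exists, not_and] at hcon
    apply hl (c (FreeGroup.mk l))
    refine Eventually.of_forall ?_
    rintro g ⟨r, hr⟩
    rw [← FreeGroup.mk_toWord (x := g), ← hr]
    apply exists_ne_mul_letter _ r (hr ▸ FreeGroup.isReduced_toWord)
    intro g hg t
    by_contra hne
    exact hcon g ⟨t, hne⟩ hg

/-- Every mixed cylinder contains a mixed cylinder all of whose one-letter refinements are pure. -/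
theorem exists_leaf [Finite α] {c : FreeGroup α → κ} (hc : AlmostInvariant c)
    {l₀ : List (α × Bool)} (h₀ : Mixed c l₀) :
    ∃ l, l₀ <+: l ∧ Mixed c l ∧ ∀ t, ∃ x, PureColor c (l ++ [t]) x := by
  have hfin : {l | l₀ <+: l ∧ Mixed c l}.Finite := (finite_mixed hc).subset fun l hl => hl.2
  obtain ⟨l, hl, hmax⟩ := Set.exists_max_image _ List.length hfin ⟨l₀, List.prefix_rfl, h₀⟩
  refine ⟨l, hl.1, hl.2, fun t => ?_⟩
  by_contra! hcon
  have := hmax (l ++ [t]) ⟨hl.1.trans (List.prefix_append _ _), hcon⟩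
  simp at this

theorem Mixed.isReduced [Nonempty κ] {c : FreeGroup α → κ} {l : List (α × Bool)}
    (h : Mixed c l) : FreeGroup.IsReduced l := by
  by_contra hl
  inhabit κ
  exact h default (Eventually.of_forall fun g hg => absurd (isReduced_of_mem_cyl hg) hl)

/-- Passing to the translated coloring `g ↦ c (mk l * g)` removes the initial word `l`. -/
theorem pureColor_append_iff {c : FreeGroup α → κ} {l m : List (α × Bool)} {x : κ}
    (h : FreeGroup.IsReduced (l ++ m)) (hm : m ≠ []) :
    PureColor c (l ++ m) x ↔ PureColor (fun g => c (FreeGroup.mk l * g)) m x := by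
  constructor
  · intro hp
    filter_upwards [(tendsto_mul_left_cofinite (FreeGroup.mk l)).eventually hp] with g hg hgm
    apply hg
    rwa [mem_cyl_append_iff h hm, inv_mul_cancel_left]
  · intro hp
    filter_upwards [(tendsto_mul_left_cofinite (FreeGroup.mk l)⁻¹).eventually hp] with g hg hgm
    rw [mem_cyl_append_iff h hm] at hgm
    simpa only [mul_inv_cancel_left] using hg hgm

end Colorings

section Turns

variable {β : Type*} [DecidableEq β]

/-- The number of occurrences of the two-letter word `ab` as a subword of a list. -/
def pairCount (a b : β) : List β → ℕ
  | [] => 0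
  | x :: l => pairCount a b l + if x = a ∧ l.head? = some b then 1 else 0

theorem pairCount_append_le (a b : β) (l m : List β) :
    pairCount a b l + pairCount a b m ≤ pairCount a b (l ++ m) := by
  induction l with
  | nil => simp [pairCount]
  | cons x l ih =>
    simp only [List.cons_append, pairCount]
    have : (if x = a ∧ l.head? = some b then 1 else 0) ≤
        (if x = a ∧ (l ++ m).head? = some b then 1 else 0) := by
      split_ifs with h1 h2 <;> try omega
      exact absurd ⟨h1.1, by rw [List.head?_append, h1.2]; rfl⟩ h2
    omega

theorem pairCount_concat (a b x : β) (l : List β) :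
    pairCount a b (l ++ [x]) = pairCount a b l + if l.getLast? = some a ∧ x = b then 1 else 0 := by
  induction l with
  | nil => simp [pairCount]
  | cons y l ih =>
    simp only [List.cons_append, pairCount, ih]
    rcases l with _ | ⟨z, l⟩
    · simp [pairCount]
    · simp only [List.cons_append, List.head?_cons, List.getLast?_cons_cons]
      exact add_right_comm _ _ _

theorem card_pair_positions (a b : β) (l : List β) :
    ((Finset.range l.length).filter fun j => l[j]? = some a ∧ l[j + 1]? = some b).card =
      pairCount a b l := by
  rw [Finset.card_filter]
  induction l with
  | nil => simp [pairCount]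
  | cons x l ih =>
    rw [List.length_cons, Finset.sum_range_succ', pairCount, ← ih]
    simp only [List.getElem?_cons_succ, List.getElem?_cons_zero, Option.some.injEq]
    rw [List.head?_eq_getElem?]

end Turns

section TurnsFree

variable {α : Type*} [DecidableEq α]

/-- The number of times the path labelled by a word makes the unoriented turn `{t, t'}`. -/
def turn (t t' : α × Bool) (l : List (α × Bool)) : ℕ :=
  pairCount (linv t) t' l + pairCount (linv t') t l

theorem turn_append_le (t t' : α × Bool) (l m : List (α × Bool)) :
    turn t t' l + turn t t' m ≤ turn t t' (l ++ m) := by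
  have h1 := pairCount_append_le (linv t) t' l m
  have h2 := pairCount_append_le (linv t') t l m
  simp only [turn]
  omega

theorem pairCount_invRev (a b : α × Bool) (l : List (α × Bool)) :
    pairCount a b (FreeGroup.invRev l) = pairCount (linv b) (linv a) l := by
  induction l with
  | nil => simp [pairCount, FreeGroup.invRev]
  | cons x l ih =>
    rw [invRev_cons', pairCount_concat, ih, pairCount]
    congr 1
    have h1 : (FreeGroup.invRev l).getLast? = l.head?.map linv := by
      rcases l with _ | ⟨y, l⟩
      · simp [FreeGroup.invRev]
      · simp [invRev_cons']
    have h2 : l.head?.map linv = some a ↔ l.head? = some (linv a) := by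
      rcases l with _ | ⟨y, l⟩
      · simp
      · simp only [List.head?_cons, Option.map_some, Option.some.injEq]
        rw [← linv_inj, linv_linv]
    have h3 : linv x = b ↔ x = linv b := by rw [← linv_inj, linv_linv]
    simp only [h1, h2, h3, and_comm]

theorem turn_invRev (t t' : α × Bool) (l : List (α × Bool)) :
    turn t t' (FreeGroup.invRev l) = turn t t' l := by
  simp only [turn, pairCount_invRev, linv_linv]
  omega

end TurnsFree

section Crossing

variable {α : Type*} [DecidableEq α]

/-- The elements `g` such that exactly one of `g` and `g * z` belongs to `A`. -/
def crossing (A : Set (FreeGroup α)) (z : FreeGroup α) : Set (FreeGroup α) :=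
  {g | ¬ (g ∈ A ↔ g * z ∈ A)}

theorem mem_cyl_turn_start {l W : List (α × Bool)} {t : α × Bool} {j : ℕ}
    (hl : FreeGroup.IsReduced (l ++ [t])) (hW : FreeGroup.IsReduced W)
    (hj : W[j]? = some (linv t)) :
    FreeGroup.mk l * (FreeGroup.mk (W.take (j + 1)))⁻¹ ∈ cyl (l ++ [t]) := by
  rw [mem_cyl_append_iff hl (by simp), inv_mul_cancel_left, FreeGroup.inv_mk, mem_cyl_singleton,
    toWord_mk_of_isReduced (isReduced_invRev (List.IsChain.take hW _)), List.take_add_one, hj,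
    Option.toList_some, invRev_concat]
  simp

theorem mem_cyl_turn_end {l W : List (α × Bool)} {t : α × Bool} {j : ℕ}
    (hl : FreeGroup.IsReduced (l ++ [t])) (hW : FreeGroup.IsReduced W)
    (hj : W[j + 1]? = some t) :
    FreeGroup.mk l * (FreeGroup.mk (W.take (j + 1)))⁻¹ * FreeGroup.mk W ∈ cyl (l ++ [t]) := by
  have : (FreeGroup.mk (W.take (j + 1)))⁻¹ * FreeGroup.mk W = FreeGroup.mk (W.drop (j + 1)) := by
    conv_lhs => rw [← List.take_append_drop (j + 1) W]
    rw [mk_append, List.take_append_drop, inv_mul_cancel_left]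
  rw [mem_cyl_append_iff hl (by simp), mul_assoc, inv_mul_cancel_left, this, mem_cyl_singleton,
    toWord_mk_of_isReduced (List.IsChain.drop hW _), List.head?_drop, hj]

theorem injOn_turn_start {W : List (α × Bool)} (hW : FreeGroup.IsReduced W) (v : FreeGroup α) :
    Set.InjOn (fun j => v * (FreeGroup.mk (W.take (j + 1)))⁻¹) (Finset.range W.length) := by
  intro i hi j hj hij
  have h := mk_injOn_isReduced (List.IsChain.take hW _) (List.IsChain.take hW _)
    (inv_injective (mul_left_cancel hij))
  have h' := congrArg List.length h
  simp only [Finset.coe_range, Set.mem_Iio] at hi hj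
  simp only [List.length_take] at h'
  omega

/-- If some one-letter refinements `P` of a cylinder are almost contained in `A` and others `N` are
almost disjoint from `A`, then a word making every turn at least `m` times crosses `A` at least
`#P * #N * m` times inside these refinements, up to a bounded error. -/
theorem exists_le_crossing [Fintype α] {A : Set (FreeGroup α)}
    (hA : ∀ z, (crossing A z).Finite) {l : List (α × Bool)} {P N : Finset (α × Bool)}
    (hP : ∀ t ∈ P, FreeGroup.IsReduced (l ++ [t]) ∧ PureColor (· ∈ A) (l ++ [t]) True)
    (hN : ∀ t ∈ N, FreeGroup.IsReduced (l ++ [t]) ∧ PureColor (· ∈ A) (l ++ [t]) False)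
    (hPN : Disjoint P N) :
    ∃ C, ∀ W, FreeGroup.IsReduced W → ∀ m, (∀ t t', t ≠ t' → m ≤ turn t t' W) →
      P.card * N.card * m ≤
        (crossing A (FreeGroup.mk W) ∩ {g | ∃ t ∈ P ∪ N, g ∈ cyl (l ++ [t])}).ncard + C := by
  classical
  have hE : {g | ∃ t, (t ∈ P ∧ g ∈ cyl (l ++ [t]) ∧ g ∉ A) ∨
      (t ∈ N ∧ g ∈ cyl (l ++ [t]) ∧ g ∈ A)}.Finite := by
    rw [Set.ofPred_exists]
    refine Set.finite_iUnion fun t => ?_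
    rw [Set.ofPred_or]
    refine Set.Finite.union ?_ ?_
    · by_cases ht : t ∈ P
      · refine Set.Finite.subset (hP t ht).2 fun g hg => ?_
        simp only [Set.mem_ofPred_eq] at hg
        simp [hg]
      · simp [ht]
    · by_cases ht : t ∈ N
      · refine Set.Finite.subset (hN t ht).2 fun g hg => ?_
        simp only [Set.mem_ofPred_eq] at hg
        simp [hg]
      · simp [ht]
  set E := hE.toFinset with hEdef
  refine ⟨2 * E.card, fun W hW m hm => ?_⟩
  set z := FreeGroup.mk W with hz
  set f : ℕ → FreeGroup α := fun j => FreeGroup.mk l * (FreeGroup.mk (W.take (j + 1)))⁻¹ with hf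
  have hinj := injOn_turn_start hW (FreeGroup.mk l)
  set I : (α × Bool) × (α × Bool) → Finset ℕ := fun q => (Finset.range W.length).filter fun j =>
    W[j]? = some (linv q.1) ∧ W[j + 1]? = some q.2 with hI
  set J : Finset ℕ := (P ×ˢ N).biUnion fun q => I q ∪ I (q.2, q.1) with hJ
  have hmemI : ∀ q j, j ∈ I q ↔ j < W.length ∧ W[j]? = some (linv q.1) ∧ W[j + 1]? = some q.2 := by
    intro q j; simp [hI]
  have hPNne : ∀ t ∈ P, ∀ t' ∈ N, t ≠ t' := fun t ht t' ht' => by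
    rintro rfl
    exact Finset.disjoint_left.mp hPN ht ht'
  have hcard : P.card * N.card * m ≤ J.card := by
    rw [hJ, Finset.card_biUnion]
    · rw [← Finset.card_product, ← smul_eq_mul, ← Finset.sum_const]
      refine Finset.sum_le_sum fun q hq => ?_
      rw [Finset.mem_product] at hq
      rw [Finset.card_union_of_disjoint]
      · refine (hm q.1 q.2 (hPNne _ hq.1 _ hq.2)).trans_eq ?_
        rw [turn, ← card_pair_positions, ← card_pair_positions]
      · rw [Finset.disjoint_left]
        intro j h1 h2
        rw [hmemI] at h1 h2
        rw [h1.2.2, Option.some.injEq] at h2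
        exact hPNne _ hq.1 _ hq.2 h2.2.2.symm
    · intro q hq q' hq' hne
      rw [Finset.mem_coe, Finset.mem_product] at hq hq'
      rw [Function.onFun, Finset.disjoint_left]
      intro j h1 h2
      apply hne
      simp only [Finset.mem_union, hmemI] at h1 h2
      have h3 := hPNne _ hq.1 _ hq'.2
      have h4 := hPNne _ hq'.1 _ hq.2
      rcases h1 with h1 | h1 <;> rcases h2 with h2 | h2 <;>
        rw [h1.2.1, h1.2.2, Option.some.injEq, Option.some.injEq, linv_inj] at h2
      · exact Prod.ext h2.2.1 h2.2.2
      · exact absurd h2.2.1 h3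
      · exact absurd h2.2.1.symm h4
      · exact Prod.ext h2.2.2 h2.2.1
  set T := crossing A z ∩ {g | ∃ t ∈ P ∪ N, g ∈ cyl (l ++ [t])} with hT
  have hTfin : T.Finite := (hA z).subset Set.inter_subset_left
  have hsub : J ⊆ (J.filter fun j => f j ∈ hTfin.toFinset) ∪ (J.filter fun j => f j ∈ E) ∪
      (J.filter fun j => f j * z ∈ E) := by
    intro j hj
    simp only [Finset.mem_union, Finset.mem_filter, hj, true_and, Set.Finite.mem_toFinset]
    by_contra! hcon
    obtain ⟨⟨h1, h2⟩, h3⟩ := hcon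
    simp only [hEdef, Set.Finite.mem_toFinset, Set.mem_ofPred_eq, not_exists, not_or, not_and,
      not_not] at h2 h3
    apply h1
    rw [hJ, Finset.mem_biUnion] at hj
    obtain ⟨q, hq, hj⟩ := hj
    rw [Finset.mem_product] at hq
    rw [Finset.mem_union, hmemI, hmemI] at hj
    rcases hj with ⟨-, ha, hb⟩ | ⟨-, ha, hb⟩
    · have hs := mem_cyl_turn_start (hP _ hq.1).1 hW ha
      have he := mem_cyl_turn_end (hN _ hq.2).1 hW hb
      refine ⟨?_, q.1, Finset.mem_union_left _ hq.1, hs⟩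
      have h4 := (h2 q.1).1 hq.1 hs
      have h5 := (h3 q.2).2 hq.2 he
      simp only [crossing, Set.mem_ofPred_eq]
      tauto
    · have hs := mem_cyl_turn_start (hN _ hq.2).1 hW ha
      have he := mem_cyl_turn_end (hP _ hq.1).1 hW hb
      refine ⟨?_, q.2, Finset.mem_union_right _ hq.2, hs⟩
      have h4 := (h2 q.2).2 hq.2 hs
      have h5 := (h3 q.1).1 hq.1 he
      simp only [crossing, Set.mem_ofPred_eq]
      tauto
  have hJsub : J ⊆ Finset.range W.length := by
    intro j hj
    rw [hJ, Finset.mem_biUnion] at hj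
    obtain ⟨q, -, hj⟩ := hj
    rw [Finset.mem_union, hmemI, hmemI] at hj
    rw [Finset.mem_range]
    rcases hj with hj | hj <;> exact hj.1
  have hbound : ∀ (S : Finset (FreeGroup α)) (y : FreeGroup α),
      (J.filter fun j => f j * y ∈ S).card ≤ S.card := by
    intro S y
    apply Finset.card_le_card_of_injOn (fun j => f j * y)
    · intro j hj
      exact (Finset.mem_filter.mp hj).2
    · intro i hi j hj hij
      exact hinj (hJsub (Finset.mem_filter.mp hi).1) (hJsub (Finset.mem_filter.mp hj).1)
        (mul_right_cancel hij)
  have h1 := hbound hTfin.toFinset 1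
  have h2 := hbound E 1
  have h3 := hbound E z
  simp only [mul_one] at h1 h2
  have h4 := Finset.card_le_card hsub
  have h5 := Finset.card_union_le ((J.filter fun j => f j ∈ hTfin.toFinset) ∪
    (J.filter fun j => f j ∈ E)) (J.filter fun j => f j * z ∈ E)
  have h6 := Finset.card_union_le (J.filter fun j => f j ∈ hTfin.toFinset)
    (J.filter fun j => f j ∈ E)
  rw [Set.ncard_eq_toFinset_card T hTfin]
  omega

end Crossing

section Cuts

variable {α : Type*}

theorem crossing_preimage_mul_left (A : Set (FreeGroup α)) (v z : FreeGroup α) :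
    crossing ((v * ·) ⁻¹' A) z = (v * ·) ⁻¹' crossing A z := by
  ext g
  simp [crossing, mul_assoc]

theorem ncard_preimage_mul_left (S : Set (FreeGroup α)) (v : FreeGroup α) :
    ((v * ·) ⁻¹' S).ncard = S.ncard :=
  Set.ncard_preimage_of_injective_subset_range (mul_right_injective v)
    (by rw [(mul_left_surjective v).range_eq]; exact Set.subset_univ _)

theorem almostInvariant_mem {A : Set (FreeGroup α)} (hA : ∀ z, (crossing A z).Finite) :
    AlmostInvariant (· ∈ A) := by
  intro z
  refine (hA z).subset fun g hg => ?_
  simpa [crossing] using hg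

variable [DecidableEq α]

/-- A word making every turn at least `m` times crosses `A` at least `n * m` times, up to a
bounded error. -/
def CrossBound (A : Set (FreeGroup α)) (n : ℕ) : Prop :=
  ∃ C, ∀ W, FreeGroup.IsReduced W → ∀ m, (∀ t t', t ≠ t' → m ≤ turn t t' W) →
    n * m ≤ (crossing A (FreeGroup.mk W)).ncard + C

/-- The set `A` is, up to finitely many elements, a cylinder or the complement of a cylinder. -/
def IsEdgeCut (A : Set (FreeGroup α)) : Prop :=
  ∃ l : List (α × Bool), l ≠ [] ∧ FreeGroup.IsReduced l ∧
    ((∀ᶠ g in cofinite, g ∈ A ↔ g ∈ cyl l) ∨ ∀ᶠ g in cofinite, g ∈ A ↔ g ∉ cyl l)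

theorem CrossBound.mono {A : Set (FreeGroup α)} {n n' : ℕ} (h : CrossBound A n) (hn : n' ≤ n) :
    CrossBound A n' := by
  obtain ⟨C, hC⟩ := h
  exact ⟨C, fun W hW m hm => (Nat.mul_le_mul_right m hn).trans (hC W hW m hm)⟩

theorem crossBound_preimage_mul_left {A : Set (FreeGroup α)} {v : FreeGroup α} {n : ℕ} :
    CrossBound ((v * ·) ⁻¹' A) n ↔ CrossBound A n := by
  simp only [CrossBound, crossing_preimage_mul_left, ncard_preimage_mul_left]

theorem isEdgeCut_of_preimage_mul_left {A : Set (FreeGroup α)} {l : List (α × Bool)}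
    (hl : FreeGroup.IsReduced l) {t : α × Bool}
    (h : (∀ᶠ g in cofinite, FreeGroup.mk l * g ∈ A ↔ g ∈ cyl [t]) ∨
      ∀ᶠ g in cofinite, FreeGroup.mk l * g ∈ A ↔ g ∉ cyl [t]) : IsEdgeCut A := by
  have h' : (∀ᶠ g in cofinite, g ∈ A ↔ (FreeGroup.mk l)⁻¹ * g ∈ cyl [t]) ∨
      ∀ᶠ g in cofinite, g ∈ A ↔ (FreeGroup.mk l)⁻¹ * g ∉ cyl [t] := by
    refine h.imp (fun h => ?_) (fun h => ?_) <;>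
    · filter_upwards [(tendsto_mul_left_cofinite (FreeGroup.mk l)⁻¹).eventually h] with g hg
      rwa [mul_inv_cancel_left] at hg
  by_cases hlt : FreeGroup.IsReduced (l ++ [t])
  · refine ⟨l ++ [t], by simp, hlt, ?_⟩
    simpa only [mem_cyl_append_iff hlt (by simp : [t] ≠ [])] using h'
  · rw [isReduced_concat_iff] at hlt
    push Not at hlt
    obtain ⟨x, hx, rfl⟩ := hlt hl
    obtain ⟨l', rfl⟩ := List.getLast?_eq_some_iff.mp hx
    refine ⟨l' ++ [x], by simp, hl, ?_⟩
    simp only [mem_cyl_linv_getLast_iff hl, not_not] at h'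
    exact h'.symm

theorem add_le_mul_add_one {a b : ℕ} (ha : 1 ≤ a) (hb : 1 ≤ b) : a + b ≤ a * b + 1 := by
  obtain ⟨a, rfl⟩ := Nat.exists_eq_add_of_le ha
  obtain ⟨b, rfl⟩ := Nat.exists_eq_add_of_le hb
  nlinarith [Nat.zero_le (a * b)]

theorem two_mul_add_le_mul {a b : ℕ} (ha : 2 ≤ a) (hb : 2 ≤ b) : 2 * (a + b) ≤ a * b + 4 := by
  obtain ⟨a, rfl⟩ := Nat.exists_eq_add_of_le ha
  obtain ⟨b, rfl⟩ := Nat.exists_eq_add_of_le hb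
  nlinarith [Nat.zero_le (a * b)]

theorem mixed_mem_nil {A : Set (FreeGroup α)} (h1 : A.Infinite) (h2 : Aᶜ.Infinite) :
    Mixed (· ∈ A) [] := by
  intro x hx
  simp only [PureColor, cyl_nil, Set.mem_univ, true_imp_iff] at hx
  by_cases h : x
  · refine h2 (Set.Finite.subset hx fun g hg => ?_)
    simpa [h] using hg
  · refine h1 (Set.Finite.subset hx fun g hg => ?_)
    simpa [h] using hg

/-- At a mixed vertex all of whose outward refinements are pure, the refinements of the two colors
can be collected into nonempty finite sets. -/
theorem exists_pure_partition {A : Set (FreeGroup α)} {l : List (α × Bool)}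
    (O : Finset (α × Bool)) (hpure : ∀ t ∈ O, ∃ x,
      PureColor (· ∈ A) (l ++ [t]) x) (hmix : ∀ x, ∃ t ∈ O, ¬ PureColor (· ∈ A) (l ++ [t]) x) :
    ∃ P N : Finset (α × Bool), P ∪ N = O ∧ Disjoint P N ∧ P.Nonempty ∧ N.Nonempty ∧
      (∀ t ∈ P, PureColor (· ∈ A) (l ++ [t]) True) ∧
      ∀ t ∈ N, PureColor (· ∈ A) (l ++ [t]) False := by
  classical
  have hpure' : ∀ t ∈ O, ¬ PureColor (· ∈ A) (l ++ [t]) True →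
      PureColor (· ∈ A) (l ++ [t]) False := by
    intro t ht hn
    obtain ⟨x, hx⟩ := hpure t ht
    by_cases h : x
    · rw [eq_true h] at hx
      exact absurd hx hn
    · rwa [eq_false h] at hx
  refine ⟨O.filter fun t => PureColor (· ∈ A) (l ++ [t]) True,
    O.filter fun t => ¬ PureColor (· ∈ A) (l ++ [t]) True, Finset.filter_union_filter_not_eq _ _,
    Finset.disjoint_filter_filter_not _ _ _, ?_, ?_, ?_, ?_⟩
  · obtain ⟨t, ht, h⟩ := hmix False
    exact ⟨t, Finset.mem_filter.mpr ⟨ht, by_contra fun h' => h (hpure' t ht h')⟩⟩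
  · obtain ⟨t, ht, h⟩ := hmix True
    exact ⟨t, Finset.mem_filter.mpr ⟨ht, h⟩⟩
  · exact fun t ht => (Finset.mem_filter.mp ht).2
  · exact fun t ht => hpure' t (Finset.mem_filter.mp ht).1 (Finset.mem_filter.mp ht).2

variable [Fintype α]

theorem isEdgeCut_or_crossBound_of_star {A : Set (FreeGroup α)}
    (hA : ∀ z, (crossing A z).Finite) {P N : Finset (α × Bool)} (hPN : P ∪ N = Finset.univ)
    (hd : Disjoint P N) (hP : P.Nonempty) (hN : N.Nonempty)
    (hPA : ∀ t ∈ P, PureColor (· ∈ A) [t] True) (hNA : ∀ t ∈ N, PureColor (· ∈ A) [t] False) :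
    ((∃ t, (∀ᶠ g in cofinite, g ∈ A ↔ g ∈ cyl [t]) ∨ ∀ᶠ g in cofinite, g ∈ A ↔ g ∉ cyl [t]) ∧
      CrossBound A (Fintype.card (α × Bool) - 1)) ∨
      CrossBound A (2 * Fintype.card (α × Bool) - 4) := by
  have hcard : P.card + N.card = Fintype.card (α × Bool) := by
    rw [← Finset.card_union_of_disjoint hd, hPN, Finset.card_univ]
  have hbd : CrossBound A (P.card * N.card) := by
    obtain ⟨C, hC⟩ := exists_le_crossing hA (l := []) (P := P) (N := N)
      (fun t ht => ⟨FreeGroup.IsReduced.singleton, hPA t ht⟩)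
      (fun t ht => ⟨FreeGroup.IsReduced.singleton, hNA t ht⟩) hd
    refine ⟨C, fun W hW m hm => (hC W hW m hm).trans ?_⟩
    gcongr
    · exact hA _
    · exact Set.inter_subset_left
  have hall : ∀ᶠ g in cofinite, (∀ t ∈ P, g ∈ cyl [t] → g ∈ A) ∧
      (∀ t ∈ N, g ∈ cyl [t] → g ∉ A) ∧ ∃ t, g ∈ cyl [t] := by
    refine ((Finset.eventually_all P).mpr fun t ht => ?_).and
      (((Finset.eventually_all N).mpr fun t ht => ?_).and ?_)
    · exact (hPA t ht).mono fun g hg hgt => by simpa using hg hgt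
    · exact (hNA t ht).mono fun g hg hgt => by simpa using hg hgt
    · filter_upwards [(Set.finite_singleton (1 : FreeGroup α)).eventually_cofinite_notMem]
        with g hg
      rcases mem_cyl_cases (l := []) (g := g) (by simp [cyl_nil]) with h | ⟨t, -, h⟩
      · exact absurd h hg
      · exact ⟨t, h⟩
  have hdisj : ∀ {t t' : α × Bool} {g}, g ∈ cyl [t] → g ∈ cyl [t'] → t = t' := by
    intro t t' g h h'
    rw [mem_cyl_singleton] at h h'
    exact Option.some_injective _ (h.symm.trans h')
  have hmem : ∀ t, t ∈ P ∨ t ∈ N := fun t => by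
    rw [← Finset.mem_union, hPN]; exact Finset.mem_univ t
  have hP1 := hP.card_pos
  have hN1 := hN.card_pos
  by_cases hP2 : P.card = 1
  · left
    obtain ⟨t, rfl⟩ := Finset.card_eq_one.mp hP2
    refine ⟨⟨t, Or.inl ?_⟩, hbd.mono ?_⟩
    · filter_upwards [hall] with g hg
      refine ⟨fun h => ?_, fun h => hg.1 t (by simp) h⟩
      obtain ⟨t', ht'⟩ := hg.2.2
      rcases hmem t' with h' | h'
      · rwa [Finset.mem_singleton.mp h'] at ht'
      · exact absurd h (hg.2.1 t' h' ht')
    · rw [hP2, one_mul]; omega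
  by_cases hN2 : N.card = 1
  · left
    obtain ⟨t, rfl⟩ := Finset.card_eq_one.mp hN2
    refine ⟨⟨t, Or.inr ?_⟩, hbd.mono ?_⟩
    · filter_upwards [hall] with g hg
      refine ⟨fun h h' => hg.2.1 t (by simp) h' h, fun h => ?_⟩
      obtain ⟨t', ht'⟩ := hg.2.2
      rcases hmem t' with h' | h'
      · exact hg.1 t' h' ht'
      · rw [Finset.mem_singleton.mp h'] at ht'
        exact absurd ht' h
    · rw [hN2, mul_one]; omega
  · right
    refine hbd.mono ?_
    have := two_mul_add_le_mul (a := P.card) (b := N.card) (by omega) (by omega)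
    omega

theorem card_filter_isReduced_concat (l : List (α × Bool)) (hl : FreeGroup.IsReduced l)
    [DecidablePred fun t => FreeGroup.IsReduced (l ++ [t])] :
    Fintype.card (α × Bool) - 1 ≤
      (Finset.univ.filter fun t => FreeGroup.IsReduced (l ++ [t])).card := by
  rcases List.eq_nil_or_concat l with rfl | ⟨l, x, rfl⟩
  · simp [FreeGroup.IsReduced.singleton]
  · rw [← Finset.card_univ, ← Finset.card_erase_of_mem (Finset.mem_univ (linv x))]
    refine Finset.card_le_card fun t ht => ?_
    rw [Finset.mem_filter, isReduced_concat_iff]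
    exact ⟨Finset.mem_univ t, hl, by simpa using Finset.ne_of_mem_erase ht⟩

/-- The number of crossings of a nontrivial almost invariant set is large unless the set is almost
a cylinder or the complement of a cylinder. -/
theorem isEdgeCut_or_crossBound (hd : 3 ≤ Fintype.card (α × Bool)) {A : Set (FreeGroup α)}
    (hA : ∀ z, (crossing A z).Finite) (h1 : A.Infinite) (h2 : Aᶜ.Infinite) :
    IsEdgeCut A ∧ CrossBound A (Fintype.card (α × Bool) - 1) ∨
      CrossBound A (2 * Fintype.card (α × Bool) - 4) := by
  classical
  have hne : Nonempty α := by
    by_contra h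
    rw [not_nonempty_iff] at h
    simp at hd
  obtain ⟨l, -, hl, hleaf⟩ := exists_leaf (almostInvariant_mem hA) (mixed_mem_nil h1 h2)
  have hred := hl.isReduced
  set B : Set (FreeGroup α) := (FreeGroup.mk l * ·) ⁻¹' A with hB
  have hBA : ∀ z, (crossing B z).Finite := fun z => by
    rw [hB, crossing_preimage_mul_left]
    exact (hA z).preimage (mul_right_injective _).injOn
  have hpure : ∀ t, FreeGroup.IsReduced (l ++ [t]) → ∀ x,
      (PureColor (· ∈ A) (l ++ [t]) x ↔ PureColor (· ∈ B) [t] x) := fun t ht x =>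
    pureColor_append_iff ht (by simp)
  have hmixO : ∀ x, ∃ t, FreeGroup.IsReduced (l ++ [t]) ∧ ¬ PureColor (· ∈ B) [t] x := by
    intro x
    by_contra! hcon
    exact hl x (pureColor_of_forall_concat fun t ht => (hpure t ht x).mpr (hcon t ht))
  have hmixB : Mixed (· ∈ B) [] := by
    intro x hx
    obtain ⟨t, -, h⟩ := hmixO x
    exact h (hx.mono fun g hg hgt => hg (cyl_mono (by simp) hgt))
  by_cases hstar : ∀ t, ∃ x, PureColor (· ∈ B) [t] x
  · obtain ⟨P, N, hPN, hdisj, hP, hN, hPA, hNA⟩ := exists_pure_partition (l := []) Finset.univ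
      (fun t _ => hstar t)
      (fun x => let ⟨t, _, ht⟩ := hmixO x; ⟨t, Finset.mem_univ t, ht⟩)
    rcases isEdgeCut_or_crossBound_of_star hBA hPN hdisj hP hN hPA hNA with ⟨⟨t, h⟩, h'⟩ | h
    · exact Or.inl ⟨isEdgeCut_of_preimage_mul_left hred h, crossBound_preimage_mul_left.mp h'⟩
    · exact Or.inr (crossBound_preimage_mul_left.mp h)
  · right
    push Not at hstar
    obtain ⟨s, hs⟩ := hstar
    have hsO : ¬ FreeGroup.IsReduced (l ++ [s]) := by
      intro h
      obtain ⟨x, hx⟩ := hleaf s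
      exact hs x ((hpure s h x).mp hx)
    set O := Finset.univ.filter fun t => FreeGroup.IsReduced (l ++ [t]) with hO
    obtain ⟨P, N, hPN, hdisj, hP, hN, hPA, hNA⟩ := exists_pure_partition (l := []) O
      (fun t ht => by
        obtain ⟨x, hx⟩ := hleaf t
        exact ⟨x, (hpure t (Finset.mem_filter.mp ht).2 x).mp hx⟩)
      (fun x => let ⟨t, ht, ht'⟩ := hmixO x;
        ⟨t, Finset.mem_filter.mpr ⟨Finset.mem_univ t, ht⟩, ht'⟩)
    obtain ⟨l', hl', hmix', hleaf'⟩ := exists_leaf (almostInvariant_mem hBA) hs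
    set O' := Finset.univ.filter fun t => FreeGroup.IsReduced (l' ++ [t]) with hO'
    obtain ⟨P', N', hPN', hdisj', hP', hN', hPA', hNA'⟩ := exists_pure_partition O'
      (fun t _ => hleaf' t)
      (fun x => by
        by_contra! hcon
        exact hmix' x (pureColor_of_forall_concat fun t ht =>
          hcon t (Finset.mem_filter.mpr ⟨Finset.mem_univ t, ht⟩)))
    obtain ⟨C, hC⟩ := exists_le_crossing hBA (l := []) (P := P) (N := N)
      (fun t ht => ⟨FreeGroup.IsReduced.singleton, hPA t ht⟩)
      (fun t ht => ⟨FreeGroup.IsReduced.singleton, hNA t ht⟩) hdisj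
    have hO'red : ∀ t ∈ O', FreeGroup.IsReduced (l' ++ [t]) := fun t ht =>
      (Finset.mem_filter.mp ht).2
    obtain ⟨C', hC'⟩ := exists_le_crossing hBA (l := l') (P := P') (N := N')
      (fun t ht => ⟨hO'red t (hPN' ▸ Finset.mem_union_left _ ht), hPA' t ht⟩)
      (fun t ht => ⟨hO'red t (hPN' ▸ Finset.mem_union_right _ ht), hNA' t ht⟩)
      hdisj'
    refine (crossBound_preimage_mul_left (v := FreeGroup.mk l)).mp ⟨C + C', fun W hW m hm => ?_⟩
    have e1 := hC W hW m hm
    have e2 := hC' W hW m hm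
    have c1 : Fintype.card (α × Bool) - 1 ≤ P.card + N.card := by
      rw [← Finset.card_union_of_disjoint hdisj, hPN]
      exact card_filter_isReduced_concat l hred
    have c2 : Fintype.card (α × Bool) - 1 ≤ P'.card + N'.card := by
      rw [← Finset.card_union_of_disjoint hdisj', hPN']
      exact card_filter_isReduced_concat l' hmix'.isReduced
    have c3 := add_le_mul_add_one hP.card_pos hN.card_pos
    have c4 := add_le_mul_add_one hP'.card_pos hN'.card_pos
    have hfin := hBA (FreeGroup.mk W)
    have hun := Set.ncard_union_eq (s := crossing B (FreeGroup.mk W) ∩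
        {g | ∃ t ∈ P ∪ N, g ∈ cyl ([] ++ [t])}) (t := crossing B (FreeGroup.mk W) ∩
        {g | ∃ t ∈ P' ∪ N', g ∈ cyl (l' ++ [t])}) (by
          rw [Set.disjoint_left]
          rintro g ⟨-, t, ht, hgt⟩ ⟨-, t', -, hgt'⟩
          rw [hPN] at ht
          have hgs : g ∈ cyl [s] := cyl_mono (hl'.trans (List.prefix_append _ _)) hgt'
          rw [List.nil_append, mem_cyl_singleton] at hgt
          rw [mem_cyl_singleton] at hgs
          rw [hgt, Option.some.injEq] at hgs
          exact hsO (hgs ▸ (Finset.mem_filter.mp ht).2))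
        (hfin.subset Set.inter_subset_left) (hfin.subset Set.inter_subset_left)
    have hle := Set.ncard_le_ncard (Set.union_subset (Set.inter_subset_left (s := crossing B
      (FreeGroup.mk W)) (t := {g | ∃ t ∈ P ∪ N, g ∈ cyl ([] ++ [t])})) (Set.inter_subset_left
      (s := crossing B (FreeGroup.mk W)) (t := {g | ∃ t ∈ P' ∪ N', g ∈ cyl (l' ++ [t])}))) hfin
    have key : (2 * Fintype.card (α × Bool) - 4) * m ≤
        P.card * N.card * m + P'.card * N'.card * m := by
      rw [← Nat.add_mul]
      exact Nat.mul_le_mul_right m (by omega)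
    rw [← hB]
    omega

end Cuts

section Automorphisms

variable {α : Type*}

theorem crossing_mul_subset (A : Set (FreeGroup α)) (z w : FreeGroup α) :
    crossing A (z * w) ⊆ crossing A z ∪ (· * z) ⁻¹' crossing A w := by
  intro g hg
  simp only [crossing, Set.mem_union, Set.mem_preimage, Set.mem_ofPred_eq, mul_assoc] at hg ⊢
  tauto

theorem crossing_preimage_mulEquiv (β : FreeGroup α ≃* FreeGroup α) (A : Set (FreeGroup α))
    (z : FreeGroup α) : crossing (β ⁻¹' A) z = β ⁻¹' crossing A (β z) := by
  ext g
  simp [crossing]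

theorem ncard_preimage_mulEquiv (β : FreeGroup α ≃* FreeGroup α) (S : Set (FreeGroup α)) :
    (β ⁻¹' S).ncard = S.ncard :=
  Set.ncard_preimage_of_injective_subset_range β.injective
    (by rw [β.surjective.range_eq]; exact Set.subset_univ _)

variable [DecidableEq α]

theorem crossing_cyl_letter_subset (x s : α × Bool) :
    crossing (cyl [x]) (FreeGroup.mk [s]) ⊆
      ((if x = s then {1} else ∅) ∪ if x = linv s then {FreeGroup.mk [linv s]} else ∅ :
        Finset (FreeGroup α)) := by
  intro g hg
  obtain ⟨l, hl, rfl⟩ : ∃ l, FreeGroup.IsReduced l ∧ FreeGroup.mk l = g :=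
    ⟨g.toWord, FreeGroup.isReduced_toWord, FreeGroup.mk_toWord⟩
  simp only [crossing, Set.mem_ofPred_eq, mem_cyl_singleton] at hg
  rw [← mk_append, toWord_mk_of_isReduced hl] at hg
  by_cases hls : FreeGroup.IsReduced (l ++ [s])
  · rw [toWord_mk_of_isReduced hls] at hg
    rcases l with _ | ⟨y, l⟩
    · simp only [List.head?_nil, List.nil_append, List.head?_cons, Option.some.injEq] at hg
      have : x = s := by
        by_contra hne
        exact hg ⟨fun h => by simp at h, fun h => absurd h.symm hne⟩
      simp [this, mk_nil]
    · simp at hg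
  · rw [isReduced_concat_iff] at hls
    push Not at hls
    obtain ⟨y, hy, rfl⟩ := hls hl
    obtain ⟨l', rfl⟩ := List.getLast?_eq_some_iff.mp hy
    have h1 : FreeGroup.mk (l' ++ [y] ++ [linv y]) = FreeGroup.mk l' := by
      rw [mk_append, mk_append, mk_linv, mul_inv_cancel_right]
    rw [h1, toWord_mk_of_isReduced (hl.of_isInfix ⟨[], [y], by simp⟩)] at hg
    rcases l' with _ | ⟨y', l'⟩
    · simp only [List.head?_nil, List.nil_append, List.head?_cons, Option.some.injEq] at hg
      have : x = y := by
        by_contra hne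
        exact hg ⟨fun h => absurd h.symm hne, fun h => by simp at h⟩
      simp [this]
    · simp at hg

theorem finite_crossing_cyl (x : α × Bool) (V : List (α × Bool)) :
    (crossing (cyl [x]) (FreeGroup.mk V)).Finite := by
  induction V with
  | nil => simp [crossing, mk_nil]
  | cons s V ih =>
    rw [mk_cons]
    refine Set.Finite.subset (Set.Finite.union ?_ ?_) (crossing_mul_subset _ _ _)
    · exact (Finset.finite_toSet _).subset (crossing_cyl_letter_subset x s)
    · exact ih.preimage (mul_left_injective _).injOn

theorem ncard_crossing_cyl_cons (x s : α × Bool) (V : List (α × Bool)) :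
    (crossing (cyl [x]) (FreeGroup.mk (s :: V))).ncard ≤
      ((if x = s then 1 else 0) + if x = linv s then 1 else 0) +
        (crossing (cyl [x]) (FreeGroup.mk V)).ncard := by
  have h1 : (crossing (cyl [x]) (FreeGroup.mk [s])).ncard ≤
      (if x = s then 1 else 0) + if x = linv s then 1 else 0 := by
    refine (Set.ncard_le_ncard (crossing_cyl_letter_subset x s) (Finset.finite_toSet _)).trans ?_
    rw [Set.ncard_coe_finset]
    refine (Finset.card_union_le _ _).trans ?_
    split_ifs <;> simp
  have h2 : ((· * FreeGroup.mk [s]) ⁻¹' crossing (cyl [x]) (FreeGroup.mk V)).ncard =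
      (crossing (cyl [x]) (FreeGroup.mk V)).ncard :=
    Set.ncard_preimage_of_injective_subset_range (mul_left_injective _)
      (by rw [(mul_right_surjective _).range_eq]; exact Set.subset_univ _)
  rw [mk_cons]
  refine (Set.ncard_le_ncard (crossing_mul_subset _ _ _) ?_).trans ?_
  · exact (finite_crossing_cyl x [s]).union
      ((finite_crossing_cyl x V).preimage (mul_left_injective _).injOn)
  · exact (Set.ncard_union_le _ _).trans (by omega)

/-- Two letters suffice to tell a singleton cylinder from any other. -/
theorem eq_singleton_of_eventually (hd : ∀ a b : α × Bool, ∃ c, c ≠ a ∧ c ≠ b) {t : α × Bool}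
    {l : List (α × Bool)} (hl : l ≠ [])
    (h : ∀ᶠ g in cofinite, g ∈ cyl [t] → g ∈ cyl l) : l = [t] := by
  have hne : Nonempty α := ⟨t.1⟩
  obtain ⟨t', l, rfl⟩ := List.exists_cons_of_ne_nil hl
  have ht : t' = t := by
    obtain ⟨g, hg, hg'⟩ := exists_mem_cyl_of_eventually (FreeGroup.IsReduced.singleton (a := t)) h
    have h1 := cyl_mono (show [t'] <+: t' :: l by simp) (hg' hg)
    rw [mem_cyl_singleton] at h1 hg
    exact Option.some_injective _ (h1.symm.trans hg)
  subst ht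
  rcases l with _ | ⟨u, l⟩
  · rfl
  · obtain ⟨u', hu', hu''⟩ := hd u (linv t')
    have hred : FreeGroup.IsReduced ([t'] ++ [u']) := by
      rw [isReduced_concat_iff]
      exact ⟨FreeGroup.IsReduced.singleton, by simpa using hu''⟩
    obtain ⟨g, hg, hg'⟩ := exists_mem_cyl_of_eventually hred h
    have h1 := cyl_mono (show [t'] ++ [u] <+: t' :: u :: l by simp)
      (hg' (cyl_mono (List.prefix_append _ _) hg))
    exact absurd h1 (disjoint_cyl_concat hu' hg)

theorem eq_of_mem_cyl_singleton {t t' : α × Bool} {g : FreeGroup α} (h : g ∈ cyl [t])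
    (h' : g ∈ cyl [t']) : t = t' := by
  rw [mem_cyl_singleton] at h h'
  exact Option.some_injective _ (h.symm.trans h')

theorem eq_one_of_eventually_translate (hd : ∀ a b : α × Bool, ∃ c, c ≠ a ∧ c ≠ b)
    {a b : α × Bool} {c : FreeGroup α}
    (h : ∀ᶠ u in cofinite, u ∈ cyl [a] ↔ c * u ∈ cyl [b]) : c = 1 ∧ a = b := by
  have hne : Nonempty α := ⟨a.1⟩
  obtain ⟨r, hr, hrc⟩ : ∃ l, FreeGroup.IsReduced l ∧ FreeGroup.mk l = c⁻¹ :=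
    ⟨c⁻¹.toWord, FreeGroup.isReduced_toWord, FreeGroup.mk_toWord⟩
  obtain rfl : c = (FreeGroup.mk r)⁻¹ := by rw [hrc, inv_inv]
  by_cases hrb : FreeGroup.IsReduced (r ++ [b])
  · simp only [← mem_cyl_append_iff hrb (by simp : [b] ≠ [])] at h
    have := eq_singleton_of_eventually hd (by simp) (h.mono fun g hg => hg.mp)
    rcases r with _ | ⟨y, r⟩
    · simp only [List.nil_append, List.cons.injEq, and_true] at this
      exact ⟨by simp [mk_nil], this.symm⟩
    · simp at this
  · exfalso
    rw [isReduced_concat_iff] at hrb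
    push Not at hrb
    obtain ⟨y, hy, rfl⟩ := hrb hr
    obtain ⟨r', rfl⟩ := List.getLast?_eq_some_iff.mp hy
    simp only [mem_cyl_linv_getLast_iff hr] at h
    obtain ⟨r0, r1, hr1⟩ := List.exists_cons_of_ne_nil (show r' ++ [y] ≠ [] by simp)
    obtain ⟨t, ht, ht'⟩ := hd a r0
    obtain ⟨g, hg, hg'⟩ := exists_mem_cyl_of_eventually (FreeGroup.IsReduced.singleton (a := t)) h
    refine ht (eq_of_mem_cyl_singleton hg (hg'.mpr fun hgr => ht' ?_))
    exact eq_of_mem_cyl_singleton hg (cyl_mono (by rw [hr1]; simp) hgr)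

theorem IsEdgeCut.preimage_mul_left {A : Set (FreeGroup α)} (h : IsEdgeCut A) (v : FreeGroup α) :
    IsEdgeCut ((v * ·) ⁻¹' A) := by
  obtain ⟨l, hl, hred, h⟩ := h
  obtain ⟨l, y, rfl⟩ := (List.eq_nil_or_concat l).resolve_left hl
  rw [List.concat_eq_append] at hred h
  simp only [mem_cyl_append_iff hred (by simp : [y] ≠ [])] at h
  refine isEdgeCut_of_preimage_mul_left (l := (v⁻¹ * FreeGroup.mk l).toWord) (t := y)
    FreeGroup.isReduced_toWord ?_
  refine h.imp (fun h => ?_) (fun h => ?_) <;>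
  · filter_upwards [(tendsto_mul_left_cofinite (FreeGroup.mk l)).eventually h] with g hg
    rw [inv_mul_cancel_left] at hg
    rw [← hg, FreeGroup.mk_toWord, Set.mem_preimage, mul_assoc, mul_inv_cancel_left]

theorem exists_ne_ne [Fintype α] (hd : 3 ≤ Fintype.card (α × Bool)) (a b : α × Bool) :
    ∃ c, c ≠ a ∧ c ≠ b := by
  have : ({a, b} : Finset (α × Bool)).card < Fintype.card (α × Bool) :=
    (Finset.card_le_two).trans_lt (by omega)
  obtain ⟨c, hc⟩ := Finset.exists_mem_notMem_of_card_lt_card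
    (t := Finset.univ) (s := {a, b}) (by rwa [Finset.card_univ])
  exact ⟨c, by simpa using hc⟩

section Simple

variable (β : FreeGroup α ≃* FreeGroup α)

theorem infinite_preimage_cyl (x : α × Bool) : (β ⁻¹' cyl [x]).Infinite :=
  (cyl_singleton_infinite x).preimage (by rw [β.surjective.range_eq]; exact Set.subset_univ _)

theorem finite_crossing_preimage_cyl (x : α × Bool) (z : FreeGroup α) :
    (crossing (β ⁻¹' cyl [x]) z).Finite := by
  rw [crossing_preimage_mulEquiv, ← FreeGroup.mk_toWord (x := β z)]
  exact (finite_crossing_cyl x _).preimage β.injective.injOn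

variable [Fintype α]

theorem sum_ncard_crossing_cyl_le (V : List (α × Bool)) :
    ∑ x : α × Bool, (crossing (cyl [x]) (FreeGroup.mk V)).ncard ≤ 2 * V.length := by
  induction V with
  | nil => simp [crossing, mk_nil]
  | cons s V ih =>
    refine (Finset.sum_le_sum fun x _ => ncard_crossing_cyl_cons x s V).trans ?_
    rw [Finset.sum_add_distrib, Finset.sum_add_distrib]
    simp only [Finset.sum_ite_eq', Finset.mem_univ, if_true, List.length_cons]
    omega

theorem almostInvariant_head :
    AlmostInvariant fun g => (β g).toWord.head? := by
  intro z
  refine (Set.finite_iUnion fun x => finite_crossing_preimage_cyl β x z).subset fun g hg => ?_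
  have hg' : (β g).toWord.head? ≠ (β (g * z)).toWord.head? := hg
  simp only [Set.mem_iUnion, crossing, Set.mem_ofPred_eq, Set.mem_preimage, mem_cyl_singleton]
  by_contra! hcon
  exact hg' (Option.ext fun x => hcon x)

/-- If all the preimages of the one-letter cylinders are edge cuts, they are simultaneously the
translates of the one-letter cylinders. -/
theorem exists_eventually_translate (hd : 3 ≤ Fintype.card (α × Bool))
    (h : ∀ x, IsEdgeCut (β ⁻¹' cyl [x])) :
    ∃ (v : FreeGroup α) (τ : α × Bool → α × Bool),
      ∀ x, ∀ᶠ g in cofinite, β (v * g) ∈ cyl [x] ↔ g ∈ cyl [τ x] := by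
  classical
  have hd3 := exists_ne_ne hd
  have hne : Nonempty (α × Bool) := Fintype.card_pos_iff.mp (by omega)
  have hneα : Nonempty α := ⟨hne.some.1⟩
  have hmix : Mixed (fun g => (β g).toWord.head?) [] := by
    intro o ho
    simp only [PureColor, cyl_nil, Set.mem_univ, true_imp_iff] at ho
    obtain ⟨x, hx⟩ : ∃ x, some x ≠ o := by
      rcases o with _ | y
      · exact ⟨hne.some, by simp⟩
      · obtain ⟨c, hc, -⟩ := hd3 y y
        exact ⟨c, by simpa using hc⟩
    refine infinite_preimage_cyl β x (Set.Finite.subset ho fun g hg hgo => hx ?_)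
    rw [Set.mem_preimage, mem_cyl_singleton] at hg
    rw [← hg, hgo]
  obtain ⟨l, -, hl, hleaf⟩ := exists_leaf (almostInvariant_head β) hmix
  have hred := hl.isReduced
  set v := FreeGroup.mk l with hv
  set D : α × Bool → Set (FreeGroup α) := fun x => (v * ·) ⁻¹' (β ⁻¹' cyl [x]) with hD
  have hDcut : ∀ x, IsEdgeCut (D x) := fun x => (h x).preimage_mul_left v
  have hDdisj : ∀ {x y g}, g ∈ D x → g ∈ D y → x = y := fun h h' => eq_of_mem_cyl_singleton h h'
  have hDinf : ∀ x, (D x).Infinite := fun x =>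
    (infinite_preimage_cyl β x).preimage
      (by rw [(mul_left_surjective v).range_eq]; exact Set.subset_univ _)
  have hDcover : ∀ᶠ g in cofinite, ∃ x, g ∈ D x := by
    filter_upwards [((Set.finite_singleton (1 : FreeGroup α)).preimage
      ((β.injective.comp (mul_right_injective v)).injOn)).eventually_cofinite_notMem] with g hg
    rcases mem_cyl_cases (l := []) (g := β (v * g)) (by simp [cyl_nil]) with h | ⟨t, -, h⟩
    · exact absurd h hg
    · exact ⟨t, h⟩
  set O := Finset.univ.filter fun t => FreeGroup.IsReduced (l ++ [t]) with hO
  have hOcard : Fintype.card (α × Bool) - 1 ≤ O.card := card_filter_isReduced_concat l hred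
  have hOx : ∀ t ∈ O, ∃ x, ∀ᶠ g in cofinite, g ∈ cyl [t] → g ∈ D x := by
    intro t ht
    obtain ⟨o, ho⟩ := hleaf t
    rw [pureColor_append_iff (Finset.mem_filter.mp ht).2 (by simp)] at ho
    obtain ⟨g, hg, ⟨x, hx⟩, hgo⟩ := exists_mem_cyl_of_eventually
      (FreeGroup.IsReduced.singleton (a := t)) (hDcover.and ho)
    refine ⟨x, ho.mono fun g' hg' hgt => ?_⟩
    simp only [hD, Set.mem_preimage, mem_cyl_singleton] at hx ⊢
    exact (hg' hgt).trans ((hgo hg).symm.trans hx)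
  have hOne : ∀ x, ∃ t ∈ O, ¬ ∀ᶠ g in cofinite, g ∈ cyl [t] → g ∈ D x := by
    intro x
    by_contra! hcon
    refine hl (some x) (pureColor_of_forall_concat fun t ht => ?_)
    rw [pureColor_append_iff ht (by simp)]
    filter_upwards [hcon t (Finset.mem_filter.mpr ⟨Finset.mem_univ t, ht⟩)] with g hg hgt
    simpa [hD, mem_cyl_singleton] using hg hgt
  have hkey : ∀ t ∈ O, ∃ x, ∀ᶠ g in cofinite, g ∈ D x ↔ g ∈ cyl [t] := by
    intro t ht
    obtain ⟨x, hx⟩ := hOx t ht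
    refine ⟨x, ?_⟩
    obtain ⟨l', hl', hred', h' | h'⟩ := hDcut x
    · obtain rfl := eq_singleton_of_eventually hd3 hl' (t := t)
        (hx.mp (h'.mono fun g h1 h2 h3 => h1.mp (h2 h3)))
      exact h'
    · exfalso
      obtain ⟨t', l'', rfl⟩ := List.exists_cons_of_ne_nil hl'
      have hsub : ∀ u, u ≠ t' → ∀ᶠ g in cofinite, g ∈ cyl [u] → g ∈ D x := fun u hu =>
        h'.mono fun g hg hgu => hg.mpr fun hgl =>
          hu (eq_of_mem_cyl_singleton hgu (cyl_mono (by simp) hgl))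
      obtain ⟨u, huO, hu⟩ := hOne x
      obtain rfl : u = t' := by_contra fun hne => hu (hsub u hne)
      obtain ⟨y, hy⟩ := hOx u huO
      obtain ⟨z, hzx, hzy⟩ := hd3 x y
      have hall : ∀ᶠ g in cofinite, (∀ u', u' ≠ u → g ∈ cyl [u'] → g ∈ D x) ∧ g ≠ 1 := by
        refine (eventually_all.mpr fun u' => ?_).and ?_
        · by_cases hu' : u' = u
          · exact Eventually.of_forall fun g hg => absurd hu' hg
          · exact (hsub u' hu').mono fun g hg _ => hg
        · exact (Set.finite_singleton (1 : FreeGroup α)).eventually_cofinite_notMem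
      refine hDinf z (Set.Finite.subset (hall.and hy) fun g hg hcon => ?_)
      rcases mem_cyl_cases (l := []) (g := g) (by simp [cyl_nil]) with h | ⟨u', -, h⟩
      · exact hcon.1.2 h
      · by_cases hu' : u' = u
        · subst hu'
          exact hzy (hDdisj hg (hcon.2 h))
        · exact hzx (hDdisj hg (hcon.1.1 u' hu' h))
  choose! f hf using hkey
  have hfinj : Set.InjOn f O := by
    intro t ht t' ht' htt
    obtain ⟨g, hg, h1, h2⟩ := exists_mem_cyl_of_eventually
      (FreeGroup.IsReduced.singleton (a := t)) ((hf t ht).and (hf t' ht'))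
    rw [htt] at h1
    exact eq_of_mem_cyl_singleton hg (h2.mp (h1.mpr hg))
  suffices hx : ∀ x, ∃ t, ∀ᶠ g in cofinite, g ∈ D x ↔ g ∈ cyl [t] by
    choose τ hτ using hx
    exact ⟨v, τ, hτ⟩
  intro x
  by_cases hxO : ∃ t ∈ O, f t = x
  · obtain ⟨t, ht, rfl⟩ := hxO
    exact ⟨t, hf t ht⟩
  have himg : O.image f ⊆ Finset.univ.erase x := by
    intro y hy
    obtain ⟨t, ht, rfl⟩ := Finset.mem_image.mp hy
    exact Finset.mem_erase.mpr ⟨fun h => hxO ⟨t, ht, h⟩, Finset.mem_univ _⟩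
  have hcimg : (O.image f).card = O.card := Finset.card_image_of_injOn hfinj
  have hce : (Finset.univ.erase x).card = Fintype.card (α × Bool) - 1 := by
    rw [Finset.card_erase_of_mem (Finset.mem_univ x), Finset.card_univ]
  have himg' : O.image f = Finset.univ.erase x :=
    Finset.eq_of_subset_of_card_le himg (by omega)
  obtain ⟨s, -, hs⟩ := Finset.exists_mem_notMem_of_card_lt_card
    (t := Finset.univ) (s := O) (by rw [Finset.card_univ, ← hcimg, himg', hce]; omega)
  have hOs : O = Finset.univ.erase s := by
    apply Finset.eq_of_subset_of_card_le
    · exact fun t ht => Finset.mem_erase.mpr ⟨fun h => hs (h ▸ ht), Finset.mem_univ _⟩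
    · rw [Finset.card_erase_of_mem (Finset.mem_univ s), Finset.card_univ]
      exact hOcard
  refine ⟨s, ?_⟩
  filter_upwards [(Finset.eventually_all O).mpr hf, hDcover,
    (Set.finite_singleton (1 : FreeGroup α)).eventually_cofinite_notMem] with g h1 h2 h3
  obtain ⟨t, hgt⟩ : ∃ t, g ∈ cyl [t] := by
    rcases mem_cyl_cases (l := []) (g := g) (by simp [cyl_nil]) with h | ⟨t, -, h⟩
    · exact absurd h h3
    · exact ⟨t, h⟩
  constructor
  · intro hg
    by_cases ht : t ∈ O
    · exact absurd ⟨t, ht, hDdisj ((h1 t ht).mpr hgt) hg⟩ hxO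
    · have : t = s := by
        by_contra hts
        exact ht (hOs ▸ Finset.mem_erase.mpr ⟨hts, Finset.mem_univ t⟩)
      exact this ▸ hgt
  · intro hg
    obtain ⟨y, hy⟩ := h2
    by_cases hyx : y = x
    · exact hyx ▸ hy
    · have : y ∈ O.image f := by
        rw [himg']
        exact Finset.mem_erase.mpr ⟨hyx, Finset.mem_univ y⟩
      obtain ⟨u, hu, rfl⟩ := Finset.mem_image.mp this
      have := eq_of_mem_cyl_singleton ((h1 u hu).mp hy) hg
      exact absurd (this ▸ hu) hs

/-- An automorphism for which all the preimages of the one-letter cylinders are edge cuts is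
conjugate to a permutation of the letters. -/
theorem exists_conj_perm_of_isEdgeCut (hd : 3 ≤ Fintype.card (α × Bool))
    (h : ∀ x, IsEdgeCut (β ⁻¹' cyl [x])) :
    ∃ (v : FreeGroup α) (τ : Equiv.Perm (α × Bool)), (∀ x, τ (linv x) = linv (τ x)) ∧
      ∀ x, β.symm (FreeGroup.mk [x]) = v * FreeGroup.mk [τ x] * v⁻¹ := by
  obtain ⟨v, τ, hτ⟩ := exists_eventually_translate β hd h
  have hneα : Nonempty α := by
    have : Nonempty (α × Bool) := Fintype.card_pos_iff.mp (by omega)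
    exact ⟨this.some.1⟩
  have hinj : Function.Injective τ := by
    intro x y hxy
    obtain ⟨g, hg, h1, h2⟩ := exists_mem_cyl_of_eventually
      (FreeGroup.IsReduced.singleton (a := τ x)) ((hτ x).and (hτ y))
    exact eq_of_mem_cyl_singleton (h1.mpr hg) (h2.mpr (hxy ▸ hg))
  have hmain : ∀ x, (v⁻¹ * β.symm (FreeGroup.mk [x])⁻¹ * v * FreeGroup.mk [τ x] = 1) ∧
      linv (τ x) = τ (linv x) := by
    intro x
    apply eq_one_of_eventually_translate (exists_ne_ne hd)
    filter_upwards [(tendsto_mul_left_cofinite (FreeGroup.mk [τ x])).eventually (hτ x),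
      (tendsto_mul_left_cofinite (v⁻¹ * β.symm (FreeGroup.mk [x])⁻¹ * v *
        FreeGroup.mk [τ x])).eventually (hτ (linv x))] with u h1 h2
    have h3 := mem_cyl_linv_getLast_iff (l := []) (x := x)
      (g := β (v * (FreeGroup.mk [τ x] * u))) FreeGroup.IsReduced.singleton
    have h4 := mem_cyl_linv_getLast_iff (l := []) (x := τ x)
      (g := FreeGroup.mk [τ x] * u) FreeGroup.IsReduced.singleton
    rw [List.nil_append, inv_mul_cancel_left] at h4
    rw [List.nil_append] at h3
    rw [← h2, h4, ← h1, ← h3]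
    simp only [_root_.map_mul, _root_.map_inv, MulEquiv.apply_symm_apply, mul_assoc,
      mul_inv_cancel_left]
  refine ⟨v, Equiv.ofBijective τ (Finite.injective_iff_bijective.mp hinj),
    fun x => (hmain x).2.symm, fun x => ?_⟩
  have h1 := (hmain x).1
  rw [_root_.map_inv] at h1
  rw [Equiv.ofBijective_apply, eq_mul_inv_iff_mul_eq, eq_comm]
  calc v * FreeGroup.mk [τ x]
      = β.symm (FreeGroup.mk [x]) * v *
        (v⁻¹ * (β.symm (FreeGroup.mk [x]))⁻¹ * v * FreeGroup.mk [τ x]) := by group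
    _ = _ := by rw [h1, mul_one]

/-- An automorphism is conjugate to a permutation of the letters, or it stretches the words in
which every turn is frequent. -/
theorem exists_conj_perm_or_stretch (hd : 4 ≤ Fintype.card (α × Bool)) :
    (∃ (v : FreeGroup α) (τ : Equiv.Perm (α × Bool)), (∀ x, τ (linv x) = linv (τ x)) ∧
      ∀ x, β.symm (FreeGroup.mk [x]) = v * FreeGroup.mk [τ x] * v⁻¹) ∨
    ∃ C, ∀ W, FreeGroup.IsReduced W → ∀ m, (∀ t t', t ≠ t' → m ≤ turn t t' W) →
      ∀ V, FreeGroup.mk V = β (FreeGroup.mk W) →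
        (Fintype.card (α × Bool) ^ 2 - 3) * m ≤ 2 * V.length + C := by
  classical
  have hd3 := exists_ne_ne (show 3 ≤ Fintype.card (α × Bool) by omega)
  have hcinf : ∀ x, (β ⁻¹' cyl [x])ᶜ.Infinite := fun x => by
    obtain ⟨y, hy, -⟩ := hd3 x x
    refine (infinite_preimage_cyl β y).mono fun g hg hgx => ?_
    exact hy (eq_of_mem_cyl_singleton hg hgx)
  have hdich := fun x => isEdgeCut_or_crossBound (by omega) (finite_crossing_preimage_cyl β x)
    (infinite_preimage_cyl β x) (hcinf x)
  by_cases hall : ∀ x, IsEdgeCut (β ⁻¹' cyl [x])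
  · exact Or.inl (exists_conj_perm_of_isEdgeCut β (by omega) hall)
  · right
    push Not at hall
    obtain ⟨x₀, hx₀⟩ := hall
    have h0 := (hdich x₀).resolve_left fun h => hx₀ h.1
    set d := Fintype.card (α × Bool) with hdd
    have hb : ∀ x, CrossBound (β ⁻¹' cyl [x]) (d - 1 + if x = x₀ then d - 3 else 0) := by
      intro x
      split_ifs with hx
      · subst hx
        exact h0.mono (by omega)
      · exact (hdich x).elim (fun h => h.2) fun h => h.mono (by omega)
    choose C hC using hb
    refine ⟨∑ x, C x, fun W hW m hm V hV => ?_⟩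
    have h1 := Finset.sum_le_sum fun x (_ : x ∈ Finset.univ) => hC x W hW m hm
    have h2 := sum_ncard_crossing_cyl_le V
    rw [Finset.sum_add_distrib, ← Finset.sum_mul, Finset.sum_add_distrib, Finset.sum_ite_eq'] at h1
    simp only [crossing_preimage_mulEquiv, ncard_preimage_mulEquiv, ← hV, Finset.mem_univ, if_true,
      Finset.sum_const, Finset.card_univ, smul_eq_mul, ← hdd] at h1
    have h3 : d ^ 2 - 3 = d * (d - 1) + (d - 3) := by
      obtain ⟨e, he⟩ := Nat.exists_eq_add_of_le hd
      rw [he, show 4 + e - 1 = e + 3 by omega, show 4 + e - 3 = e + 1 by omega]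
      have : (4 + e) ^ 2 = (4 + e) * (e + 3) + (e + 1) + 3 := by ring
      omega
    rw [h3]
    omega

end Simple

end Automorphisms

section Blocks

theorem isReduced_append_overlap {α : Type*} {A B C : List (α × Bool)}
    (h1 : FreeGroup.IsReduced (A ++ B))
    (h2 : FreeGroup.IsReduced (B ++ C)) (hB : B ≠ []) : FreeGroup.IsReduced (A ++ (B ++ C)) := by
  rw [← List.append_assoc]
  exact List.IsChain.append_overlap h1 h2 hB

theorem exists_cancellation {α : Type*} {A B : List (α × Bool)} (hA : FreeGroup.IsReduced A)
    (hB : FreeGroup.IsReduced B) : ∃ A₁ X B₂, A = A₁ ++ X ∧ B = FreeGroup.invRev X ++ B₂ ∧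
      FreeGroup.IsReduced (A₁ ++ B₂) := by
  induction A using List.reverseRecOn generalizing B with
  | nil => exact ⟨[], [], B, rfl, by simp [FreeGroup.invRev], by simpa using hB⟩
  | append_singleton A a ih =>
    by_cases h : FreeGroup.IsReduced (A ++ [a] ++ B)
    · exact ⟨A ++ [a], [], B, by simp, by simp [FreeGroup.invRev], h⟩
    · rw [isReduced_append_iff] at h
      push Not at h
      obtain ⟨a', ha', b, hb, rfl⟩ := h hA hB
      obtain rfl : a = a' := by simpa using ha'
      rcases B with _ | ⟨b, B⟩
      · simp at hb
      · obtain rfl : b = linv a := by simpa using hb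
        obtain ⟨A₁, X, B₂, hA', hB', hred⟩ := ih (hA.of_isInfix ⟨[], [a], by simp⟩)
          (isReduced_cons_iff.mp hB).2
        refine ⟨A₁, X ++ [a], B₂, by simp [hA'], ?_, hred⟩
        rw [invRev_concat, hB']
        rfl

variable {α ι : Type*} [DecidableEq α]

/-- The reduced word of the generator, or inverse of a generator, indexed by the letter `y`. -/
def block (w : ι → FreeGroup α) (y : ι × Bool) : List (α × Bool) :=
  (FreeGroup.lift w (FreeGroup.mk [y])).toWord

/-- Long generators without common subwords of length `L`, even after permuting the letters, and in
which every turn is frequent. -/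
structure Generic (w : ι → FreeGroup α) (L D : ℕ) : Prop where
  pos : 1 ≤ L
  long : ∀ y, 20 * L ≤ (block w y).length
  unique : ∀ τ : Equiv.Perm (α × Bool), (∀ x, τ (linv x) = linv (τ x)) → ∀ y y' q q',
    q + L ≤ (block w y).length → q' + L ≤ (block w y').length →
    ((block w y).drop q).take L = (((block w y').drop q').take L).map τ → τ = 1 ∧ y = y' ∧ q = q'
  turns : ∀ y t t', t ≠ t' →
    2 * (block w y).length + D * (4 * L) < D * turn t t' (block w y)

theorem mk_block (w : ι → FreeGroup α) (y : ι × Bool) :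
    FreeGroup.mk (block w y) = FreeGroup.lift w (FreeGroup.mk [y]) := FreeGroup.mk_toWord

theorem isReduced_block (w : ι → FreeGroup α) (y : ι × Bool) : FreeGroup.IsReduced (block w y) :=
  FreeGroup.isReduced_toWord

theorem block_linv (w : ι → FreeGroup α) (y : ι × Bool) :
    block w (linv y) = FreeGroup.invRev (block w y) := by
  rw [block, mk_linv, _root_.map_inv, FreeGroup.toWord_inv, block]

/-- The first letters of a block. -/
def blockInit (w : ι → FreeGroup α) (L : ℕ) (y : ι × Bool) : List (α × Bool) := (block w y).take L

/-- The middle part of a block. -/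
def blockMid (w : ι → FreeGroup α) (L : ℕ) (y : ι × Bool) : List (α × Bool) :=
  ((block w y).drop L).take ((block w y).length - 2 * L)

/-- The last letters of a block. -/
def blockEnd (w : ι → FreeGroup α) (L : ℕ) (y : ι × Bool) : List (α × Bool) :=
  (block w y).drop ((block w y).length - L)

theorem turn_append_le_add_left (t t' : α × Bool) (l m : List (α × Bool)) :
    turn t t' (l ++ m) ≤ turn t t' m + 2 * l.length := by
  induction l with
  | nil => simp
  | cons x l ih =>
    simp only [turn, List.cons_append, pairCount, List.length_cons] at ih ⊢
    split_ifs <;> omega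

theorem turn_append_le_add_right (t t' : α × Bool) (l m : List (α × Bool)) :
    turn t t' (l ++ m) ≤ turn t t' l + 2 * m.length := by
  rw [← turn_invRev t t' (l ++ m), FreeGroup.invRev_append, ← turn_invRev t t' l]
  simpa using turn_append_le_add_left t t' (FreeGroup.invRev m) (FreeGroup.invRev l)

section Generic

variable {w : ι → FreeGroup α} {L D : ℕ}

theorem Generic.block_eq (h : Generic w L D) (y : ι × Bool) :
    block w y = blockInit w L y ++ (blockMid w L y ++ blockEnd w L y) := by
  have h1 := h.long y
  have h2 := h.pos
  have h3 : blockEnd w L y = ((block w y).drop L).drop ((block w y).length - 2 * L) := by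
    rw [blockEnd, List.drop_drop]
    congr 1
    omega
  rw [h3, blockMid, List.take_append_drop, blockInit, List.take_append_drop]

theorem Generic.length_blockInit (h : Generic w L D) (y : ι × Bool) :
    (blockInit w L y).length = L := by
  have h1 := h.long y
  simp only [blockInit, List.length_take]
  omega

theorem Generic.length_blockEnd (h : Generic w L D) (y : ι × Bool) :
    (blockEnd w L y).length = L := by
  have h1 := h.long y
  simp only [blockEnd, List.length_drop]
  omega

theorem Generic.length_blockMid (h : Generic w L D) (y : ι × Bool) :
    (blockMid w L y).length + 2 * L = (block w y).length := by
  have h1 := h.long y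
  simp only [blockMid, List.length_take, List.length_drop]
  omega

theorem Generic.blockMid_ne_nil (h : Generic w L D) (y : ι × Bool) : blockMid w L y ≠ [] := by
  have h1 := h.long y
  have h2 := h.length_blockMid y
  have h3 := h.pos
  intro hn
  rw [hn, List.length_nil] at h2
  omega

theorem Generic.le_turn_blockMid (h : Generic w L D) (y : ι × Bool) {t t' : α × Bool}
    (ht : t ≠ t') : 2 * (block w y).length + 1 ≤ D * turn t t' (blockMid w L y) := by
  have h1 := h.turns y t t' ht
  have h2 : turn t t' (block w y) ≤ turn t t' (blockMid w L y) + 4 * L := by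
    rw [h.block_eq y]
    have e1 := turn_append_le_add_left t t' (blockInit w L y) (blockMid w L y ++ blockEnd w L y)
    have e2 := turn_append_le_add_right t t' (blockMid w L y) (blockEnd w L y)
    rw [h.length_blockInit] at e1
    rw [h.length_blockEnd] at e2
    omega
  have h3 := Nat.mul_le_mul_left D h2
  rw [Nat.mul_add] at h3
  omega

theorem Generic.drop_take_blockMid (h : Generic w L D) (y : ι × Bool) {j : ℕ}
    (hj : j + L ≤ (blockMid w L y).length) :
    ((blockMid w L y).drop j).take L = ((block w y).drop (L + j)).take L ∧
      L + j + L ≤ (block w y).length := by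
  have h1 := h.length_blockMid y
  refine ⟨?_, by omega⟩
  rw [blockMid, List.drop_take, List.take_take, List.drop_drop, min_eq_left (by omega)]

/-- Overlaps of the middle parts of blocks are aligned. -/
theorem Generic.unique_mid (h : Generic w L D) {τ : Equiv.Perm (α × Bool)}
    (hτ : ∀ x, τ (linv x) = linv (τ x)) {y y' : ι × Bool} {j j' : ℕ}
    (hj : j + L ≤ (blockMid w L y).length) (hj' : j' + L ≤ (blockMid w L y').length)
    (heq : ((blockMid w L y).drop j).take L = (((blockMid w L y').drop j').take L).map τ) :
    τ = 1 ∧ y = y' ∧ j = j' := by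
  obtain ⟨e1, e2⟩ := h.drop_take_blockMid y hj
  obtain ⟨e3, e4⟩ := h.drop_take_blockMid y' hj'
  rw [e1, e3] at heq
  obtain ⟨h1, h2, h3⟩ := h.unique τ hτ y y' _ _ e2 e4 heq
  exact ⟨h1, h2, by omega⟩

/-- The reduced words joining the middle parts of consecutive blocks. -/
theorem Generic.exists_gap (h : Generic w L D) : ∃ gap : ι × Bool → Option (ι × Bool) →
    List (α × Bool), ∀ y o, (∀ y' ∈ o, y' ≠ linv y) →
      gap y o ≠ [] ∧ (gap y o).length ≤ 2 * L ∧
      FreeGroup.mk (gap y o) =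
        FreeGroup.mk (blockEnd w L y) * FreeGroup.mk (o.elim [] (blockInit w L)) ∧
      FreeGroup.IsReduced (blockMid w L y ++ gap y o) ∧
      FreeGroup.IsReduced (gap y o ++ o.elim [] (blockMid w L)) := by
  suffices hex : ∀ (y : ι × Bool) (o : Option (ι × Bool)), ∃ g : List (α × Bool),
      (∀ y' ∈ o, y' ≠ linv y) →
      g ≠ [] ∧ g.length ≤ 2 * L ∧
      FreeGroup.mk g = FreeGroup.mk (blockEnd w L y) * FreeGroup.mk (o.elim [] (blockInit w L)) ∧
      FreeGroup.IsReduced (blockMid w L y ++ g) ∧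
      FreeGroup.IsReduced (g ++ o.elim [] (blockMid w L)) by
    choose gap hgap using hex
    exact ⟨gap, hgap⟩
  have hL := h.pos
  intro y o
  have hme : FreeGroup.IsReduced (blockMid w L y ++ blockEnd w L y) :=
    (h.block_eq y ▸ isReduced_block w y).of_isInfix ⟨blockInit w L y, [], by simp⟩
  have he := hme.of_isInfix (L₁ := blockEnd w L y) ⟨blockMid w L y, [], by simp⟩
  rcases o with _ | y'
  · refine ⟨blockEnd w L y, fun _ => ⟨?_, ?_, ?_, hme, ?_⟩⟩
    · rw [← List.length_pos_iff, h.length_blockEnd]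
      exact hL
    · rw [h.length_blockEnd]
      omega
    · simp [mk_nil]
    · simpa using he
  · have him : FreeGroup.IsReduced (blockInit w L y' ++ blockMid w L y') :=
      (h.block_eq y' ▸ isReduced_block w y').of_isInfix ⟨[], blockEnd w L y', by simp⟩
    have hi := him.of_isInfix (L₁ := blockInit w L y') ⟨[], blockMid w L y', by simp⟩
    obtain ⟨A₁, X, B₂, hA, hB, hAB⟩ := exists_cancellation he hi
    refine ⟨A₁ ++ B₂, fun hyy => ?_⟩
    have hyy := hyy y' rfl
    have hlA := congrArg List.length hA
    have hlB := congrArg List.length hB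
    rw [h.length_blockEnd, List.length_append] at hlA
    rw [h.length_blockInit, List.length_append, FreeGroup.invRev_length] at hlB
    have hX : X.length < L := by
      by_contra! hX
      have hA0 : A₁ = [] := List.length_eq_zero_iff.mp (by omega)
      have hB0 : B₂ = [] := List.length_eq_zero_iff.mp (by omega)
      rw [hA0, List.nil_append] at hA
      rw [hB0, List.append_nil, ← hA] at hB
      have h1 := h.long y
      have h2 := h.long y'
      have h3 := block_linv w y
      have h4 : (block w (linv y)).length = (block w y).length := by simp [h3]
      refine hyy (h.unique 1 (fun x => rfl) y' (linv y) 0 0 (by omega) (by omega) ?_).2.1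
      rw [Equiv.Perm.coe_one, List.map_id, List.drop_zero, List.drop_zero]
      rw [blockInit, blockEnd] at hB
      rw [hB, h3, FreeGroup.invRev, FreeGroup.invRev, List.map_drop, List.reverse_drop,
        List.length_map]
      congr 1
      omega
    have hA1 : A₁ ≠ [] := by
      rw [← List.length_pos_iff]
      omega
    have hB2 : B₂ ≠ [] := by
      rw [← List.length_pos_iff]
      omega
    refine ⟨by simp [hA1], ?_, ?_, ?_, ?_⟩
    · rw [List.length_append]
      omega
    · rw [Option.elim_some, hA, hB, mk_append, mk_append, mk_append, ← FreeGroup.inv_mk, mul_assoc,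
        mul_inv_cancel_left]
    · refine isReduced_append_overlap ?_ hAB hA1
      rw [hA] at hme
      exact hme.of_isInfix ⟨[], X, by simp⟩
    · rw [Option.elim_some, List.append_assoc]
      refine isReduced_append_overlap hAB ?_ hB2
      rw [hB] at him
      exact him.of_isInfix ⟨FreeGroup.invRev X, [], by simp⟩

end Generic

end Blocks

section Assemble

variable {ι β : Type*}

/-- Concatenation of words `M y` separated by gaps, with initial gap `X`. -/
def assemble (M : ι → List β) (gap : ι → Option ι → List β) : List β → List ι → List β
  | X, [] => X
  | X, y :: t => X ++ (M y ++ assemble M gap (gap y t.head?) t)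

theorem exists_assemble_eq_append (M : ι → List β) (gap : ι → Option ι → List β) (X : List β)
    (hs : List ι) : ∃ R, assemble M gap X hs = X ++ R := by
  cases hs with
  | nil => exact ⟨[], by simp [assemble]⟩
  | cons y t => exact ⟨_, rfl⟩

end Assemble

section AssembleFree

variable {α ι : Type*} [DecidableEq α] {w : ι → FreeGroup α} {L D : ℕ}
  {gap : ι × Bool → Option (ι × Bool) → List (α × Bool)}

theorem sum_turn_le_turn_assemble (M : ι → List (α × Bool))
    (gap : ι → Option ι → List (α × Bool)) (t t' : α × Bool) (X : List (α × Bool)) (hs : List ι) :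
    (hs.map fun y => turn t t' (M y)).sum ≤ turn t t' (assemble M gap X hs) := by
  induction hs generalizing X with
  | nil => simp
  | cons y hs ih =>
    rw [List.map_cons, List.sum_cons, assemble]
    have h1 := turn_append_le t t' X (M y ++ assemble M gap (gap y hs.head?) hs)
    have h2 := turn_append_le t t' (M y) (assemble M gap (gap y hs.head?) hs)
    have h3 := ih (gap y hs.head?)
    omega

theorem lift_mk_cons (h : Generic w L D) (y : ι × Bool) (hs : List (ι × Bool)) :
    FreeGroup.lift w (FreeGroup.mk (y :: hs)) = FreeGroup.mk (blockInit w L y) *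
      FreeGroup.mk (blockMid w L y) * FreeGroup.mk (blockEnd w L y) *
        FreeGroup.lift w (FreeGroup.mk hs) := by
  rw [mk_cons, _root_.map_mul, ← mk_block, h.block_eq, mk_append, mk_append, mul_assoc]
  simp only [mul_assoc]

theorem mk_assemble (h : Generic w L D) (hgap : ∀ y o, (∀ y' ∈ o, y' ≠ linv y) →
      FreeGroup.mk (gap y o) =
        FreeGroup.mk (blockEnd w L y) * FreeGroup.mk (o.elim [] (blockInit w L)))
    {hs : List (ι × Bool)} (hhs : FreeGroup.IsReduced hs) (X : List (α × Bool)) :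
    FreeGroup.mk (assemble (blockMid w L) gap X hs) = FreeGroup.mk X *
      (FreeGroup.mk (hs.head?.elim [] (blockInit w L)))⁻¹ *
        FreeGroup.lift w (FreeGroup.mk hs) := by
  induction hs generalizing X with
  | nil => simp [assemble, mk_nil]
  | cons y hs ih =>
    obtain ⟨hy, hhs⟩ := isReduced_cons_iff.mp hhs
    rw [assemble, mk_append, mk_append, ih hhs, hgap y _ hy, lift_mk_cons h, List.head?_cons,
      Option.elim_some]
    simp only [mul_assoc, mul_inv_cancel_left, inv_mul_cancel_left]

theorem isReduced_assemble (h : Generic w L D) (hgap : ∀ y o, (∀ y' ∈ o, y' ≠ linv y) →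
      gap y o ≠ [] ∧ FreeGroup.IsReduced (blockMid w L y ++ gap y o) ∧
      FreeGroup.IsReduced (gap y o ++ o.elim [] (blockMid w L)))
    {hs : List (ι × Bool)} (hhs : FreeGroup.IsReduced hs) (X : List (α × Bool))
    (hX : FreeGroup.IsReduced (X ++ hs.head?.elim [] (blockMid w L))) :
    FreeGroup.IsReduced (assemble (blockMid w L) gap X hs) := by
  induction hs generalizing X with
  | nil => simpa [assemble] using hX
  | cons y hs ih =>
    obtain ⟨hy, hhs⟩ := isReduced_cons_iff.mp hhs
    obtain ⟨h1, h2, h3⟩ := hgap y _ hy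
    have h4 := ih hhs _ h3
    rw [assemble]
    refine isReduced_append_overlap (by simpa using hX) ?_ (h.blockMid_ne_nil y)
    obtain ⟨R, hR⟩ := exists_assemble_eq_append (blockMid w L) gap (gap y hs.head?) hs
    rw [hR] at h4 ⊢
    exact isReduced_append_overlap h2 h4 h1

/-- Every long window of an assembled word meets some middle part in a long subword. -/
theorem exists_window (h : Generic w L D) (hgap : ∀ y o, (∀ y' ∈ o, y' ≠ linv y) →
      (gap y o).length ≤ 2 * L ∧ FreeGroup.mk (gap y o) =
        FreeGroup.mk (blockEnd w L y) * FreeGroup.mk (o.elim [] (blockInit w L)))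
    {K : ℕ} (hK0 : 1 ≤ K) (hK : K ≤ 18 * L) {hs : List (ι × Bool)} (hhs : FreeGroup.IsReduced hs)
    (X : List (α × Bool)) (hX : X.length ≤ 2 * L) {s e : ℕ}
    (hse : s + 2 * K + 2 * L ≤ e ∨ s = 0 ∧ K + 2 * L ≤ e)
    (he : e ≤ (assemble (blockMid w L) gap X hs).length) :
    ∃ hs₁ y, ∃ b j, s ≤ b + j ∧ b + j + K ≤ e ∧ j + K ≤ (blockMid w L y).length ∧
      blockMid w L y <+: (assemble (blockMid w L) gap X hs).drop b ∧
      FreeGroup.mk ((assemble (blockMid w L) gap X hs).take b) = FreeGroup.mk X *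
        (FreeGroup.mk (hs.head?.elim [] (blockInit w L)))⁻¹ *
          FreeGroup.lift w (FreeGroup.mk hs₁) * FreeGroup.mk (blockInit w L y) := by
  induction hs generalizing X s e with
  | nil =>
    simp only [assemble] at he
    omega
  | cons y hs ih =>
    obtain ⟨hy, hhs⟩ := isReduced_cons_iff.mp hhs
    obtain ⟨h1, h2⟩ := hgap y _ hy
    have hM := h.length_blockMid y
    have hl := h.long y
    rw [assemble] at he ⊢
    set R := assemble (blockMid w L) gap (gap y hs.head?) hs with hR
    rw [List.length_append, List.length_append] at he
    by_cases hcase : s + K ≤ X.length + (blockMid w L y).length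
    · refine ⟨[], y, X.length, s - X.length, by omega, by omega, by omega, ?_, ?_⟩
      · rw [List.drop_left]
        exact List.prefix_append _ _
      · rw [List.take_left, mk_nil, _root_.map_one, List.head?_cons, Option.elim_some, mul_one,
          inv_mul_cancel_right]
    · have hse' : (s - (X.length + (blockMid w L y).length)) + 2 * K + 2 * L ≤
          e - (X.length + (blockMid w L y).length) ∨
          s - (X.length + (blockMid w L y).length) = 0 ∧
          K + 2 * L ≤ e - (X.length + (blockMid w L y).length) := by omega
      obtain ⟨hs₁, y', b, j, e1, e2, e3, e4, e5⟩ := ih hhs _ h1 hse'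
        (by rw [← hR]; omega)
      refine ⟨y :: hs₁, y', X.length + (blockMid w L y).length + b, j, by omega, by omega, e3,
        ?_, ?_⟩
      · rwa [← List.append_assoc, ← List.length_append, List.drop_length_add_append]
      · rw [← List.append_assoc, ← List.length_append, List.take_length_add_append, mk_append, e5,
          lift_mk_cons h, h2, mk_append]
        simp only [mul_assoc, mul_inv_cancel_left, inv_mul_cancel_left, List.head?_cons,
          Option.elim_some]

end AssembleFree

section Rigidity

/-- Conjugating a long reduced word changes only its ends. -/
theorem exists_conj_overlap {α : Type*} [DecidableEq α] {A B : List (α × Bool)}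
    (hA : FreeGroup.IsReduced A)
    (hB : FreeGroup.IsReduced B) {V : List (α × Bool)} (hV : FreeGroup.IsReduced V)
    (hlen : 2 * V.length < A.length)
    (h : FreeGroup.mk B = FreeGroup.mk V * FreeGroup.mk A * (FreeGroup.mk V)⁻¹) :
    ∃ P M Q P' Q', A = P ++ M ++ Q ∧ B = P' ++ M ++ Q' ∧
      FreeGroup.mk P' = FreeGroup.mk V * FreeGroup.mk P ∧ P.length ≤ V.length ∧
      Q.length ≤ V.length := by
  obtain ⟨V₁, X, A₂, hVe, hAe, h1⟩ := exists_cancellation hV hA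
  subst hVe hAe
  have hA2 : FreeGroup.IsReduced A₂ := hA.of_isInfix ⟨FreeGroup.invRev X, [], by simp⟩
  have hV' : FreeGroup.IsReduced (FreeGroup.invRev (V₁ ++ X)) := isReduced_invRev hV
  obtain ⟨M, Y, V₂, rfl, hY, h2⟩ := exists_cancellation hA2 hV'
  have hYl := congrArg List.length hY
  simp only [FreeGroup.invRev_length, List.length_append] at hYl hlen
  have hM : M ≠ [] := by
    rw [← List.length_pos_iff]
    omega
  have h3 : FreeGroup.IsReduced (V₁ ++ (M ++ V₂)) :=
    isReduced_append_overlap (h1.of_isInfix ⟨[], Y, by simp⟩) h2 hM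
  refine ⟨FreeGroup.invRev X, M, Y, V₁, V₂, by simp, ?_, ?_, by simp, ?_⟩
  · rw [List.append_assoc]
    refine mk_injOn_isReduced hB h3 ?_
    rw [h, FreeGroup.inv_mk, hY]
    simp only [mk_append, ← FreeGroup.inv_mk, mul_assoc, mul_inv_cancel_left]
  · rw [mk_append, ← FreeGroup.inv_mk, mul_inv_cancel_right]
  · rw [List.length_append]
    omega

theorem map_mk_of_conj_perm {α : Type*} {β : FreeGroup α →* FreeGroup α} {v : FreeGroup α}
    {τ : Equiv.Perm (α × Bool)} (h : ∀ x, β (FreeGroup.mk [x]) = v * FreeGroup.mk [τ x] * v⁻¹)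
    (l : List (α × Bool)) : β (FreeGroup.mk l) = v * FreeGroup.mk (l.map τ) * v⁻¹ := by
  induction l with
  | nil => simp [mk_nil]
  | cons x l ih =>
    rw [mk_cons, _root_.map_mul, ih, h, List.map_cons, mk_cons (τ x) (l.map τ)]
    simp only [mul_assoc, inv_mul_cancel_left]

theorem isReduced_map {α : Type*} {τ : Equiv.Perm (α × Bool)} (hτ : ∀ x, τ (linv x) = linv (τ x))
    {l : List (α × Bool)} (hl : FreeGroup.IsReduced l) : FreeGroup.IsReduced (l.map τ) := by
  rw [FreeGroup.IsReduced, List.isChain_map]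
  refine hl.imp fun x y hxy => ?_
  rw [← ne_linv_iff] at hxy ⊢
  rw [← hτ]
  exact fun h => hxy (τ.injective h)

theorem length_le_length_assemble {α ι : Type*} (M : ι → List (α × Bool))
    (gap : ι → Option ι → List (α × Bool)) (X : List (α × Bool)) (hs : List ι)
    (hM : ∀ y, M y ≠ []) : hs.length ≤ (assemble M gap X hs).length := by
  induction hs generalizing X with
  | nil => simp
  | cons y hs ih =>
    have h1 := ih (gap y hs.head?)
    have h2 := List.length_pos_iff.mpr (hM y)
    simp only [assemble, List.length_cons, List.length_append]
    omega

variable {α ι : Type*} [DecidableEq α] {w : ι → FreeGroup α} {L D : ℕ}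

/-- The reduced word of an element of the subgroup contains the middle parts of the blocks. -/
theorem Generic.exists_reduced_word (h : Generic w L D) {hs : List (ι × Bool)}
    (hhs : FreeGroup.IsReduced hs) (hne : hs ≠ []) : ∃ W, FreeGroup.IsReduced W ∧
      FreeGroup.mk W = FreeGroup.lift w (FreeGroup.mk hs) ∧ hs.length ≤ W.length ∧
      (∀ t t', (hs.map fun y => turn t t' (blockMid w L y)).sum ≤ turn t t' W) ∧
      ∀ K s e, 1 ≤ K → K ≤ 18 * L → s + 2 * K + 2 * L ≤ e → e ≤ W.length →
        ∃ hs₁ y, ∃ b j, s ≤ b + j ∧ b + j + K ≤ e ∧ j + K ≤ (blockMid w L y).length ∧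
          blockMid w L y <+: W.drop b ∧
          FreeGroup.mk (W.take b) =
            FreeGroup.lift w (FreeGroup.mk hs₁) * FreeGroup.mk (blockInit w L y) := by
  obtain ⟨gap, hgap⟩ := h.exists_gap
  rcases hs with _ | ⟨z, hs⟩
  · exact absurd rfl hne
  refine ⟨assemble (blockMid w L) gap (blockInit w L z) (z :: hs), ?_, ?_, ?_, ?_, ?_⟩
  · refine isReduced_assemble h (fun y o ho => ?_) hhs _ ?_
    · obtain ⟨h1, h2, h3, h4, h5⟩ := hgap y o ho
      exact ⟨h1, h4, h5⟩
    · have := h.block_eq z ▸ isReduced_block w z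
      exact this.of_isInfix ⟨[], blockEnd w L z, by simp⟩
  · rw [mk_assemble h (fun y o ho => (hgap y o ho).2.2.1) hhs]
    simp only [List.head?_cons, Option.elim_some, mul_inv_cancel, one_mul]
  · exact length_le_length_assemble _ _ _ _ h.blockMid_ne_nil
  · exact fun t t' => sum_turn_le_turn_assemble _ _ _ _ _ _
  · intro K s e hK0 hK hse he
    obtain ⟨hs₁, y, b, j, e1, e2, e3, e4, e5⟩ := exists_window h
      (fun y o ho => ⟨(hgap y o ho).2.1, (hgap y o ho).2.2.1⟩) hK0 hK hhs (blockInit w L z)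
      (by rw [h.length_blockInit]; omega) (Or.inl hse) he
    refine ⟨hs₁, y, b, j, e1, e2, e3, e4, ?_⟩
    rw [e5]
    simp only [List.head?_cons, Option.elim_some, mul_inv_cancel, one_mul]

theorem mk_flatten_replicate (h : List (ι × Bool)) (N : ℕ) :
    FreeGroup.mk (List.replicate N h).flatten = FreeGroup.mk h ^ N := by
  rw [FreeGroup.pow_mk]

theorem mk_flatMap_block (w : ι → FreeGroup α) (h : List (ι × Bool)) :
    FreeGroup.mk (h.flatMap (block w)) = FreeGroup.lift w (FreeGroup.mk h) := by
  induction h with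
  | nil => simp [mk_nil]
  | cons y h ih => rw [List.flatMap_cons, mk_append, ih, mk_cons, _root_.map_mul, mk_block]

theorem take_drop_eq_of_isPrefix {β : Type*} {M W : List β} {b j L : ℕ} (h : M <+: W.drop b)
    (hj : j + L ≤ M.length) : (W.drop (b + j)).take L = (M.drop j).take L := by
  obtain ⟨R, hR⟩ := h
  rw [← List.drop_drop, ← hR, List.drop_append_of_le_length (by omega),
    List.take_append_of_le_length (by rw [List.length_drop]; omega)]

theorem take_add_eq_of_isPrefix {β : Type*} {M W : List β} {b j : ℕ} (h : M <+: W.drop b)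
    (hj : j ≤ M.length) : W.take (b + j) = W.take b ++ M.take j := by
  obtain ⟨R, hR⟩ := h
  rw [List.take_add, ← hR, List.take_append_of_le_length hj]

/-- A common pattern of two words of the subgroup determines the conjugating element. -/
theorem Generic.conj_mem (hG : Generic w L D) {v : FreeGroup α} {τ : Equiv.Perm (α × Bool)}
    (hτ : ∀ x, τ (linv x) = linv (τ x)) {h h' : List (ι × Bool)}
    (hh : FreeGroup.IsReduced h) (hh' : FreeGroup.IsReduced h') (hne' : h' ≠ [])
    (hlong : 2 * v.toWord.length + 10 * L < h.length) {W₀ : List (α × Bool)}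
    (hW₀ : FreeGroup.mk W₀ = FreeGroup.lift w (FreeGroup.mk h))
    (hW₀' : FreeGroup.IsReduced W₀)
    (hconj : FreeGroup.lift w (FreeGroup.mk h') = v * FreeGroup.mk (W₀.map τ) * v⁻¹) :
    τ = 1 ∧ v ∈ (FreeGroup.lift w).range := by
  have hL := hG.pos
  have hne : h ≠ [] := by
    rintro rfl
    simp at hlong
  obtain ⟨W, hW, hWφ, hWl, -, hWw⟩ := hG.exists_reduced_word hh hne
  obtain ⟨W', hW', hWφ', -, -, hWw'⟩ := hG.exists_reduced_word hh' hne'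
  obtain rfl : W = W₀ := mk_injOn_isReduced hW hW₀' (hWφ.trans hW₀.symm)
  have hA : FreeGroup.IsReduced (W.map τ) := isReduced_map hτ hW
  obtain ⟨P, M, Q, P', Q', hAe, hBe, hP, hPl, hQl⟩ := exists_conj_overlap hA hW'
    (FreeGroup.isReduced_toWord (x := v)) (by rw [List.length_map]; omega)
    (by rw [FreeGroup.mk_toWord, hWφ', hconj])
  rw [FreeGroup.mk_toWord] at hP
  have hlA := congrArg List.length hAe
  have hlB := congrArg List.length hBe
  simp only [List.length_map, List.length_append] at hlA hlB
  obtain ⟨hs₁, y, b, j, e1, e2, e3, e4, e5⟩ := hWw (4 * L) P.length (P.length + 10 * L)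
    (by omega) (by omega) (by omega) (by omega)
  obtain ⟨hs₁', y', b', j', e1', e2', e3', e4', e5'⟩ := hWw' L (b + j - P.length + P'.length)
    (b + j - P.length + P'.length + 4 * L) (by omega) (by omega) (by omega) (by omega)
  obtain ⟨i, hi⟩ : ∃ i, b' + j' = P'.length + i := ⟨b' + j' - P'.length, by omega⟩
  obtain ⟨j₂, hj₂⟩ : ∃ j₂, P.length + i = b + j₂ := ⟨P.length + i - b, by omega⟩
  have hiM : i + L ≤ M.length := by omega
  have k1 : (W'.drop (b' + j')).take L = (M.drop i).take L := by
    rw [hi, hBe, List.append_assoc, List.drop_length_add_append,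
      List.drop_append_of_le_length (by omega),
      List.take_append_of_le_length (by rw [List.length_drop]; omega)]
  have k2 : ((W.map τ).drop (b + j₂)).take L = (M.drop i).take L := by
    rw [← hj₂, hAe, List.append_assoc, List.drop_length_add_append,
      List.drop_append_of_le_length (by omega),
      List.take_append_of_le_length (by rw [List.length_drop]; omega)]
  rw [← List.map_drop, ← List.map_take, take_drop_eq_of_isPrefix e4 (by omega)] at k2
  rw [take_drop_eq_of_isPrefix e4' e3', ← k2] at k1
  obtain ⟨rfl, rfl, rfl⟩ := hG.unique_mid hτ e3' (by omega) k1
  refine ⟨rfl, ?_⟩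
  have k3 : FreeGroup.mk (W'.take (b' + j')) = v * FreeGroup.mk (W.take (b + j')) := by
    rw [Equiv.Perm.coe_one, List.map_id] at hAe
    rw [hi, ← hj₂, hAe, hBe, List.append_assoc, List.append_assoc, List.take_length_add_append,
      List.take_length_add_append, List.take_append_of_le_length (by omega),
      List.take_append_of_le_length (by omega), mk_append, mk_append, hP, mul_assoc]
  rw [take_add_eq_of_isPrefix e4 (by omega), take_add_eq_of_isPrefix e4' (by omega), mk_append,
    mk_append, e5, e5', mul_assoc, mul_assoc, ← mul_assoc v] at k3
  refine ⟨FreeGroup.mk hs₁' * (FreeGroup.mk hs₁)⁻¹, ?_⟩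
  rw [_root_.map_mul, _root_.map_inv, mul_inv_eq_iff_eq_mul]
  exact mul_right_cancel k3

theorem Generic.eq_conj_of_le [Fintype α] (hd : 4 ≤ Fintype.card (α × Bool))
    (hG : Generic w L (Fintype.card (α × Bool) ^ 2 - 3)) {h h' : List (ι × Bool)}
    (hh : FreeGroup.IsCyclicallyReduced h) (hh' : FreeGroup.IsCyclicallyReduced h')
    (hne : h ≠ []) (hne' : h' ≠ []) (β : FreeGroup α ≃* FreeGroup α)
    (hβ : β (FreeGroup.lift w (FreeGroup.mk h')) = FreeGroup.lift w (FreeGroup.mk h))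
    (hle : (h.map fun y => (block w y).length).sum ≤ (h'.map fun y => (block w y).length).sum) :
    ∃ v ∈ (FreeGroup.lift w).range, ∀ g, β g = v * g * v⁻¹ := by
  have hN : ∀ N, FreeGroup.lift w (FreeGroup.mk (List.replicate N h).flatten) =
      FreeGroup.lift w (FreeGroup.mk h) ^ N := fun N => by rw [mk_flatten_replicate, map_pow]
  have hN' : ∀ N, FreeGroup.lift w (FreeGroup.mk (List.replicate N h').flatten) =
      FreeGroup.lift w (FreeGroup.mk h') ^ N := fun N => by rw [mk_flatten_replicate, map_pow]
  have hred : ∀ N, FreeGroup.IsReduced (List.replicate N h).flatten := fun N =>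
    (hh.flatten_replicate N).isReduced
  have hred' : ∀ N, FreeGroup.IsReduced (List.replicate N h').flatten := fun N =>
    (hh'.flatten_replicate N).isReduced
  have hl := List.length_pos_iff.mpr hne
  have hl' := List.length_pos_iff.mpr hne'
  have hlen : ∀ N, N ≤ (List.replicate N h).flatten.length := fun N => by
    simp only [List.length_flatten, List.map_replicate, List.sum_replicate, smul_eq_mul]
    exact Nat.le_mul_of_pos_right N hl
  have hnil' : ∀ N, (List.replicate (N + 1) h').flatten ≠ [] := fun N => by
    simp [List.replicate_succ, hne']
  rcases exists_conj_perm_or_stretch β hd with ⟨v, τ, hτ, hv⟩ | ⟨C, hC⟩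
  · set N := 2 * v.toWord.length + 10 * L with hNdef
    have hlenN := hlen (N + 1)
    obtain ⟨W, hW, hWφ, -⟩ := hG.exists_reduced_word (hred (N + 1))
      (by rw [← List.length_pos_iff]; omega)
    have key : FreeGroup.lift w (FreeGroup.mk (List.replicate (N + 1) h').flatten) =
        v * FreeGroup.mk (W.map τ) * v⁻¹ := by
      rw [← map_mk_of_conj_perm (β := β.symm.toMonoidHom) hv, hWφ, hN, hN', ← hβ]
      simp
    obtain ⟨rfl, hvr⟩ := hG.conj_mem hτ (hred (N + 1)) (hred' (N + 1)) (hnil' N) (by omega) hWφ hW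
      key
    refine ⟨v⁻¹, inv_mem hvr, fun g => ?_⟩
    have h1 := map_mk_of_conj_perm (β := β.symm.toMonoidHom) hv (v⁻¹ * g * v).toWord
    rw [Equiv.Perm.coe_one, List.map_id, FreeGroup.mk_toWord] at h1
    have h2 : β.symm (v⁻¹ * g * v) = g := by
      refine Eq.trans h1 ?_
      group
    rw [inv_inv, ← h2, MulEquiv.apply_symm_apply, h2]
  · exfalso
    set D := Fintype.card (α × Bool) ^ 2 - 3 with hD
    have hDpos : 0 < D := by
      have : 4 ^ 2 ≤ Fintype.card (α × Bool) ^ 2 := Nat.pow_le_pow_left hd 2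
      omega
    set T' := (h'.map fun y => (block w y).length).sum with hT'
    set T := (h.map fun y => (block w y).length).sum with hT
    set N := C + 1 with hNdef
    obtain ⟨W, hW, hWφ, -, hWt, -⟩ := hG.exists_reduced_word (hred' N) (hnil' C)
    set m := (2 * T' + D) / D with hm
    have hmD : 2 * T' + 1 ≤ D * m := by
      have := Nat.lt_mul_div_succ (2 * T' + D) hDpos
      rw [← hm, Nat.mul_succ] at this
      omega
    have hturn : ∀ t t', t ≠ t' → N * m ≤ turn t t' W := by
      intro t t' htt
      refine le_trans ?_ (hWt t t')
      rw [List.map_flatten, List.map_replicate, List.sum_flatten, List.map_replicate,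
        List.sum_replicate, smul_eq_mul]
      refine Nat.mul_le_mul_left N ?_
      have h1 : 2 * T' + h'.length ≤ D * (h'.map fun y => turn t t' (blockMid w L y)).sum := by
        rw [hT']
        clear hT' hle hm hmD hWt hWφ hnil' hlen hred' hN' hβ hne' hh' hl' T' m hT
        induction h' with
        | nil => simp
        | cons y h' ih =>
          have := hG.le_turn_blockMid y htt
          simp only [List.map_cons, List.sum_cons, List.length_cons, Nat.mul_add]
          omega
      rw [hm]
      refine Nat.lt_succ_iff.mp ((Nat.div_lt_iff_lt_mul hDpos).mpr ?_)
      rw [mul_comm _ D, Nat.mul_succ]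
      omega
    have h2 := hC W hW (N * m) hturn ((List.replicate N h).flatten.flatMap (block w))
      (by rw [mk_flatMap_block, hWφ, hN, hN', map_pow, hβ])
    have h3 : ((List.replicate N h).flatten.flatMap (block w)).length = N * T := by
      rw [List.length_flatMap, List.map_flatten, List.map_replicate, List.sum_flatten,
        List.map_replicate, List.sum_replicate, smul_eq_mul]
    rw [h3] at h2
    have h4 : D * (N * m) = N * (D * m) := by ring
    have h5 : N * (2 * T' + 1) ≤ N * (D * m) := Nat.mul_le_mul_left N hmD
    have h6 : N * T ≤ N * T' := Nat.mul_le_mul_left N hle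
    have h7 : N * (2 * T' + 1) = 2 * (N * T') + N := by ring
    omega

theorem exists_isCyclicallyReduced_conj [DecidableEq ι] (f : FreeGroup ι) :
    ∃ u l, FreeGroup.IsCyclicallyReduced l ∧ f = u * FreeGroup.mk l * u⁻¹ := by
  refine ⟨FreeGroup.mk (reduceCyclically.conjugator f.toWord), reduceCyclically f.toWord,
    reduceCyclically.isCyclicallyReduced FreeGroup.isReduced_toWord, ?_⟩
  conv_lhs => rw [← FreeGroup.mk_toWord (x := f),
    ← reduceCyclically.conj_conjugator_reduceCyclically f.toWord, mk_append, mk_append,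
    ← FreeGroup.inv_mk]

theorem Generic.eq_conj [Fintype α] [DecidableEq ι] (hd : 4 ≤ Fintype.card (α × Bool))
    (hG : Generic w L (Fintype.card (α × Bool) ^ 2 - 3)) (β : FreeGroup α ≃* FreeGroup α)
    {x : FreeGroup α} (hx : x ≠ 1) (hxr : x ∈ (FreeGroup.lift w).range)
    (hβx : β.symm x ∈ (FreeGroup.lift w).range) :
    ∃ v ∈ (FreeGroup.lift w).range, ∀ g, β g = v * g * v⁻¹ := by
  obtain ⟨f, rfl⟩ := hxr
  obtain ⟨f', hf'⟩ := hβx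
  obtain ⟨u, h, hh, rfl⟩ := exists_isCyclicallyReduced_conj f
  obtain ⟨u', h', hh', rfl⟩ := exists_isCyclicallyReduced_conj f'
  have hne : h ≠ [] := by
    rintro rfl
    exact hx (by simp [mk_nil])
  have hne' : h' ≠ [] := by
    rintro rfl
    rw [eq_comm, MulEquiv.symm_apply_eq] at hf'
    exact hx (by rw [hf']; simp [mk_nil])
  rw [eq_comm, MulEquiv.symm_apply_eq] at hf'
  set a := FreeGroup.lift w u with ha
  set a' := FreeGroup.lift w u' with ha'
  have har : a ∈ (FreeGroup.lift w).range := ⟨u, rfl⟩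
  have har' : a' ∈ (FreeGroup.lift w).range := ⟨u', rfl⟩
  have hγ : (β.trans (MulAut.conj (a⁻¹ * β a'))) (FreeGroup.lift w (FreeGroup.mk h')) =
      FreeGroup.lift w (FreeGroup.mk h) := by
    simp only [_root_.map_mul, _root_.map_inv, ← ha, ← ha'] at hf'
    rw [MulEquiv.trans_apply, MulAut.conj_apply]
    calc _ = a⁻¹ * (β a' * β (FreeGroup.lift w (FreeGroup.mk h')) * (β a')⁻¹) * a := by group
      _ = _ := by rw [← hf']; group
  obtain ⟨v, hv, hvβ⟩ : ∃ v ∈ (FreeGroup.lift w).range, ∀ g,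
      (β.trans (MulAut.conj (a⁻¹ * β a'))) g = v * g * v⁻¹ := by
    rcases le_total (h.map fun y => (block w y).length).sum
      (h'.map fun y => (block w y).length).sum with hle | hle
    · exact hG.eq_conj_of_le hd hh hh' hne hne' _ hγ hle
    · obtain ⟨v, hv, hvβ⟩ := hG.eq_conj_of_le hd hh' hh hne' hne
        (β.trans (MulAut.conj (a⁻¹ * β a'))).symm (by rw [← hγ, MulEquiv.symm_apply_apply]) hle
      refine ⟨v⁻¹, inv_mem hv, fun g => ?_⟩
      rw [← MulEquiv.eq_symm_apply, hvβ]
      group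
  have hβ : ∀ g, β g = (a⁻¹ * β a')⁻¹ * (v * g * v⁻¹) * (a⁻¹ * β a') := fun g => by
    rw [← hvβ, MulEquiv.trans_apply, MulAut.conj_apply]
    group
  have hb : β a' = a * (v * a' * v⁻¹) * a⁻¹ := by
    have h1 := hvβ a'
    rw [MulEquiv.trans_apply, MulAut.conj_apply] at h1
    rw [← h1]
    group
  refine ⟨(a⁻¹ * β a')⁻¹ * v, mul_mem (inv_mem (mul_mem (inv_mem har) ?_)) hv, fun g => ?_⟩
  · rw [hb]
    exact mul_mem (mul_mem har (mul_mem (mul_mem hv har') (inv_mem hv))) (inv_mem har)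
  · rw [hβ g]
    group

end Rigidity

section Count

variable {α : Type*} [DecidableEq α] [Fintype α]

/-- The letters which may precede a given word. -/
def precLetters (l : List (α × Bool)) : Finset (α × Bool) :=
  Finset.univ.filter fun t => ∀ b ∈ l.head?, b ≠ linv t

/-- The reduced words of a given length. -/
def redWords (α : Type*) [DecidableEq α] [Fintype α] : ℕ → Finset (List (α × Bool))
  | 0 => {[]}
  | n + 1 => (redWords α n).biUnion fun l => (precLetters l).image (· :: l)

theorem mem_redWords {n : ℕ} {l : List (α × Bool)} :
    l ∈ redWords α n ↔ FreeGroup.IsReduced l ∧ l.length = n := by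
  induction n generalizing l with
  | zero =>
    simp only [redWords, Finset.mem_singleton, List.length_eq_zero_iff]
    refine ⟨?_, fun h => h.2⟩
    rintro rfl
    exact ⟨FreeGroup.IsReduced.nil, rfl⟩
  | succ n ih =>
    simp only [redWords, Finset.mem_biUnion, Finset.mem_image, precLetters, Finset.mem_filter,
      Finset.mem_univ, true_and, ih]
    constructor
    · rintro ⟨l, ⟨h1, h2⟩, t, h3, rfl⟩
      exact ⟨isReduced_cons_iff.mpr ⟨h3, h1⟩, by simp [h2]⟩
    · rintro ⟨h1, h2⟩
      rcases l with _ | ⟨t, l⟩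
      · simp at h2
      · obtain ⟨h3, h4⟩ := isReduced_cons_iff.mp h1
        exact ⟨l, ⟨h4, by simpa using h2⟩, t, h3, rfl⟩

theorem sum_redWords_succ (F : List (α × Bool) → ℝ) (n : ℕ) :
    ∑ u ∈ redWords α (n + 1), F u = ∑ l ∈ redWords α n, ∑ t ∈ precLetters l, F (t :: l) := by
  rw [redWords, Finset.sum_biUnion]
  · refine Finset.sum_congr rfl fun l _ => Finset.sum_image fun a _ b _ h => (List.cons.inj h).1
  · intro l _ l' _ hll
    rw [Function.onFun, Finset.disjoint_left]
    rintro u hu hu'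
    obtain ⟨t, -, rfl⟩ := Finset.mem_image.mp hu
    obtain ⟨t', -, h⟩ := Finset.mem_image.mp hu'
    exact hll (List.cons.inj h).2.symm

theorem card_precLetters_nil : (precLetters ([] : List (α × Bool))).card =
    Fintype.card (α × Bool) := by
  simp [precLetters]

theorem precLetters_cons (x : α × Bool) (l : List (α × Bool)) :
    precLetters (x :: l) = Finset.univ.erase (linv x) := by
  ext t
  simp only [precLetters, Finset.mem_filter, Finset.mem_univ, true_and, List.head?_cons,
    Option.mem_some_iff, forall_eq', Finset.mem_erase, and_true]
  refine not_congr ⟨?_, ?_⟩ <;> rintro rfl <;> simp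

theorem card_precLetters_cons (x : α × Bool) (l : List (α × Bool)) :
    (precLetters (x :: l)).card = Fintype.card (α × Bool) - 1 := by
  rw [precLetters_cons, Finset.card_erase_of_mem (Finset.mem_univ _), Finset.card_univ]

theorem le_card_precLetters (l : List (α × Bool)) :
    Fintype.card (α × Bool) - 1 ≤ (precLetters l).card := by
  rcases l with _ | ⟨x, l⟩
  · rw [card_precLetters_nil]
    omega
  · rw [card_precLetters_cons]

theorem card_precLetters_eq {n : ℕ} {l l' : List (α × Bool)} (hl : l ∈ redWords α n)
    (hl' : l' ∈ redWords α n) : (precLetters l).card = (precLetters l').card := by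
  have h := (mem_redWords.mp hl).2
  have h' := (mem_redWords.mp hl').2
  rcases l with _ | ⟨x, l⟩ <;> rcases l' with _ | ⟨x', l'⟩
  · rfl
  · simp at h h'; omega
  · simp at h h'; omega
  · rw [card_precLetters_cons, card_precLetters_cons]

theorem exists_card_redWords_succ (n : ℕ) : ∃ e : ℕ, Fintype.card (α × Bool) - 1 ≤ e ∧
    (∀ l ∈ redWords α n, (precLetters l).card = e) ∧
    ((redWords α (n + 1)).card : ℝ) = e * (redWords α n).card := by
  have hs : ∀ e : ℕ, (∀ l ∈ redWords α n, (precLetters l).card = e) →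
      ((redWords α (n + 1)).card : ℝ) = e * (redWords α n).card := by
    intro e he
    have := sum_redWords_succ (α := α) (fun _ => 1) n
    simp only [Finset.sum_const, nsmul_eq_mul, mul_one] at this
    rw [this, Finset.sum_congr rfl fun l hl => by rw [he l hl], Finset.sum_const, nsmul_eq_mul,
      mul_comm]
  rcases (redWords α n).eq_empty_or_nonempty with h | ⟨l₀, hl₀⟩
  · have h1 : ∀ l ∈ redWords α n, (precLetters l).card = Fintype.card (α × Bool) - 1 := by simp [h]
    exact ⟨_, le_rfl, h1, hs _ h1⟩
  · have h1 : ∀ l ∈ redWords α n, (precLetters l).card = (precLetters l₀).card :=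
      fun l hl => card_precLetters_eq hl hl₀
    exact ⟨_, le_card_precLetters _, h1, hs _ h1⟩

/-- A supermartingale inequality for uniformly random reduced words. -/
theorem sum_redWords_succ_le {F : List (α × Bool) → ℝ} {n : ℕ} {c C : ℝ} (hc : 0 ≤ c)
    (h : ∀ l ∈ redWords α n,
      ∑ t ∈ precLetters l, F (t :: l) ≤ c * (precLetters l).card * F l)
    (hn : ∑ l ∈ redWords α n, F l ≤ C * (redWords α n).card) :
    ∑ l ∈ redWords α (n + 1), F l ≤ c * C * (redWords α (n + 1)).card := by
  obtain ⟨e, -, he, hcard⟩ := exists_card_redWords_succ (α := α) n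
  rw [sum_redWords_succ, hcard]
  calc _ ≤ ∑ l ∈ redWords α n, c * e * F l :=
        Finset.sum_le_sum fun l hl => by rw [← he l hl]; exact h l hl
    _ = c * e * ∑ l ∈ redWords α n, F l := by rw [Finset.mul_sum]
    _ ≤ c * e * (C * (redWords α n).card) := by gcongr
    _ = _ := by ring

/-- The number of reduced words of length `n` with a given property. -/
def redCount (n : ℕ) (Q : List (α × Bool) → Prop) : ℕ := {u | u ∈ redWords α n ∧ Q u}.ncard

theorem redCount_eq_card_filter (n : ℕ) (Q : List (α × Bool) → Prop) [DecidablePred Q] :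
    redCount n Q = ((redWords α n).filter Q).card := by
  rw [redCount, ← Set.ncard_coe_finset, Finset.coe_filter]

theorem finite_redCount (n : ℕ) (Q : List (α × Bool) → Prop) :
    {u | u ∈ redWords α n ∧ Q u}.Finite :=
  (redWords α n).finite_toSet.subset fun _ hu => hu.1

theorem redCount_mono {n : ℕ} {Q Q' : List (α × Bool) → Prop}
    (h : ∀ u ∈ redWords α n, Q u → Q' u) : redCount n Q ≤ redCount n Q' :=
  Set.ncard_le_ncard (fun u hu => ⟨hu.1, h u hu.1 hu.2⟩) (finite_redCount n Q')

theorem redCount_exists_le {ι : Type*} (s : Finset ι) (n : ℕ) (Q : ι → List (α × Bool) → Prop) :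
    redCount n (fun u => ∃ i ∈ s, Q i u) ≤ ∑ i ∈ s, redCount n (Q i) := by
  refine le_trans (Set.ncard_le_ncard (t := ⋃ i ∈ s, {u | u ∈ redWords α n ∧ Q i u}) ?_ ?_)
    (Finset.set_ncard_biUnion_le s _)
  · rintro u ⟨hu, i, hi, hQ⟩
    exact Set.mem_biUnion hi ⟨hu, hQ⟩
  · exact s.finite_toSet.biUnion fun i _ => finite_redCount n (Q i)

/-- Words satisfying a nontrivial constraint at `M` consecutive positions are rare. -/
theorem card_constrained_le (hd : 3 ≤ Fintype.card (α × Bool)) {n : ℕ}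
    (P : ℕ → (α × Bool) → List (α × Bool) → Prop) (i₀ M : ℕ) (hM : i₀ + M ≤ n)
    (hP : ∀ i l, {t | P i t l}.ncard ≤ Fintype.card (α × Bool) - 2) :
    (redCount n (fun u => ∀ i, i₀ ≤ i → i < i₀ + M →
      ∀ t, u[i]? = some t → P i t (u.drop (i + 1))) : ℝ) ≤
      ((Fintype.card (α × Bool) - 2 : ℝ) / (Fintype.card (α × Bool) - 1)) ^ M *
        (redWords α n).card := by
  classical
  rw [redCount_eq_card_filter]
  set d := Fintype.card (α × Bool) with hdd
  have hd3 : (3 : ℝ) ≤ d := by exact_mod_cast hd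
  have hρ0 : (0 : ℝ) ≤ (d - 2 : ℝ) / (d - 1) := div_nonneg (by linarith) (by linarith)
  induction n generalizing P i₀ M with
  | zero =>
    obtain rfl : M = 0 := by omega
    simpa using Finset.card_filter_le _ _
  | succ n ih =>
    rcases M with _ | M
    · rw [pow_zero, one_mul]
      exact_mod_cast Finset.card_filter_le _ _
    obtain ⟨e, hed, he, hcard⟩ := exists_card_redWords_succ (α := α) n
    have hed' : (d : ℝ) - 1 ≤ e := by
      have : d ≤ e + 1 := by omega
      have : (d : ℝ) ≤ e + 1 := by exact_mod_cast this
      linarith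
    rw [Finset.card_filter, Nat.cast_sum, sum_redWords_succ, hcard]
    rcases i₀ with _ | i₁
    · have h1 := ih (fun i => P (i + 1)) 0 M (by omega) (fun i l => hP _ _)
      rw [Finset.card_filter, Nat.cast_sum] at h1
      calc _ ≤ ∑ l ∈ redWords α n, ((d : ℝ) - 2) * ((if ∀ i, 0 ≤ i → i < 0 + M →
            ∀ t, l[i]? = some t → P (i + 1) t (l.drop (i + 1)) then 1 else 0 : ℕ) : ℝ) := by
            refine Finset.sum_le_sum fun l hl => ?_
            rw [← Nat.cast_sum, ← Finset.card_filter]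
            split_ifs with hsat
            · have h2 : ((precLetters l).filter fun t => ∀ i, 0 ≤ i → i < 0 + (M + 1) →
                  ∀ t', (t :: l)[i]? = some t' → P i t' ((t :: l).drop (i + 1))).card ≤ d - 2 := by
                refine le_trans ?_ (hP 0 l)
                rw [Set.ncard_eq_toFinset_card']
                refine Finset.card_le_card fun t ht => ?_
                have := (Finset.mem_filter.mp ht).2 0 le_rfl (by omega) t rfl
                simpa using this
              have h3 : ((d - 2 : ℕ) : ℝ) = (d : ℝ) - 2 := by
                rw [Nat.cast_sub (by omega)]
                norm_num
              rw [Nat.cast_one, mul_one, ← h3]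
              exact_mod_cast h2
            · rw [Finset.card_eq_zero.mpr]
              · simp
              · refine Finset.filter_eq_empty_iff.mpr fun t _ ht => hsat fun i _ hi t' ht' => ?_
                exact ht (i + 1) (by omega) (by omega) t' (by simpa using ht')
        _ = ((d : ℝ) - 2) * ∑ l ∈ redWords α n, ((if ∀ i, 0 ≤ i → i < 0 + M →
            ∀ t, l[i]? = some t → P (i + 1) t (l.drop (i + 1)) then 1 else 0 : ℕ) : ℝ) := by
            rw [Finset.mul_sum]
        _ ≤ ((d : ℝ) - 2) * (((d - 2 : ℝ) / (d - 1)) ^ M * (redWords α n).card) :=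
            mul_le_mul_of_nonneg_left h1 (by linarith)
        _ = ((d - 2 : ℝ) / (d - 1)) ^ (M + 1) * ((d - 1) * (redWords α n).card) := by
            have : (d : ℝ) - 1 ≠ 0 := by linarith
            rw [pow_succ]
            field_simp
        _ ≤ _ := by gcongr
    · have h1 := ih (fun i => P (i + 1)) i₁ (M + 1) (by omega) (fun i l => hP _ _)
      rw [Finset.card_filter, Nat.cast_sum] at h1
      calc _ ≤ ∑ l ∈ redWords α n, (e : ℝ) * ((if ∀ i, i₁ ≤ i → i < i₁ + (M + 1) →
            ∀ t, l[i]? = some t → P (i + 1) t (l.drop (i + 1)) then 1 else 0 : ℕ) : ℝ) := by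
            refine Finset.sum_le_sum fun l hl => ?_
            rw [← Nat.cast_sum, ← Finset.card_filter]
            split_ifs with hsat
            · rw [Nat.cast_one, mul_one, ← he l hl]
              exact_mod_cast Finset.card_filter_le _ _
            · rw [Finset.card_eq_zero.mpr]
              · simp
              · refine Finset.filter_eq_empty_iff.mpr fun t _ ht => hsat fun i hi' hi t' ht' => ?_
                exact ht (i + 1) (by omega) (by omega) t' (by simpa using ht')
        _ = (e : ℝ) * ∑ l ∈ redWords α n, ((if ∀ i, i₁ ≤ i → i < i₁ + (M + 1) →
            ∀ t, l[i]? = some t → P (i + 1) t (l.drop (i + 1)) then 1 else 0 : ℕ) : ℝ) := by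
            rw [Finset.mul_sum]
        _ ≤ e * (((d - 2 : ℝ) / (d - 1)) ^ (M + 1) * (redWords α n).card) := by gcongr
        _ = _ := by ring

end Count

section LowerTail

variable {α : Type*} [DecidableEq α]

/-- The corrector for the number of occurrences of a two-letter word ending in `b` along a random
reduced word. -/
def corrector (d : ℝ) (b h : α × Bool) : ℝ :=
  if h = b then -((d - 1) / (d * (d - 2))) else if h = linv b then 1 / (d * (d - 2)) else 0

theorem abs_corrector_le {d : ℝ} (hd : 3 ≤ d) (b h : α × Bool) : |corrector d b h| ≤ 1 := by
  have h1 : 0 < d * (d - 2) := mul_pos (by linarith) (by linarith)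
  rw [corrector]
  split_ifs
  · rw [abs_neg, abs_of_nonneg (div_nonneg (by linarith) h1.le), div_le_one h1]
    nlinarith
  · rw [abs_of_nonneg (by positivity), div_le_one h1]
    nlinarith
  · simp

/-- The exponential weight of a word, with the corrector evaluated at its first letter. -/
def tiltWeight (d θ : ℝ) (a b : α × Bool) (l : List (α × Bool)) : ℝ :=
  Real.exp (-(θ * pairCount a b l)) * (1 + θ * l.head?.elim 0 (corrector d b))

variable [Fintype α]

theorem sum_corrector {d : ℝ} (hd : 3 ≤ d) (b : α × Bool) :
    ∑ h, corrector d b h = -(1 / d) := by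
  have h1 : ∀ h, corrector d b h = (if h = b then -((d - 1) / (d * (d - 2))) else 0) +
      if h = linv b then 1 / (d * (d - 2)) else 0 := by
    intro h
    rw [corrector]
    split_ifs with h2 h3 <;> simp
    subst h2
    exact absurd h3.symm (linv_ne_self _)
  simp only [h1, Finset.sum_add_distrib, Finset.sum_ite_eq', Finset.mem_univ, if_true]
  have : d ≠ 0 := by linarith
  have : d - 2 ≠ 0 := by linarith
  field_simp
  ring

theorem sum_erase_corrector {d : ℝ} (hd : 3 ≤ d) (b h : α × Bool) :
    ∑ t ∈ Finset.univ.erase (linv h), corrector d b t - (if h = b then 1 else 0) =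
      (d - 1) * (corrector d b h - 1 / (d * (d - 1))) := by
  have e1 : d ≠ 0 := by linarith
  have e2 : d - 2 ≠ 0 := by linarith
  have e3 : d - 1 ≠ 0 := by linarith
  have h1 := Finset.sum_erase_add Finset.univ (corrector d b) (Finset.mem_univ (linv h))
  rw [sum_corrector hd] at h1
  have h2 : ∑ t ∈ Finset.univ.erase (linv h), corrector d b t =
    -(1 / d) - corrector d b (linv h) := by linarith
  rw [h2]
  by_cases hb : h = b
  · subst hb
    simp only [corrector, linv_ne_self, if_true, if_false]
    field_simp
    ring
  · by_cases hb' : h = linv b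
    · subst hb'
      simp only [corrector, linv_ne_self, linv_linv, if_true, if_false]
      field_simp
      ring
    · have hb'' : linv h ≠ b := fun e => hb' (by rw [← e, linv_linv])
      have hb3 : linv h ≠ linv b := fun e => hb (linv_inj.mp e)
      simp only [corrector, hb, hb', hb'', hb3, if_false]
      field_simp
      ring

theorem sum_tiltWeight_cons_le {a b : α × Bool} (hab : a ≠ linv b)
    (hd : 3 ≤ Fintype.card (α × Bool)) {θ ε : ℝ} (hθ : 0 < θ) (hθε : 2 * θ ≤ ε)
    (hε : ε ≤ 1 / ((Fintype.card (α × Bool) : ℝ) * (Fintype.card (α × Bool) - 1)))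
    (h : α × Bool) (l : List (α × Bool)) :
    ∑ t ∈ precLetters (h :: l), tiltWeight (Fintype.card (α × Bool)) θ a b (t :: h :: l) ≤
      Real.exp (-(θ * (1 / ((Fintype.card (α × Bool) : ℝ) * (Fintype.card (α × Bool) - 1)) - ε))) *
        (precLetters (h :: l)).card * tiltWeight (Fintype.card (α × Bool)) θ a b (h :: l) := by
  have hcard := card_precLetters_cons h l
  rw [precLetters_cons] at hcard ⊢
  rw [hcard]
  have hd' : (3 : ℝ) ≤ Fintype.card (α × Bool) := by exact_mod_cast hd
  have hsub : ((Fintype.card (α × Bool) - 1 : ℕ) : ℝ) = (Fintype.card (α × Bool) : ℝ) - 1 := by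
    rw [Nat.cast_sub (by omega), Nat.cast_one]
  have hcard' : ((Finset.univ.erase (linv h)).card : ℝ) = (Fintype.card (α × Bool) : ℝ) - 1 := by
    rw [hcard, hsub]
  rw [hsub]
  generalize (Fintype.card (α × Bool) : ℝ) = d at *
  set q := 1 / (d * (d - 1)) with hq
  have hq1 : q ≤ 1 := by
    rw [hq, div_le_one (mul_pos (by linarith) (by linarith))]
    nlinarith
  have hg := abs_le.mp (abs_corrector_le hd' b h)
  have hga := abs_le.mp (abs_corrector_le hd' b a)
  have hterm : ∀ t, tiltWeight d θ a b (t :: h :: l) ≤ Real.exp (-(θ * pairCount a b (h :: l))) *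
      ((1 + θ * corrector d b t) - if t = a then (if h = b then θ - 2 * θ ^ 2 else 0) else 0) := by
    intro t
    rw [tiltWeight, pairCount, List.head?_cons, List.head?_cons, Option.elim_some]
    push_cast
    rw [mul_add θ, neg_add, Real.exp_add, mul_assoc]
    refine mul_le_mul_of_nonneg_left ?_ (Real.exp_pos _).le
    by_cases hta : t = a
    · by_cases hhb : h = b
      · subst hta hhb
        simp only [true_and, if_true, mul_one]
        have h1 := (abs_le.mp (Real.abs_exp_sub_one_sub_id_le (x := -θ)
          (by rw [abs_neg, abs_of_pos hθ]; linarith))).2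
        have h2 : Real.exp (-θ) ≤ 1 - θ + θ ^ 2 := by linarith
        have h3 : 0 ≤ 1 + θ * corrector d h t := by nlinarith
        have h4 := mul_le_mul_of_nonneg_right h2 h3
        nlinarith [mul_nonneg hθ.le (mul_nonneg hθ.le (by linarith : (0:ℝ) ≤ 1 - θ)),
          mul_nonneg (mul_nonneg hθ.le (mul_nonneg hθ.le (by linarith : (0:ℝ) ≤ 1 - θ)))
            (by linarith : 0 ≤ 1 + corrector d h t)]
      · have : ¬ (t = a ∧ some h = some b) := fun e => hhb (Option.some.inj e.2)
        simp [hta, hhb]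
    · simp [hta]
  have hmem : a ∈ Finset.univ.erase (linv h) ∨ h ≠ b := by
    by_cases hhb : h = b
    · subst hhb
      simp [hab]
    · exact Or.inr hhb
  have hind : ∑ t ∈ Finset.univ.erase (linv h),
      (if t = a then (if h = b then θ - 2 * θ ^ 2 else 0) else 0) =
        if h = b then θ - 2 * θ ^ 2 else 0 := by
    rw [Finset.sum_ite_eq']
    rcases hmem with hm | hm
    · rw [if_pos hm]
    · simp [hm]
  refine (Finset.sum_le_sum fun t _ => hterm t).trans ?_
  rw [← Finset.mul_sum, Finset.sum_sub_distrib, hind, Finset.sum_add_distrib, Finset.sum_const,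
    nsmul_eq_mul, mul_one, ← Finset.mul_sum, hcard', tiltWeight, List.head?_cons,
    Option.elim_some, mul_left_comm]
  refine mul_le_mul_of_nonneg_left ?_ (Real.exp_pos _).le
  have hsum := sum_erase_corrector hd' b h
  rw [← hq] at hsum
  have hexp := Real.add_one_le_exp (-(θ * (q - ε)))
  have hpos : 0 ≤ (d - 1) * (1 + θ * corrector d b h) :=
    mul_nonneg (by linarith) (by nlinarith)
  have h5 := mul_le_mul_of_nonneg_right hexp hpos
  have h6 : d - 1 + θ * ∑ t ∈ Finset.univ.erase (linv h), corrector d b t -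
      (if h = b then θ - 2 * θ ^ 2 else 0) ≤
        (d - 1) + θ * ((d - 1) * (corrector d b h - q)) + 2 * θ ^ 2 := by
    rw [← hsum]
    split_ifs <;> nlinarith
  have h7 : (q - ε) * corrector d b h ≤ 1 := by nlinarith
  have h8 : θ * ((q - ε) * corrector d b h) ≤ θ := by nlinarith
  nlinarith [mul_nonneg hθ.le (by nlinarith :
      (0:ℝ) ≤ (d - 1) * (2 * θ - θ * ((q - ε) * corrector d b h)) - 2 * θ),
    mul_nonneg (mul_nonneg hθ.le (by linarith : (0:ℝ) ≤ d - 1)) (by linarith : (0:ℝ) ≤ ε - 2 * θ)]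

end LowerTail

section Rare

variable {α : Type*}

theorem getElem?_window {β : Type*} {A : List β} {q L r : ℕ} (hr : r < L) :
    ((A.drop q).take L)[r]? = A[q + r]? := by
  rw [List.getElem?_take_of_lt hr, List.getElem?_drop]

theorem getElem?_invRev (u : List (α × Bool)) {j : ℕ} (hj : j < u.length) :
    (FreeGroup.invRev u)[j]? = u[u.length - 1 - j]?.map linv := by
  rw [FreeGroup.invRev, List.getElem?_reverse (by simpa using hj), List.getElem?_map,
    List.length_map]
  rfl

/-- The probability that a constrained letter is allowed. -/
def letterRatio (α : Type*) [Fintype α] : ℝ :=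
  (Fintype.card (α × Bool) - 2 : ℝ) / (Fintype.card (α × Bool) - 1)

theorem letterRatio_nonneg [Fintype α] (hd : 3 ≤ Fintype.card (α × Bool)) : 0 ≤ letterRatio α := by
  have hd' : (3 : ℝ) ≤ Fintype.card (α × Bool) := by exact_mod_cast hd
  exact div_nonneg (by linarith) (by linarith)

theorem letterRatio_lt_one [Fintype α] (hd : 3 ≤ Fintype.card (α × Bool)) : letterRatio α < 1 := by
  have hd' : (3 : ℝ) ≤ Fintype.card (α × Bool) := by exact_mod_cast hd
  rw [letterRatio, div_lt_one (by linarith)]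
  linarith

variable [DecidableEq α]

theorem tiltWeight_le {d θ : ℝ} (hd : 3 ≤ d) (hθ : 0 ≤ θ) (hθ1 : θ ≤ 1) (a b : α × Bool)
    (l : List (α × Bool)) : tiltWeight d θ a b l ≤ 2 := by
  have h1 : Real.exp (-(θ * pairCount a b l)) ≤ 1 := Real.exp_le_one_iff.mpr (by
    have : 0 ≤ θ * pairCount a b l := by positivity
    linarith)
  have h2 : l.head?.elim 0 (corrector d b) ≤ 1 := by
    rcases l with _ | ⟨x, l⟩
    · simp
    · exact (abs_le.mp (abs_corrector_le hd b x)).2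
  have h3 : 1 + θ * l.head?.elim 0 (corrector d b) ≤ 2 := by nlinarith
  have h4 := (Real.exp_pos (-(θ * pairCount a b l))).le
  rw [tiltWeight]
  nlinarith

theorem le_tiltWeight {d θ : ℝ} (hd : 3 ≤ d) (hθ : 0 ≤ θ) (hθ1 : θ ≤ 1 / 2) (a b : α × Bool)
    (l : List (α × Bool)) : Real.exp (-(θ * pairCount a b l)) / 2 ≤ tiltWeight d θ a b l := by
  have h2 : -1 ≤ l.head?.elim 0 (corrector d b) := by
    rcases l with _ | ⟨x, l⟩
    · simp
    · exact (abs_le.mp (abs_corrector_le hd b x)).1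
  have h3 : 1 / 2 ≤ 1 + θ * l.head?.elim 0 (corrector d b) := by nlinarith
  have h4 := (Real.exp_pos (-(θ * pairCount a b l))).le
  rw [tiltWeight]
  nlinarith

variable [Fintype α]

theorem sum_tiltWeight_le {a b : α × Bool} (hab : a ≠ linv b)
    (hd : 3 ≤ Fintype.card (α × Bool)) {θ ε : ℝ} (hθ : 0 < θ) (hθ1 : θ ≤ 1) (hθε : 2 * θ ≤ ε)
    (hε : ε ≤ 1 / ((Fintype.card (α × Bool) : ℝ) * (Fintype.card (α × Bool) - 1))) (n : ℕ) :
    ∑ l ∈ redWords α (n + 1), tiltWeight (Fintype.card (α × Bool)) θ a b l ≤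
      Real.exp (-(θ * (1 / ((Fintype.card (α × Bool) : ℝ) * (Fintype.card (α × Bool) - 1)) - ε)))
        ^ n * 2 * (redWords α (n + 1)).card := by
  induction n with
  | zero =>
    rw [pow_zero, one_mul, mul_comm, ← nsmul_eq_mul]
    exact Finset.sum_le_card_nsmul _ _ _ fun l _ =>
      tiltWeight_le (by exact_mod_cast hd) hθ.le hθ1 a b l
  | succ n ih =>
    rw [pow_succ', mul_assoc (Real.exp _)]
    refine sum_redWords_succ_le (Real.exp_pos _).le (fun l hl => ?_) ih
    rcases l with _ | ⟨h, l⟩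
    · have := (mem_redWords.mp hl).2
      simp at this
    · exact sum_tiltWeight_cons_le hab hd hθ hθε hε h l

/-- A lower large deviation bound for the number of occurrences of a two-letter word in a random
reduced word. -/
theorem card_pairCount_le {a b : α × Bool} (hab : a ≠ linv b)
    (hd : 3 ≤ Fintype.card (α × Bool)) {ε : ℝ} (hε0 : 0 < ε)
    (hε : ε ≤ 1 / ((Fintype.card (α × Bool) : ℝ) * (Fintype.card (α × Bool) - 1))) (n : ℕ) :
    (redCount n (fun l => (pairCount a b l : ℝ) ≤
      (1 / ((Fintype.card (α × Bool) : ℝ) * (Fintype.card (α × Bool) - 1)) - 2 * ε) * n) : ℝ) ≤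
        4 * Real.exp 1 * Real.exp (-(ε ^ 2 / 2 * n)) * (redWords α n).card := by
  classical
  rw [redCount_eq_card_filter]
  have hd' : (3 : ℝ) ≤ Fintype.card (α × Bool) := by exact_mod_cast hd
  have hq1 : 1 / ((Fintype.card (α × Bool) : ℝ) * (Fintype.card (α × Bool) - 1)) ≤ 1 := by
    rw [div_le_one (mul_pos (by linarith) (by linarith))]
    nlinarith
  rcases n with _ | n
  · have h1 : (1 : ℝ) ≤ Real.exp 1 := Real.one_le_exp (by norm_num)
    have h2 := (redWords α 0).card_filter_le fun l => (pairCount a b l : ℝ) ≤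
      (1 / ((Fintype.card (α × Bool) : ℝ) * (Fintype.card (α × Bool) - 1)) - 2 * ε) * (0 : ℕ)
    have h3 : ((redWords α 0).card : ℝ) = 1 := by simp [redWords]
    have h4 := (Nat.cast_le (α := ℝ)).mpr h2
    rw [h3] at h4 ⊢
    refine h4.trans ?_
    simp only [Nat.cast_zero, mul_zero, neg_zero, Real.exp_zero]
    linarith
  set q := 1 / ((Fintype.card (α × Bool) : ℝ) * (Fintype.card (α × Bool) - 1)) with hq
  have hsum := sum_tiltWeight_le hab hd (half_pos hε0) (by linarith) (by linarith) hε n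
  rw [← hq] at hsum
  set S := (redWords α (n + 1)).filter fun l => (pairCount a b l : ℝ) ≤ (q - 2 * ε) * (n + 1 : ℕ)
    with hS
  have h1 : (S.card : ℝ) * (Real.exp (-(ε / 2 * ((q - 2 * ε) * (n + 1 : ℕ)))) / 2) ≤
      ∑ l ∈ redWords α (n + 1), tiltWeight (Fintype.card (α × Bool)) (ε / 2) a b l := by
    rw [← nsmul_eq_mul]
    refine (Finset.card_nsmul_le_sum S _ _ fun l hl => ?_).trans
      (Finset.sum_le_sum_of_subset_of_nonneg (Finset.filter_subset _ _) fun l _ _ =>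
        le_trans (by positivity) (le_tiltWeight hd' (half_pos hε0).le (by linarith) a b l))
    refine le_trans ?_ (le_tiltWeight hd' (half_pos hε0).le (by linarith) a b l)
    have := (Finset.mem_filter.mp hl).2
    gcongr
  have h2 := h1.trans hsum
  rw [← mul_div_assoc, div_le_iff₀ two_pos, ← le_div_iff₀ (Real.exp_pos _), div_eq_mul_inv,
    ← Real.exp_neg, neg_neg, ← Real.exp_nat_mul] at h2
  refine h2.trans ?_
  have h3 : Real.exp (n * -(ε / 2 * (q - ε))) * Real.exp (ε / 2 * ((q - 2 * ε) * (n + 1 : ℕ))) ≤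
      Real.exp 1 * Real.exp (-(ε ^ 2 / 2 * (n + 1 : ℕ))) := by
    rw [← Real.exp_add, ← Real.exp_add]
    refine Real.exp_le_exp.mpr ?_
    push_cast
    nlinarith
  have h4 : (0 : ℝ) ≤ (redWords α (n + 1)).card := Nat.cast_nonneg _
  calc _ = 4 * (Real.exp (n * -(ε / 2 * (q - ε))) *
        Real.exp (ε / 2 * ((q - 2 * ε) * (n + 1 : ℕ)))) * (redWords α (n + 1)).card := by ring
    _ ≤ 4 * (Real.exp 1 * Real.exp (-(ε ^ 2 / 2 * (n + 1 : ℕ)))) * (redWords α (n + 1)).card := by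
        gcongr
    _ = _ := by ring

theorem card_determined_le (hd : 3 ≤ Fintype.card (α × Bool)) {n : ℕ}
    (G : ℕ → List (α × Bool) → Option (α × Bool)) (i₀ M : ℕ) (hM : i₀ + M ≤ n)
    (Q : List (α × Bool) → Prop) (hQ : ∀ u, u.length = n → Q u →
      ∀ i, i₀ ≤ i → i < i₀ + M → u[i]? = G i (u.drop (i + 1))) :
    (redCount n Q : ℝ) ≤
      letterRatio α ^ M * (redWords α n).card := by
  refine le_trans ?_ (card_constrained_le hd (fun i t l => some t = G i l) i₀ M hM fun i l => ?_)
  · refine Nat.cast_le.mpr (redCount_mono fun u h1 h2 i hi hi' t ht => ?_)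
    rw [← ht, hQ u (mem_redWords.mp h1).2 h2 i hi hi']
  · refine le_trans ?_ (by omega : 1 ≤ Fintype.card (α × Bool) - 2)
    refine (Set.ncard_le_one).mpr fun s hs t ht => ?_
    exact Option.some.inj (hs.trans ht.symm)

theorem card_eq_fixed_le (hd : 3 ≤ Fintype.card (α × Bool)) {n q L : ℕ} (hq : q + L ≤ n)
    (z : List (α × Bool)) :
    (redCount n (fun u => (u.drop q).take L = z) : ℝ) ≤
      letterRatio α ^ L * (redWords α n).card := by
  refine card_determined_le hd (fun i _ => z[i - q]?) q L hq _ fun u _ hQ i hi hi' => ?_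
  rw [← hQ, getElem?_window (by omega)]
  congr 1
  omega

theorem card_eq_map_self_le (hd : 3 ≤ Fintype.card (α × Bool)) {n q q' L : ℕ} (hq : q + L ≤ n)
    (hq' : q' + L ≤ n) {τ : Equiv.Perm (α × Bool)} (hτ : ∀ x, τ (linv x) = linv (τ x))
    (hne : ¬(τ = 1 ∧ q = q')) :
    (redCount n (fun u : List (α × Bool) =>
      (u.drop q).take L = ((u.drop q').take L).map τ) : ℝ) ≤
        letterRatio α ^ L * (redWords α n).card := by
  have hQ : ∀ u : List (α × Bool), (u.drop q).take L = ((u.drop q').take L).map τ → ∀ r, r < L →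
      u[q + r]? = u[q' + r]?.map τ := by
    intro u hu r hr
    rw [← getElem?_window hr, hu, List.getElem?_map, getElem?_window hr]
  rcases lt_trichotomy q q' with h | rfl | h
  · refine card_determined_le hd (fun i l => l[q' - q - 1]?.map τ) q L hq _
      fun u _ hu i hi hi' => ?_
    have := hQ u hu (i - q) (by omega)
    rw [List.getElem?_drop, show i + 1 + (q' - q - 1) = q' + (i - q) by omega, ← this]
    congr 1
    omega
  · have hτ1 : τ ≠ 1 := fun h => hne ⟨h, rfl⟩
    obtain ⟨x, hx⟩ : ∃ x, τ x ≠ x := by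
      by_contra! hall
      exact hτ1 (Equiv.ext hall)
    refine le_trans ?_ (card_constrained_le hd (fun i t l => τ t = t) q L hq fun i l => ?_)
    · refine Nat.cast_le.mpr (redCount_mono fun u h1 h2 i hi hi' t ht => ?_)
      have := hQ u h2 (i - q) (by omega)
      rw [show q + (i - q) = i by omega, ht] at this
      exact (Option.some.inj this).symm
    · have h1 : {t | τ t = t} ⊆ ((Finset.univ.erase x).erase (linv x) : Finset (α × Bool)) := by
        intro t ht
        simp only [Finset.coe_erase, Finset.coe_univ]
        refine ⟨⟨trivial, fun e => hx ?_⟩, fun e => hx ?_⟩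
        · rw [← Set.mem_singleton_iff.mp e]
          exact ht
        · have h2 : τ t = t := ht
          rw [Set.mem_singleton_iff.mp e, hτ] at h2
          exact linv_inj.mp h2
      refine (Set.ncard_le_ncard h1).trans ?_
      rw [Set.ncard_coe_finset, Finset.card_erase_of_mem, Finset.card_erase_of_mem,
        Finset.card_univ]
      · omega
      · exact Finset.mem_univ _
      · simp [linv_ne_self]
  · refine card_determined_le hd (fun i l => l[q - q' - 1]?.map τ.symm) q' L hq' _
      fun u _ hu i hi hi' => ?_
    have := hQ u hu (i - q') (by omega)
    rw [List.getElem?_drop, show i + 1 + (q - q' - 1) = q + (i - q') by omega, this,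
      show q' + (i - q') = i by omega]
    simp

theorem card_eq_map_invRev_le (hd : 3 ≤ Fintype.card (α × Bool)) {n q q' L : ℕ} (hq : q + L ≤ n)
    (hq' : q' + L ≤ n) (τ : Equiv.Perm (α × Bool)) :
    (redCount n (fun u : List (α × Bool) =>
      (u.drop q).take L = (((FreeGroup.invRev u).drop q').take L).map τ) : ℝ) ≤
        letterRatio α ^ (L / 2) * (redWords α n).card := by
  have hQ : ∀ u : List (α × Bool), u.length = n →
      (u.drop q).take L = (((FreeGroup.invRev u).drop q').take L).map τ → ∀ r, r < L →
      u[q + r]? = u[n - 1 - q' - r]?.map (fun x => τ (linv x)) := by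
    intro u hun hu r hr
    rw [← getElem?_window hr, hu, List.getElem?_map, getElem?_window hr,
      getElem?_invRev u (by omega), Option.map_map, hun,
      show n - 1 - (q' + r) = n - 1 - q' - r by omega]
    rfl
  by_cases hc : q + L ≤ n - 1 - q'
  · refine card_determined_le hd (fun i l => l[n - 1 - q' + q - 2 * i - 1]?.map
      fun x => τ (linv x)) q (L / 2) (by omega) _ fun u hun hu i hi hi' => ?_
    have := hQ u hun hu (i - q) (by omega)
    rw [List.getElem?_drop, show i + 1 + (n - 1 - q' + q - 2 * i - 1) = n - 1 - q' - (i - q) by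
      omega, ← this]
    congr 1
    omega
  · refine card_determined_le hd (fun i l => l[n - 1 - q' + q - 2 * i - 1]?.map
      fun x => linv (τ.symm x)) (n - q' - L) (L / 2) (by omega) _ fun u hun hu i hi hi' => ?_
    have := hQ u hun hu (n - 1 - q' - i) (by omega)
    rw [List.getElem?_drop, show i + 1 + (n - 1 - q' + q - 2 * i - 1) =
      q + (n - 1 - q' - i) by omega, this,
      show n - 1 - q' - (n - 1 - q' - i) = i by omega]
    simp [Option.map_map, Function.comp_def]

end Rare

section Walk

variable {α : Type*}

theorem length_toWord_walk_le [DecidableEq α] (n : ℕ) (s : Fin n → α × Bool) :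
    (List.ofFn fun j => FreeGroup.mk [s j]).prod.toWord.length ≤ n := by
  have : (List.ofFn fun j => FreeGroup.mk [s j]).prod = FreeGroup.mk (List.ofFn s) := by
    induction n with
    | zero => rfl
    | succ n ih => rw [List.ofFn_succ, List.ofFn_succ, List.prod_cons, ih fun j => s j.succ,
        mk_cons (s 0) (List.ofFn _)]
  rw [this]
  exact FreeGroup.norm_mk_le.trans (by simp)

variable [Fintype α]

/-- The sum of a function over all walks of a given length. -/
def walkSum (n : ℕ) (F : FreeGroup α → ℝ) : ℝ :=
  ∑ s : Fin n → α × Bool, F (List.ofFn fun j => FreeGroup.mk [s j]).prod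

theorem walkSum_succ (n : ℕ) (F : FreeGroup α → ℝ) :
    walkSum (n + 1) F = walkSum n fun g => ∑ t, F (FreeGroup.mk [t] * g) := by
  simp only [walkSum]
  rw [← (Fin.consEquiv fun _ => α × Bool).sum_comp, Fintype.sum_prod_type, Finset.sum_comm]
  refine Finset.sum_congr rfl fun s _ => Finset.sum_congr rfl fun t _ => ?_
  simp [Fin.consEquiv, List.ofFn_succ]

theorem walkSum_mul_left (n : ℕ) (c : ℝ) (F : FreeGroup α → ℝ) :
    walkSum n (fun g => c * F g) = c * walkSum n F := by
  rw [walkSum, walkSum, Finset.mul_sum]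

theorem walkSum_const (n : ℕ) (c : ℝ) :
    walkSum n (fun _ : FreeGroup α => c) = c * (Fintype.card (α × Bool) : ℝ) ^ n := by
  rw [walkSum, Finset.sum_const, Finset.card_univ, Fintype.card_fun, Fintype.card_fin, nsmul_eq_mul,
    Nat.cast_pow, mul_comm]

theorem walkSum_mono {F G : FreeGroup α → ℝ} (h : ∀ g, F g ≤ G g) (n : ℕ) :
    walkSum n F ≤ walkSum n G :=
  Finset.sum_le_sum fun _ _ => h _

variable [DecidableEq α]

/-- Multiplying the elements of a sphere by a random letter gives elements of the two neighbouring
spheres. -/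
theorem exists_sum_redWords_mul (m : ℕ) : ∃ e : ℝ, 0 ≤ e ∧ ∀ F : FreeGroup α → ℝ,
    ∑ u ∈ redWords α m, ∑ t, F (FreeGroup.mk [t] * FreeGroup.mk u) =
      ∑ u ∈ redWords α (m + 1), F (FreeGroup.mk u) +
        e * ∑ u ∈ redWords α (m - 1), F (FreeGroup.mk u) := by
  have hsplit : ∀ F : FreeGroup α → ℝ,
      ∑ u ∈ redWords α m, ∑ t, F (FreeGroup.mk [t] * FreeGroup.mk u) =
      ∑ u ∈ redWords α (m + 1), F (FreeGroup.mk u) +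
        ∑ u ∈ redWords α m, ∑ t ∈ (precLetters u)ᶜ, F (FreeGroup.mk [t] * FreeGroup.mk u) := by
    intro F
    rw [sum_redWords_succ fun u => F (FreeGroup.mk u), ← Finset.sum_add_distrib]
    refine Finset.sum_congr rfl fun u _ => ?_
    rw [← Finset.sum_add_sum_compl (precLetters u)]
    simp only [mk_cons _ u]
  rcases m with _ | m
  · refine ⟨0, le_rfl, fun F => ?_⟩
    rw [hsplit, zero_mul]
    simp [redWords, precLetters]
  · obtain ⟨e, -, he, -⟩ := exists_card_redWords_succ (α := α) m
    refine ⟨e, Nat.cast_nonneg e, fun F => ?_⟩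
    rw [hsplit, sum_redWords_succ fun u =>
        ∑ t ∈ (precLetters u)ᶜ, F (FreeGroup.mk [t] * FreeGroup.mk u),
      Nat.add_sub_cancel, Finset.mul_sum]
    congr 1
    refine Finset.sum_congr rfl fun l hl => ?_
    rw [← he l hl, ← nsmul_eq_mul, ← Finset.sum_const]
    refine Finset.sum_congr rfl fun x _ => ?_
    rw [precLetters_cons, Finset.compl_erase, Finset.compl_univ, insert_empty_eq,
      Finset.sum_singleton, mk_cons x l, mk_linv, inv_mul_cancel_left]

/-- Walks of length `n` are uniform on every sphere. -/
theorem walkSum_le_of_sum_redWords_le {n : ℕ} {F G : FreeGroup α → ℝ}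
    (h : ∀ m ≤ n, ∑ u ∈ redWords α m, F (FreeGroup.mk u) ≤ ∑ u ∈ redWords α m, G (FreeGroup.mk u)) :
    walkSum n F ≤ walkSum n G := by
  induction n generalizing F G with
  | zero => simpa [walkSum, redWords, mk_nil] using h 0 le_rfl
  | succ n ih =>
    rw [walkSum_succ, walkSum_succ]
    refine ih fun m hm => ?_
    obtain ⟨e, he0, he⟩ := exists_sum_redWords_mul (α := α) m
    rw [he, he]
    exact add_le_add (h _ (by omega)) (mul_le_mul_of_nonneg_left (h _ (by omega)) he0)

theorem sum_half_pow_length_le (hd : 4 ≤ Fintype.card (α × Bool)) (g : FreeGroup α) :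
    ∑ t : α × Bool, (1 / 2 : ℝ) ^ (FreeGroup.mk [t] * g).toWord.length ≤
      7 / 8 * Fintype.card (α × Bool) * (1 / 2 : ℝ) ^ g.toWord.length := by
  have hd' : (4 : ℝ) ≤ Fintype.card (α × Bool) := by exact_mod_cast hd
  obtain ⟨u, hu, rfl⟩ : ∃ u, FreeGroup.IsReduced u ∧ g = FreeGroup.mk u :=
    ⟨g.toWord, FreeGroup.isReduced_toWord, FreeGroup.mk_toWord.symm⟩
  have h1 : ∀ t ∈ precLetters u, (1 / 2 : ℝ) ^ (FreeGroup.mk [t] * FreeGroup.mk u).toWord.length =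
      1 / 2 * (1 / 2 : ℝ) ^ u.length := by
    intro t ht
    rw [← mk_cons, toWord_mk_of_isReduced (isReduced_cons_iff.mpr
      ⟨by simpa [precLetters] using ht, hu⟩), List.length_cons, pow_succ']
  rw [← Finset.sum_add_sum_compl (precLetters u), Finset.sum_congr rfl h1,
    toWord_mk_of_isReduced hu, Finset.sum_const, nsmul_eq_mul]
  rcases u with _ | ⟨x, l⟩
  · rw [card_precLetters_nil, show precLetters ([] : List (α × Bool)) = Finset.univ by
      simp [precLetters], Finset.compl_univ, Finset.sum_empty, List.length_nil]
    linarith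
  · have hl := (isReduced_cons_iff.mp hu).2
    rw [card_precLetters_cons, precLetters_cons, Finset.compl_erase, Finset.compl_univ,
      insert_empty_eq, Finset.sum_singleton, mk_cons x l, mk_linv, inv_mul_cancel_left,
      toWord_mk_of_isReduced hl, List.length_cons, Nat.cast_sub (by omega), Nat.cast_one]
    have := pow_pos (by norm_num : (0:ℝ) < 1 / 2) l.length
    rw [pow_succ]
    nlinarith

theorem walkSum_half_pow_length_le (hd : 4 ≤ Fintype.card (α × Bool)) (n : ℕ) :
    walkSum n (fun g : FreeGroup α => (1 / 2 : ℝ) ^ g.toWord.length) ≤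
      (7 / 8 * Fintype.card (α × Bool) : ℝ) ^ n := by
  induction n with
  | zero => simp [walkSum]
  | succ n ih =>
    rw [walkSum_succ]
    refine (walkSum_mono (fun g => sum_half_pow_length_le hd g) n).trans ?_
    rw [walkSum_mul_left, pow_succ']
    exact mul_le_mul_of_nonneg_left ih (by positivity)

end Walk

section Measure

theorem expDecay_of_le {f : ℕ → ENNReal} {K σ : ℝ} {m : ℕ} (hK : 0 < K) (hσ : 0 < σ) (hσ1 : σ < 1)
    (hm : 0 < m) (h : ∀ n, f n ≤ ENNReal.ofReal (K * (n + 1) ^ 2 * σ ^ (n / m))) : ExpDecay f := by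
  set r := σ ^ ((1 : ℝ) / (2 * m)) with hr
  have hm' : (0 : ℝ) < m := by exact_mod_cast hm
  have hr0 : 0 < r := Real.rpow_pos_of_pos hσ _
  have hr1 : r < 1 := Real.rpow_lt_one hσ.le hσ1 (by positivity)
  have hrm : r ^ (2 * m) = σ := by
    rw [hr, ← Real.rpow_natCast, ← Real.rpow_mul hσ.le]
    push_cast
    rw [one_div_mul_cancel (by positivity), Real.rpow_one]
  obtain ⟨B, hB⟩ : ∃ B : ℝ, ∀ n : ℕ, ((n : ℝ) + 1) ^ 2 * r ^ n ≤ B := by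
    have ht := tendsto_pow_const_mul_const_pow_of_abs_lt_one 2
      (by rwa [abs_of_pos hr0] : |r| < 1)
    obtain ⟨B, hB⟩ := ht.bddAbove_range
    refine ⟨B / r, fun n => ?_⟩
    rw [le_div_iff₀ hr0]
    have := hB ⟨n + 1, rfl⟩
    push_cast at this
    rwa [pow_succ r, ← mul_assoc] at this
  have hB0 : 0 < B := lt_of_lt_of_le (by norm_num) (hB 0)
  refine ⟨K * B / σ, by positivity, r⁻¹, (one_lt_inv₀ hr0).mpr hr1, fun n => (h n).trans ?_⟩
  refine ENNReal.ofReal_le_ofReal ?_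
  have h1 : σ ^ (n / m) * σ ≤ r ^ n * r ^ n := by
    rw [← pow_succ, ← hrm, ← pow_mul, ← pow_add]
    refine pow_le_pow_of_le_one hr0.le hr1.le ?_
    have := Nat.lt_mul_div_succ n hm
    nlinarith
  have hrn : 0 < r ^ n := pow_pos hr0 n
  rw [inv_pow, div_inv_eq_mul, div_mul_eq_mul_div, le_div_iff₀ hσ]
  calc _ = K * ((n : ℝ) + 1) ^ 2 * (σ ^ (n / m) * σ) := by ring
    _ ≤ K * ((n : ℝ) + 1) ^ 2 * (r ^ n * r ^ n) := by gcongr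
    _ = K * (((n : ℝ) + 1) ^ 2 * r ^ n) * r ^ n := by ring
    _ ≤ _ := by gcongr; exact hB n

variable {k : ℕ}

instance : DiscreteMeasurableSpace (FreeGroup (Fin k)) := ⟨fun _ => trivial⟩

instance : Countable (FreeGroup (Fin k)) := FreeGroup.toWord_injective.countable

theorem walkMeasure_le (hk : 0 < k) (n : ℕ) {S : Set (FreeGroup (Fin k))}
    {F : FreeGroup (Fin k) → ℝ} (hF : ∀ g, 0 ≤ F g)
    (h : ∀ g ∈ S, g.toWord.length ≤ n → 1 ≤ F g) :
    walkMeasure k n S ≤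
      ENNReal.ofReal (walkSum n F / (Fintype.card (Fin k × Bool) : ℝ) ^ n) := by
  classical
  have hd : 0 < Fintype.card (Fin k × Bool) := by simp; omega
  have hc : Fintype.card (Fin n → Fin k × Bool) = Fintype.card (Fin k × Bool) ^ n := by simp
  rw [walkMeasure, Measure.map_apply (measurable_of_countable _) (.of_discrete), Measure.smul_apply,
    Measure.count_apply_finite _ (Set.toFinite _), hc, smul_eq_mul, mul_comm, ← div_eq_mul_inv]
  rw [ENNReal.ofReal_div_of_pos (by positivity), ← Nat.cast_pow, ENNReal.ofReal_natCast]
  gcongr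
  rw [← ENNReal.ofReal_natCast]
  refine ENNReal.ofReal_le_ofReal ?_
  rw [Finset.card_eq_sum_ones, Nat.cast_sum, walkSum]
  refine (Finset.sum_le_sum fun s hs => ?_).trans
    (Finset.sum_le_sum_of_subset_of_nonneg (Finset.subset_univ _) fun s _ _ => hF _)
  rw [Nat.cast_one]
  exact h _ (by simpa using hs) (length_toWord_walk_le n s)

theorem isProbabilityMeasure_walkMeasure (hk : 0 < k) (n : ℕ) :
    IsProbabilityMeasure (walkMeasure k n) := by
  have : Nonempty (Fin k × Bool) := ⟨(⟨0, hk⟩, true)⟩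
  constructor
  rw [walkMeasure, Measure.map_apply (measurable_of_countable _) (.of_discrete), Measure.smul_apply,
    Set.preimage_univ, Measure.count_univ, ENat.card_eq_coe_fintype_card, smul_eq_mul]
  exact ENNReal.inv_mul_cancel (Nat.cast_ne_zero.mpr Fintype.card_ne_zero)
    (ENNReal.natCast_ne_top _)

theorem walkMeasure_lt_length (hk : 0 < k) (n : ℕ) :
    walkMeasure k n {g | ¬ g.toWord.length ≤ n} = 0 := by
  refine le_antisymm ((walkMeasure_le hk n (F := fun _ => 0) (fun _ => le_rfl)
    fun g hg hg' => absurd hg' hg).trans ?_) zero_le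
  simp [walkSum]

theorem walkMeasure_length_lt_le (hk : 2 ≤ k) (n M : ℕ) :
    walkMeasure k n {g | g.toWord.length < M} ≤ ENNReal.ofReal (2 ^ M * (7 / 8) ^ n) := by
  have hd : 4 ≤ Fintype.card (Fin k × Bool) := by simp; omega
  refine (walkMeasure_le (by omega) n
    (F := fun g => 2 ^ M * (1 / 2 : ℝ) ^ g.toWord.length) (fun g => by positivity)
    fun g hg _ => ?_).trans (ENNReal.ofReal_le_ofReal ?_)
  · rw [one_div, inv_pow, ← div_eq_mul_inv, one_le_div (by positivity)]
    exact pow_le_pow_right₀ (by norm_num) (le_of_lt hg)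
  · rw [walkSum_mul_left, div_le_iff₀ (by positivity), mul_assoc, ← mul_pow]
    gcongr
    exact walkSum_half_pow_length_le hd n

theorem walkMeasure_toWord_le (hk : 0 < k) {n : ℕ} {c : ℝ}
    {Q : List (Fin k × Bool) → Prop}
    (h : ∀ m ≤ n, (redCount m Q : ℝ) ≤ c * (redWords (Fin k) m).card) :
    walkMeasure k n {g | Q g.toWord} ≤ ENNReal.ofReal c := by
  classical
  have hd : 0 < Fintype.card (Fin k × Bool) := by simp; omega
  refine (walkMeasure_le hk n (F := fun g => if Q g.toWord then 1 else 0)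
    (fun g => by split_ifs <;> norm_num) fun g hg _ => ?_).trans
      (ENNReal.ofReal_le_ofReal ?_)
  · exact (if_pos hg).ge
  · rw [div_le_iff₀ (by positivity), ← walkSum_const]
    refine walkSum_le_of_sum_redWords_le fun m hm => ?_
    rw [Finset.sum_const, nsmul_eq_mul, mul_comm]
    refine le_trans (le_of_eq ?_) (h m hm)
    rw [redCount_eq_card_filter, Finset.card_filter, Nat.cast_sum]
    refine Finset.sum_congr rfl fun u hu => ?_
    rw [toWord_mk_of_isReduced (mem_redWords.mp hu).1]
    simp

end Measure

section Typical

variable {α : Type*}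

/-- Two words without common subwords of length `L`, up to permutations of the letters. -/
def Unrelated (L : ℕ) (A B : List (α × Bool)) : Prop :=
  ∀ τ : Equiv.Perm (α × Bool), ∀ q q', q + L ≤ A.length → q' + L ≤ B.length →
    (A.drop q).take L ≠ ((B.drop q').take L).map τ

/-- A word of length between `M` and `n`, without repeated subwords of length `L` (up to
inversion and permutations of the letters), in which every admissible pair of consecutive letters
has frequency at least `c`. -/
structure Typical [DecidableEq α] (L M n : ℕ) (c : ℝ) (A : List (α × Bool)) : Prop where
  le_length : M ≤ A.length
  length_le : A.length ≤ n
  pairs : ∀ a b, a ≠ linv b → c * A.length < pairCount a b A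
  self : ∀ τ : Equiv.Perm (α × Bool), (∀ x, τ (linv x) = linv (τ x)) → ∀ q q',
    q + L ≤ A.length → q' + L ≤ A.length →
    (A.drop q).take L = ((A.drop q').take L).map τ → τ = 1 ∧ q = q'
  inv : Unrelated L A (FreeGroup.invRev A)

theorem window_invRev {B : List (α × Bool)} {q L : ℕ} (h : q + L ≤ B.length) :
    ((FreeGroup.invRev B).drop q).take L =
      FreeGroup.invRev ((B.drop (B.length - q - L)).take L) := by
  refine List.ext_getElem? fun r => ?_
  by_cases hr : r < L
  · have hl : ((B.drop (B.length - q - L)).take L).length = L := by simp; omega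
    rw [getElem?_window hr, getElem?_invRev _ (by omega), getElem?_invRev _ (by omega), hl,
      getElem?_window (by omega)]
    congr 2
    omega
  · rw [List.getElem?_eq_none, List.getElem?_eq_none] <;> simp <;> omega

theorem invRev_map {τ : Equiv.Perm (α × Bool)} (hτ : ∀ x, τ (linv x) = linv (τ x))
    (l : List (α × Bool)) : FreeGroup.invRev (l.map τ) = (FreeGroup.invRev l).map τ := by
  simp only [FreeGroup.invRev, List.map_reverse, List.map_map]
  congr 2
  ext1 x
  exact (hτ x).symm

theorem window_eq_of_invRev {B B' : List (α × Bool)} {q q' L : ℕ} {τ : Equiv.Perm (α × Bool)}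
    (hτ : ∀ x, τ (linv x) = linv (τ x)) (h : q + L ≤ B.length) (h' : q' + L ≤ B'.length)
    (e : ((FreeGroup.invRev B).drop q).take L = (((FreeGroup.invRev B').drop q').take L).map τ) :
    (B.drop (B.length - q - L)).take L = ((B'.drop (B'.length - q' - L)).take L).map τ := by
  rw [window_invRev h, window_invRev h', ← invRev_map hτ] at e
  exact FreeGroup.invRev_injective e

end Typical

section Generic

variable {α ι : Type*} [DecidableEq α] {w : ι → FreeGroup α} {L M n D : ℕ} {c : ℝ}

theorem generic_of_typical (hL : 1 ≤ L) (hM : 20 * L ≤ M) (hD : 0 < D)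
    (hc : ∀ m : ℕ, M ≤ m → 2 * (m : ℝ) + D * (4 * L) ≤ D * (2 * (c * m)))
    (hw : ∀ i, Typical L M n c (w i).toWord)
    (hww : ∀ i j, i ≠ j → ∀ s, Unrelated L (w i).toWord (block w (j, s))) : Generic w L D := by
  have hb : ∀ i, block w (i, true) = (w i).toWord := fun i => by
    rw [block, FreeGroup.lift_mk]
    simp
  have hb' : ∀ i, block w (i, false) = FreeGroup.invRev (w i).toWord := fun i => by
    rw [← hb, ← block_linv]
    rfl
  have hlen : ∀ i s, (block w (i, s)).length = (w i).toWord.length := by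
    rintro i (_ | _)
    · rw [hb', FreeGroup.invRev_length]
    · rw [hb]
  have hturn : ∀ i s t t', turn t t' (block w (i, s)) = turn t t' (w i).toWord := by
    rintro i (_ | _) t t'
    · rw [hb', turn_invRev]
    · rw [hb]
  have huniq : ∀ τ : Equiv.Perm (α × Bool), (∀ x, τ (linv x) = linv (τ x)) → ∀ i y' q q',
      q + L ≤ (block w (i, true)).length → q' + L ≤ (block w y').length →
      ((block w (i, true)).drop q).take L = (((block w y').drop q').take L).map τ →
      τ = 1 ∧ (i, true) = y' ∧ q = q' := by
    rintro τ hτ i ⟨j, s⟩ q q' hq hq' e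
    rw [hb] at hq e
    by_cases hij : i = j
    · subst hij
      rcases s with _ | _
      · rw [hb'] at e hq'
        exact absurd e ((hw i).inv τ q q' hq hq')
      · rw [hb] at e hq'
        obtain ⟨h1, h2⟩ := (hw i).self τ hτ q q' hq hq' e
        exact ⟨h1, rfl, h2⟩
    · exact absurd e (hww i j hij s τ q q' hq hq')
  refine ⟨hL, ?_, ?_, ?_⟩
  · rintro ⟨i, s⟩
    rw [hlen]
    exact hM.trans (hw i).le_length
  · rintro τ hτ ⟨i, s⟩ y' q q' hq hq' e
    rcases s with _ | _
    · rw [show ((i, false) : ι × Bool) = linv (i, true) from rfl, ← linv_linv y', block_linv,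
        block_linv w (linv y')] at e
      have hy' : (block w (linv y')).length = (block w y').length := by
        rw [block_linv, FreeGroup.invRev_length]
      have hi : (block w (i, true)).length = (block w (i, false)).length := by
        rw [hlen, hlen]
      have e' := window_eq_of_invRev hτ (hi ▸ hq) (hy' ▸ hq') e
      obtain ⟨h1, h2, h3⟩ := huniq τ hτ i (linv y') _ _ (by omega) (by omega) e'
      obtain rfl : y' = (i, false) := by rw [← linv_linv y', ← h2]; rfl
      rw [← h2] at h3
      exact ⟨h1, rfl, by omega⟩
    · exact huniq τ hτ i y' q q' hq hq' e
  · rintro ⟨i, s⟩ t t' htt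
    rw [hlen, hturn, turn]
    have h1 := (hw i).pairs (linv t) t' (fun h => htt (linv_inj.mp h))
    have h2 := (hw i).pairs (linv t') t (fun h => htt (linv_inj.mp h).symm)
    have h3 := hc _ (hw i).le_length
    have hD' : (0 : ℝ) < D := by exact_mod_cast hD
    have : (2 * (w i).toWord.length + D * (4 * L) : ℝ) <
        D * (pairCount (linv t) t' (w i).toWord + pairCount (linv t') t (w i).toWord) := by
      refine h3.trans_lt (mul_lt_mul_of_pos_left ?_ hD')
      linarith
    exact_mod_cast this

end Generic

section Union

variable {α : Type*} [DecidableEq α] [Fintype α]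

theorem redCount_exists_le_mul {ι : Type*} (s : Finset ι) {m : ℕ} {b : ℝ}
    {Q : ι → List (α × Bool) → Prop}
    (h : ∀ i ∈ s, (redCount m (Q i) : ℝ) ≤ b * (redWords α m).card) :
    (redCount m (fun u => ∃ i ∈ s, Q i u) : ℝ) ≤ s.card * b * (redWords α m).card := by
  refine (Nat.cast_le.mpr (redCount_exists_le s m Q)).trans ?_
  rw [Nat.cast_sum, mul_assoc, ← nsmul_eq_mul]
  exact Finset.sum_le_card_nsmul _ _ _ h

theorem redCount_le_of_imp {m : ℕ} {b : ℝ} (hb : 0 ≤ b) {P : Prop} {Q : List (α × Bool) → Prop}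
    (hP : ∀ u ∈ redWords α m, Q u → P) (h : P → (redCount m Q : ℝ) ≤ b) :
    (redCount m Q : ℝ) ≤ b := by
  by_cases hp : P
  · exact h hp
  · have : {u | u ∈ redWords α m ∧ Q u} = ∅ :=
      Set.eq_empty_of_forall_notMem fun u hu => hp (hP u hu.1 hu.2)
    rwa [redCount, this, Set.ncard_empty, Nat.cast_zero]

/-- A union bound over the positions of two subwords and the permutations of the letters. -/
theorem redCount_windows_le {n m L : ℕ} {b : ℝ} (hb : 0 ≤ b)
    {E : Equiv.Perm (α × Bool) → ℕ → ℕ → List (α × Bool) → Prop}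
    (h : ∀ τ q q', q + L ≤ m → (redCount m (E τ q q') : ℝ) ≤ b * (redWords α m).card) :
    (redCount m (fun u => ∃ τ q q', q ≤ n ∧ q' ≤ n ∧ q + L ≤ u.length ∧ E τ q q' u) : ℝ) ≤
      Fintype.card (Equiv.Perm (α × Bool)) * (n + 1) ^ 2 * b * (redWords α m).card := by
  have h1 := redCount_exists_le_mul (m := m) (b := b)
    (Finset.univ ×ˢ (Finset.range (n + 1) ×ˢ Finset.range (n + 1)))
    (Q := fun x u => x.2.1 + L ≤ u.length ∧ E x.1 x.2.1 x.2.2 u) fun x _ => by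
      refine redCount_le_of_imp (P := x.2.1 + L ≤ m) (by positivity) (fun u hu hQ => ?_)
        fun hP => ?_
      · rw [← (mem_redWords.mp hu).2]
        exact hQ.1
      · exact (Nat.cast_le.mpr (redCount_mono fun u _ hu => hu.2)).trans (h _ _ _ hP)
  refine le_trans (Nat.cast_le.mpr (redCount_mono ?_)) (h1.trans (le_of_eq ?_))
  · rintro u - ⟨τ, q, q', hq, hq', hu⟩
    exact ⟨(τ, q, q'), by simp; omega, hu⟩
  · rw [Finset.card_product, Finset.card_product, Finset.card_univ, Finset.card_range]
    push_cast
    ring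

end Union

section Walks

variable {k : ℕ}

theorem walkMeasure_rarePair_le (hk : 2 ≤ k) {M n : ℕ} {ε c : ℝ} (hε0 : 0 < ε)
    (hε : ε ≤ 1 / ((Fintype.card (Fin k × Bool) : ℝ) * (Fintype.card (Fin k × Bool) - 1)))
    (hc : c = 1 / ((Fintype.card (Fin k × Bool) : ℝ) * (Fintype.card (Fin k × Bool) - 1)) - 2 * ε) :
    walkMeasure k n {g | M ≤ g.toWord.length ∧
      ∃ a b, a ≠ linv b ∧ pairCount a b g.toWord ≤ c * g.toWord.length} ≤
      ENNReal.ofReal ((Fintype.card (Fin k × Bool)) ^ 2 * (4 * Real.exp 1) *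
        Real.exp (-(ε ^ 2 / 2)) ^ M) := by
  have hd : 3 ≤ Fintype.card (Fin k × Bool) := by simp; omega
  refine walkMeasure_toWord_le (by omega) (Q := fun u => M ≤ u.length ∧
      ∃ a b, a ≠ linv b ∧ pairCount a b u ≤ c * u.length) fun m _ => ?_
  have h1 := redCount_exists_le_mul (α := Fin k) (m := m)
    (b := 4 * Real.exp 1 * Real.exp (-(ε ^ 2 / 2)) ^ M)
    (Finset.univ ×ˢ Finset.univ)
    (Q := fun x u => M ≤ u.length ∧ x.1 ≠ linv x.2 ∧ pairCount x.1 x.2 u ≤ c * u.length)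
    fun x _ => by
      refine redCount_le_of_imp (P := M ≤ m ∧ x.1 ≠ linv x.2) (by positivity) (fun u hu hQ => ?_)
        fun hP => ?_
      · rw [← (mem_redWords.mp hu).2]
        exact ⟨hQ.1, hQ.2.1⟩
      · refine le_trans (Nat.cast_le.mpr (redCount_mono fun u hu hQ => ?_))
          ((card_pairCount_le hP.2 hd hε0 hε m).trans ?_)
        · have := hQ.2.2
          rwa [(mem_redWords.mp hu).2, hc] at this
        · gcongr
          rw [← Real.exp_nat_mul]
          refine Real.exp_le_exp.mpr ?_
          have : (M : ℝ) ≤ m := by exact_mod_cast hP.1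
          nlinarith [sq_nonneg ε]
  refine le_trans (Nat.cast_le.mpr (redCount_mono ?_)) (h1.trans (le_of_eq ?_))
  · rintro u - ⟨hM, a, b, h⟩
    exact ⟨(a, b), by simp, hM, h⟩
  · rw [Finset.card_product, Finset.card_univ]
    push_cast
    ring

theorem letterRatio_pow_le (hk : 2 ≤ k) (L : ℕ) :
    letterRatio (Fin k) ^ L ≤ letterRatio (Fin k) ^ (L / 2) := by
  have hd : 3 ≤ Fintype.card (Fin k × Bool) := by simp; omega
  exact pow_le_pow_of_le_one (letterRatio_nonneg hd) (letterRatio_lt_one hd).le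
    (Nat.div_le_self _ _)

theorem walkMeasure_repeat_le (hk : 2 ≤ k) {L n : ℕ} :
    walkMeasure k n {g | g.toWord.length ≤ n ∧ ∃ τ : Equiv.Perm (Fin k × Bool),
      ∃ q q', (∀ x, τ (linv x) = linv (τ x)) ∧ q + L ≤ g.toWord.length ∧
        q' + L ≤ g.toWord.length ∧
        (g.toWord.drop q).take L = ((g.toWord.drop q').take L).map τ ∧ ¬ (τ = 1 ∧ q = q')} ≤
      ENNReal.ofReal (Fintype.card (Equiv.Perm (Fin k × Bool)) * (n + 1) ^ 2 *
        letterRatio (Fin k) ^ (L / 2)) := by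
  have hd : 3 ≤ Fintype.card (Fin k × Bool) := by simp; omega
  have hρ := letterRatio_nonneg (α := Fin k) hd
  refine walkMeasure_toWord_le (by omega) (Q := fun u => u.length ≤ n ∧
    ∃ τ : Equiv.Perm (Fin k × Bool), ∃ q q', (∀ x, τ (linv x) = linv (τ x)) ∧ q + L ≤ u.length ∧
      q' + L ≤ u.length ∧ (u.drop q).take L = ((u.drop q').take L).map τ ∧ ¬ (τ = 1 ∧ q = q'))
    fun m _ => ?_
  refine le_trans (Nat.cast_le.mpr (redCount_mono ?_)) (redCount_windows_le (n := n) (L := L)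
    (E := fun τ q q' u => (∀ x, τ (linv x) = linv (τ x)) ∧ q' + L ≤ u.length ∧
      (u.drop q).take L = ((u.drop q').take L).map τ ∧ ¬ (τ = 1 ∧ q = q')) (by positivity) ?_)
  · rintro u - ⟨hn, τ, q, q', hτ, hq, hq', h⟩
    exact ⟨τ, q, q', by omega, by omega, hq, hτ, hq', h⟩
  · intro τ q q' hq
    refine redCount_le_of_imp (P := (∀ x, τ (linv x) = linv (τ x)) ∧ q' + L ≤ m ∧
      ¬ (τ = 1 ∧ q = q')) (by positivity) (fun u hu hQ => ?_) fun hP => ?_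
    · rw [← (mem_redWords.mp hu).2]
      exact ⟨hQ.1, hQ.2.1, hQ.2.2.2⟩
    · refine (Nat.cast_le.mpr (redCount_mono fun u _ hu => hu.2.2.1)).trans
        ((card_eq_map_self_le hd hq hP.2.1 hP.1 hP.2.2).trans ?_)
      exact mul_le_mul_of_nonneg_right (letterRatio_pow_le hk L) (Nat.cast_nonneg _)

theorem walkMeasure_not_unrelated_invRev_le (hk : 2 ≤ k) {L n : ℕ} :
    walkMeasure k n {g | g.toWord.length ≤ n ∧
      ¬ Unrelated L g.toWord (FreeGroup.invRev g.toWord)} ≤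
      ENNReal.ofReal (Fintype.card (Equiv.Perm (Fin k × Bool)) * (n + 1) ^ 2 *
        letterRatio (Fin k) ^ (L / 2)) := by
  have hd : 3 ≤ Fintype.card (Fin k × Bool) := by simp; omega
  have hρ := letterRatio_nonneg (α := Fin k) hd
  refine walkMeasure_toWord_le (by omega)
    (Q := fun u => u.length ≤ n ∧ ¬ Unrelated L u (FreeGroup.invRev u)) fun m _ => ?_
  refine le_trans (Nat.cast_le.mpr (redCount_mono ?_)) (redCount_windows_le (n := n) (L := L)
    (E := fun τ q q' u => q' + L ≤ u.length ∧
      (u.drop q).take L = (((FreeGroup.invRev u).drop q').take L).map τ) (by positivity) ?_)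
  · rintro u - ⟨hn, h⟩
    simp only [Unrelated, ne_eq, not_forall, not_not, FreeGroup.invRev_length] at h
    obtain ⟨τ, q, q', hq, hq', h⟩ := h
    exact ⟨τ, q, q', by omega, by omega, hq, hq', h⟩
  · intro τ q q' hq
    refine redCount_le_of_imp (P := q' + L ≤ m) (by positivity) (fun u hu hQ => ?_) fun hP => ?_
    · rw [← (mem_redWords.mp hu).2]
      exact hQ.1
    · exact (Nat.cast_le.mpr (redCount_mono fun u _ hu => hu.2)).trans
        (card_eq_map_invRev_le hd hq hP τ)

theorem walkMeasure_not_unrelated_le (hk : 2 ≤ k) {L n : ℕ} {B : List (Fin k × Bool)}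
    (hB : B.length ≤ n) :
    walkMeasure k n {g | g.toWord.length ≤ n ∧ ¬ Unrelated L g.toWord B} ≤
      ENNReal.ofReal (Fintype.card (Equiv.Perm (Fin k × Bool)) * (n + 1) ^ 2 *
        letterRatio (Fin k) ^ (L / 2)) := by
  have hd : 3 ≤ Fintype.card (Fin k × Bool) := by simp; omega
  have hρ := letterRatio_nonneg (α := Fin k) hd
  refine walkMeasure_toWord_le (by omega)
    (Q := fun u => u.length ≤ n ∧ ¬ Unrelated L u B) fun m _ => ?_
  refine le_trans (Nat.cast_le.mpr (redCount_mono ?_)) (redCount_windows_le (n := n) (L := L)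
    (E := fun τ q q' u => (u.drop q).take L = ((B.drop q').take L).map τ) (by positivity) ?_)
  · rintro u - ⟨hn, h⟩
    simp only [Unrelated, ne_eq, not_forall, not_not] at h
    obtain ⟨τ, q, q', hq, hq', h⟩ := h
    exact ⟨τ, q, q', by omega, by omega, hq, h⟩
  · intro τ q q' hq
    refine (card_eq_fixed_le hd hq _).trans ?_
    exact mul_le_mul_of_nonneg_right (letterRatio_pow_le hk L) (Nat.cast_nonneg _)

end Walks

section Independent

theorem measure_pi_pair_le {X : Type*} [MeasurableSpace X] {ι : Type*} [Fintype ι] (μ : Measure X)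
    [IsProbabilityMeasure μ] {i j : ι} (hij : i ≠ j) {S : Set (X × X)} (hS : MeasurableSet S)
    {e : ENNReal} (h : ∀ y, μ {x | (x, y) ∈ S} ≤ e) :
    Measure.pi (fun _ : ι => μ) {w | (w i, w j) ∈ S} ≤ e := by
  have hind := (ProbabilityTheory.iIndepFun_pi (μ := fun _ : ι => μ) (X := fun _ => id)
    fun _ => aemeasurable_id).indepFun hij
  have hmap := (ProbabilityTheory.indepFun_iff_map_prod_eq_prod_map_map
    (measurable_pi_apply i).aemeasurable (measurable_pi_apply j).aemeasurable).mp hind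
  have hi : ∀ i, Measure.map (fun w : ι → X => w i) (Measure.pi fun _ : ι => μ) = μ :=
    fun i => (measurePreserving_eval (fun _ : ι => μ) i).map_eq
  rw [hi, hi] at hmap
  have : Measure.pi (fun _ : ι => μ) {w | (w i, w j) ∈ S} = (μ.prod μ) S := by
    rw [← hmap, Measure.map_apply (by fun_prop) hS]
    rfl
  rw [this, Measure.prod_apply_symm hS]
  refine (lintegral_mono h).trans ?_
  simp

end Independent

section Estimate

variable {k : ℕ}

theorem walkMeasure_not_typical_le (hk : 2 ≤ k) {L R n : ℕ} {σ K ε c : ℝ} (hε0 : 0 < ε)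
    (hε : ε ≤ 1 / ((Fintype.card (Fin k × Bool) : ℝ) * (Fintype.card (Fin k × Bool) - 1)))
    (hc : c = 1 / ((Fintype.card (Fin k × Bool) : ℝ) * (Fintype.card (Fin k × Bool) - 1)) - 2 * ε)
    (hR : 1 ≤ R) (hn : 8 * (R * L) ≤ n) (hσ1 : σ ≤ 1) (hσ : 7 / 10 ≤ σ)
    (hσε : Real.exp (-(ε ^ 2 / 2)) ≤ σ) (hσρ : letterRatio (Fin k) ≤ σ)
    (hK : (Fintype.card (Fin k × Bool)) ^ 2 * (4 * Real.exp 1) ≤ K)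
    (hK' : Fintype.card (Equiv.Perm (Fin k × Bool)) ≤ K) :
    walkMeasure k n {g | ¬ Typical L (R * L) n c g.toWord} ≤
      4 * ENNReal.ofReal (K * (n + 1) ^ 2 * σ ^ (L / 2)) := by
  have hd : 3 ≤ Fintype.card (Fin k × Bool) := by simp; omega
  have hσ0 : 0 ≤ σ := by linarith
  have hn1 : (1 : ℝ) ≤ (n + 1) ^ 2 := one_le_pow₀ (by linarith [Nat.cast_nonneg (α := ℝ) n])
  have hK1 : 1 ≤ K := le_trans (by exact_mod_cast Fintype.card_pos) hK'
  have hpow : ∀ x : ℝ, 0 ≤ x → x ≤ σ → x ^ (R * L) ≤ σ ^ (L / 2) := fun x h0 h1 =>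
    (pow_le_pow_left₀ h0 h1 _).trans (pow_le_pow_of_le_one hσ0 hσ1
      ((Nat.div_le_self _ _).trans (Nat.le_mul_of_pos_left _ hR)))
  have hshort := (walkMeasure_length_lt_le hk n (R * L)).trans
    (ENNReal.ofReal_le_ofReal (q := K * (n + 1) ^ 2 * σ ^ (L / 2)) (by
      calc (2 : ℝ) ^ (R * L) * (7 / 8) ^ n ≤ 2 ^ (R * L) * (7 / 8) ^ (8 * (R * L)) :=
            mul_le_mul_of_nonneg_left (pow_le_pow_of_le_one (by norm_num) (by norm_num) hn)
              (by positivity)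
        _ = (2 * (7 / 8) ^ 8) ^ (R * L) := by rw [pow_mul _ 8, ← mul_pow]
        _ ≤ σ ^ (L / 2) := hpow _ (by norm_num) (le_trans (by norm_num) hσ)
        _ = 1 * 1 * σ ^ (L / 2) := by ring
        _ ≤ _ := by gcongr))
  have hpair := (walkMeasure_rarePair_le (M := R * L) (n := n) hk hε0 hε hc).trans
    (ENNReal.ofReal_le_ofReal (q := K * (n + 1) ^ 2 * σ ^ (L / 2)) (by
      calc _ ≤ K * σ ^ (L / 2) :=
            mul_le_mul hK (hpow _ (Real.exp_pos _).le hσε) (by positivity) (by positivity)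
        _ = K * 1 * σ ^ (L / 2) := by ring
        _ ≤ _ := by gcongr))
  have hρ := letterRatio_nonneg (α := Fin k) hd
  have hwin : ENNReal.ofReal (Fintype.card (Equiv.Perm (Fin k × Bool)) * (n + 1) ^ 2 *
      letterRatio (Fin k) ^ (L / 2)) ≤ ENNReal.ofReal (K * (n + 1) ^ 2 * σ ^ (L / 2)) :=
    ENNReal.ofReal_le_ofReal (by gcongr)
  have hself := (walkMeasure_repeat_le (L := L) (n := n) hk).trans hwin
  have hinv := (walkMeasure_not_unrelated_invRev_le (L := L) (n := n) hk).trans hwin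
  have hlen := walkMeasure_lt_length (k := k) (by omega) n
  have hsub : {g : FreeGroup (Fin k) | ¬ Typical L (R * L) n c g.toWord} ⊆
      {g | ¬ g.toWord.length ≤ n} ∪ ({g | g.toWord.length < R * L} ∪
        ({g | R * L ≤ g.toWord.length ∧
          ∃ a b, a ≠ linv b ∧ pairCount a b g.toWord ≤ c * g.toWord.length} ∪
        ({g | g.toWord.length ≤ n ∧ ∃ τ : Equiv.Perm (Fin k × Bool),
          ∃ q q', (∀ x, τ (linv x) = linv (τ x)) ∧ q + L ≤ g.toWord.length ∧
            q' + L ≤ g.toWord.length ∧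
            (g.toWord.drop q).take L = ((g.toWord.drop q').take L).map τ ∧ ¬ (τ = 1 ∧ q = q')} ∪
        {g | g.toWord.length ≤ n ∧ ¬ Unrelated L g.toWord (FreeGroup.invRev g.toWord)}))) := by
    intro g hg
    simp only [Set.mem_union, Set.mem_ofPred_eq] at hg ⊢
    by_contra! h
    obtain ⟨h1, h2, h3, h4, h5⟩ := h
    exact hg ⟨h2, h1, fun a b => h3 h2 a b,
      fun τ hτ q q' hq hq' e => h4 h1 τ q q' hτ hq hq' e, h5 h1⟩
  refine (measure_mono hsub).trans ?_
  refine (measure_union_le _ _).trans ?_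
  rw [hlen, zero_add]
  refine (measure_union_le _ _).trans ((add_le_add hshort ((measure_union_le _ _).trans
    (add_le_add hpair ((measure_union_le _ _).trans (add_le_add hself hinv))))).trans
      (le_of_eq ?_))
  ring

theorem measure_pi_not_typical_le (hk : 2 ≤ k) (p : ℕ) {L R n : ℕ} {σ K ε c : ℝ} (hε0 : 0 < ε)
    (hε : ε ≤ 1 / ((Fintype.card (Fin k × Bool) : ℝ) * (Fintype.card (Fin k × Bool) - 1)))
    (hc : c = 1 / ((Fintype.card (Fin k × Bool) : ℝ) * (Fintype.card (Fin k × Bool) - 1)) - 2 * ε)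
    (hR : 1 ≤ R) (hn : 8 * (R * L) ≤ n) (hσ1 : σ ≤ 1) (hσ : 7 / 10 ≤ σ)
    (hσε : Real.exp (-(ε ^ 2 / 2)) ≤ σ) (hσρ : letterRatio (Fin k) ≤ σ)
    (hK : (Fintype.card (Fin k × Bool)) ^ 2 * (4 * Real.exp 1) ≤ K)
    (hK' : Fintype.card (Equiv.Perm (Fin k × Bool)) ≤ K) :
    Measure.pi (fun _ : Fin p => walkMeasure k n)
      {w | ¬ ((∀ i, Typical L (R * L) n c (w i).toWord) ∧
        ∀ i j, i ≠ j → ∀ s, Unrelated L (w i).toWord (block w (j, s)))} ≤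
      (4 * p + 2 * p ^ 2) * ENNReal.ofReal (K * (n + 1) ^ 2 * σ ^ (L / 2)) := by
  have := isProbabilityMeasure_walkMeasure (k := k) (by omega) n
  have hd : 3 ≤ Fintype.card (Fin k × Bool) := by simp; omega
  have hρ := letterRatio_nonneg (α := Fin k) hd
  set e := ENNReal.ofReal (K * (n + 1) ^ 2 * σ ^ (L / 2)) with he
  have hK0 : 0 ≤ K := (Nat.cast_nonneg _).trans hK'
  have h1 : ∀ i, Measure.pi (fun _ : Fin p => walkMeasure k n)
      {w | ¬ Typical L (R * L) n c (w i).toWord} ≤ 4 * e := by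
    intro i
    refine le_trans (le_of_eq ?_)
      (walkMeasure_not_typical_le hk hε0 hε hc hR hn hσ1 hσ hσε hσρ hK hK')
    exact (measurePreserving_eval (fun _ : Fin p => walkMeasure k n) i).measure_preimage
      (s := {g | ¬ Typical L (R * L) n c g.toWord}) (MeasurableSet.of_discrete).nullMeasurableSet
  have h2 : ∀ x : Fin p × Fin p × Bool, Measure.pi (fun _ : Fin p => walkMeasure k n)
      {w | x.1 ≠ x.2.1 ∧ (w x.1).toWord.length ≤ n ∧ (w x.2.1).toWord.length ≤ n ∧
        ¬ Unrelated L (w x.1).toWord (block w x.2)} ≤ e := by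
    rintro ⟨i, j, s⟩
    by_cases hij : i = j
    · simp [hij]
    let B : FreeGroup (Fin k) → List (Fin k × Bool) :=
      fun g => if s then g.toWord else FreeGroup.invRev g.toWord
    have hB : ∀ g, (B g).length = g.toWord.length := by
      intro g
      by_cases hs : s <;> simp [B, hs]
    have hblock : ∀ w : Fin p → FreeGroup (Fin k), block w (j, s) = B (w j) := by
      intro w
      rcases s with _ | _ <;> simp [B, block, FreeGroup.lift_mk]
    refine le_trans (le_of_eq ?_) (measure_pi_pair_le (walkMeasure k n) hij
      (S := {x | x.1.toWord.length ≤ n ∧ x.2.toWord.length ≤ n ∧ ¬ Unrelated L x.1.toWord (B x.2)})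
      (MeasurableSet.of_discrete) (e := e) fun y => ?_)
    · simp [hij, hblock]
    · by_cases hy : y.toWord.length ≤ n
      · refine le_trans (measure_mono ?_)
          ((walkMeasure_not_unrelated_le (L := L) hk ((hB y).trans_le hy)).trans
            (ENNReal.ofReal_le_ofReal (by gcongr)))
        exact fun g hg => ⟨hg.1, hg.2.2⟩
      · simp [hy]
  have hsub : {w : Fin p → FreeGroup (Fin k) | ¬ ((∀ i, Typical L (R * L) n c (w i).toWord) ∧
        ∀ i j, i ≠ j → ∀ s, Unrelated L (w i).toWord (block w (j, s)))} ⊆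
      (⋃ i, {w | ¬ Typical L (R * L) n c (w i).toWord}) ∪
      ⋃ x : Fin p × Fin p × Bool, {w | x.1 ≠ x.2.1 ∧ (w x.1).toWord.length ≤ n ∧
        (w x.2.1).toWord.length ≤ n ∧ ¬ Unrelated L (w x.1).toWord (block w x.2)} := by
    intro w hw
    by_contra h
    simp only [Set.mem_union, Set.mem_iUnion, Set.mem_ofPred_eq, not_or, not_exists, not_not,
      not_and] at h
    exact hw ⟨h.1, fun i j hij s => h.2 (i, j, s) hij (h.1 i).length_le (h.1 j).length_le⟩
  refine (measure_mono hsub).trans ((measure_union_le _ _).trans ?_)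
  refine (add_le_add ((measure_iUnion_fintype_le _ _).trans (Finset.sum_le_sum fun i _ => h1 i))
    ((measure_iUnion_fintype_le _ _).trans (Finset.sum_le_sum fun x _ => h2 x))).trans
      (le_of_eq ?_)
  simp only [Finset.sum_const, Finset.card_univ, Fintype.card_prod, Fintype.card_fin,
    Fintype.card_bool, nsmul_eq_mul]
  push_cast
  ring

end Estimate

section Main

variable {k : ℕ}

theorem Generic.autMalnormal (hk : 2 ≤ k) {p L : ℕ} {w : Fin p → FreeGroup (Fin k)}
    (hw : Generic w L (Fintype.card (Fin k × Bool) ^ 2 - 3)) :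
    AutMalnormal (Subgroup.closure (Set.range w)) := by
  rintro β ⟨x, hx, hxH, hβx⟩
  rw [← FreeGroup.range_lift_eq_closure] at hxH hβx ⊢
  exact hw.eq_conj (by simp; omega) β hx hxH hβx

theorem eq_conj_of_map_eq {H : Subgroup (FreeGroup (Fin k))} (hH : AutMalnormal H)
    {x : FreeGroup (Fin k)} (hx : x ≠ 1) (hxH : x ∈ H) (β : FreeGroup (Fin k) ≃* FreeGroup (Fin k))
    (hβ : Subgroup.map β.toMonoidHom H = H) : ∃ h, h ∈ H ∧ ∀ g, β g = h * g * h⁻¹ := by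
  refine hH β ⟨x, hx, hxH, ?_⟩
  rw [← hβ] at hxH
  obtain ⟨y, hy, rfl⟩ := hxH
  simpa using hy

theorem Generic.apply_ne_one {α ι : Type*} [DecidableEq α] {L D : ℕ} {w : ι → FreeGroup α}
    (hw : Generic w L D) (i : ι) : w i ≠ 1 := by
  intro h
  have h1 := hw.long (i, true)
  have h2 := hw.pos
  rw [block, FreeGroup.lift_mk] at h1
  simp [h] at h1
  omega

/-- Random tuples are generic, up to an exponentially small probability. -/
theorem exists_measure_pi_not_generic_le (hk : 2 ≤ k) {p : ℕ} (hp : 1 ≤ p) :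
    ∃ K σ : ℝ, ∃ m : ℕ, 0 < K ∧ 0 < σ ∧ σ < 1 ∧ 0 < m ∧ ∀ n,
      Measure.pi (fun _ : Fin p => walkMeasure k n)
        {w | ¬ ∃ L, Generic w L (Fintype.card (Fin k × Bool) ^ 2 - 3)} ≤
        ENNReal.ofReal (K * (n + 1) ^ 2 * σ ^ (n / m)) := by
  have hd : 4 ≤ Fintype.card (Fin k × Bool) := by simp; omega
  have hd' : (4 : ℝ) ≤ Fintype.card (Fin k × Bool) := by exact_mod_cast hd
  set d := Fintype.card (Fin k × Bool) with hdd
  have hD : 0 < d ^ 2 - 3 := by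
    have : 4 ^ 2 ≤ d ^ 2 := Nat.pow_le_pow_left hd 2
    omega
  have hDd : ((d ^ 2 - 3 : ℕ) : ℝ) = (d : ℝ) ^ 2 - 3 := by
    rw [Nat.cast_sub (by omega)]
    push_cast
    ring
  set D := d ^ 2 - 3
  have hD' : (0 : ℝ) < D := by exact_mod_cast hD
  have hgap : 0 < 1 / ((d : ℝ) * (d - 1)) - 1 / D := by
    rw [sub_pos]
    refine one_div_lt_one_div_of_lt (mul_pos (by linarith) (by linarith)) ?_
    rw [hDd]
    nlinarith
  set δ := 1 / ((d : ℝ) * (d - 1)) - 1 / D with hδ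
  have hinv : 0 < 1 / (D : ℝ) := by positivity
  have hε : δ / 4 ≤ 1 / ((d : ℝ) * (d - 1)) := by linarith
  obtain ⟨R, hR⟩ := exists_nat_ge (max 20 (4 / δ))
  have hR20 : 20 ≤ R := by exact_mod_cast (le_max_left _ _).trans hR
  have hRδ : 4 ≤ R * δ := (div_le_iff₀ hgap).mp ((le_max_right _ _).trans hR)
  set σ := max (7 / 10) (max (Real.exp (-((δ / 4) ^ 2 / 2))) (letterRatio (Fin k)))
  have hσ : 7 / 10 ≤ σ := le_max_left _ _
  have hσ1 : σ < 1 := max_lt (by norm_num) (max_lt (Real.exp_lt_one_iff.2 (by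
    have : 0 < (δ / 4) ^ 2 := by positivity
    linarith)) (letterRatio_lt_one (by omega)))
  set K : ℝ := max ((d : ℝ) ^ 2 * (4 * Real.exp 1)) (Fintype.card (Equiv.Perm (Fin k × Bool)))
  have hK1 : 1 ≤ K := le_trans (by exact_mod_cast Fintype.card_pos) (le_max_right _ _)
  have hp' : (1 : ℝ) ≤ p := by exact_mod_cast hp
  refine ⟨(4 * p + 2 * p ^ 2) * K, σ, 16 * R, by positivity, by linarith, hσ1, by omega,
    fun n => ?_⟩
  have := isProbabilityMeasure_walkMeasure (k := k) (by omega) n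
  have hdiv : n / (16 * R) = n / (8 * R) / 2 := by
    rw [Nat.div_div_eq_div_mul]
    congr 1
    ring
  set L := n / (8 * R)
  rw [hdiv]
  rcases Nat.eq_zero_or_pos L with hL | hL
  · refine prob_le_one.trans ?_
    rw [hL, Nat.zero_div, pow_zero, mul_one, ← ENNReal.ofReal_one]
    refine ENNReal.ofReal_le_ofReal ?_
    have h1 : (1 : ℝ) ≤ (n + 1) ^ 2 := one_le_pow₀ (by linarith [Nat.cast_nonneg (α := ℝ) n])
    have h2 : (1 : ℝ) ≤ 4 * p + 2 * p ^ 2 := by nlinarith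
    exact one_le_mul_of_one_le_of_one_le (one_le_mul_of_one_le_of_one_le h2 hK1) h1
  · have hn : 8 * (R * L) ≤ n := by
      rw [← mul_assoc]
      exact Nat.mul_div_le n (8 * R)
    have hmain := measure_pi_not_typical_le hk p (L := L) (R := R) (n := n) (σ := σ) (K := K)
      (by positivity) hε rfl (by omega) hn hσ1.le hσ
      ((le_max_left _ _).trans (le_max_right _ _)) ((le_max_right _ _).trans (le_max_right _ _))
      (le_max_left _ _) (le_max_right _ _)
    refine (measure_mono fun w hw => ?_).trans (hmain.trans (le_of_eq ?_))
    · rintro ⟨h1, h2⟩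
      refine hw ⟨L, generic_of_typical hL (Nat.mul_le_mul_right _ hR20) hD (fun m hm => ?_) h1 h2⟩
      have hm' : (R : ℝ) * L ≤ m := by exact_mod_cast hm
      have hc : (D : ℝ) * (1 / ((d : ℝ) * (d - 1)) - 2 * (δ / 4)) = 1 + D * δ / 2 := by
        rw [show 1 / ((d : ℝ) * (d - 1)) = 1 / D + δ by rw [hδ]; ring]
        field_simp
        ring
      have h3 : (4 : ℝ) * L ≤ δ * m := by
        calc (4 : ℝ) * L ≤ R * δ * L := by gcongr
          _ = δ * (R * L) := by ring
          _ ≤ _ := by gcongr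
      calc (2 * m + D * (4 * L) : ℝ) ≤ 2 * m + D * (δ * m) := by gcongr
        _ = 2 * (1 + D * δ / 2) * m := by ring
        _ = _ := by rw [← hc]; ring
    · have hcast : (4 * p + 2 * p ^ 2 : ENNReal) = ENNReal.ofReal (4 * p + 2 * p ^ 2) := by
        rw [show (4 * p + 2 * p ^ 2 : ℝ) = ((4 * p + 2 * p ^ 2 : ℕ) : ℝ) by push_cast; ring,
          ENNReal.ofReal_natCast]
        push_cast
        ring
      rw [hcast, ← ENNReal.ofReal_mul (by positivity)]
      congr 1
      ring

end Main

end RandomSubgroup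

/-- For `k ≥ 2`, `p ≥ 1`, if `w_1, …, w_p` are given by `p` independent
simple random walks of length `n` on `F_k`, then with probability going to 1 exponentially
fast as `n → ∞` the subgroup `H = ⟨w_1, …, w_p⟩` is Aut-malnormal; in particular every
automorphism of `F_k` leaving `H` invariant is conjugation by an element of `H`. -/
theorem rw_random_subgroup_AutMalnormal (k p : ℕ) (hk : 2 ≤ k) (hp : 1 ≤ p) :
    ExpDecay (fun n =>
      Measure.pi (fun _ : Fin p => walkMeasure k n)
        {w : Fin p → FreeGroup (Fin k) |
          ¬ (AutMalnormal (Subgroup.closure (Set.range w)) ∧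
            ∀ α : FreeGroup (Fin k) ≃* FreeGroup (Fin k),
              Subgroup.map α.toMonoidHom (Subgroup.closure (Set.range w)) =
                Subgroup.closure (Set.range w) →
              ∃ h, h ∈ Subgroup.closure (Set.range w) ∧ ∀ g, α g = h * g * h⁻¹)}) := by
  obtain ⟨K, σ, m, hK, hσ, hσ1, hm, h⟩ := RandomSubgroup.exists_measure_pi_not_generic_le hk hp
  refine RandomSubgroup.expDecay_of_le hK hσ hσ1 hm fun n => (measure_mono ?_).trans (h n)
  rintro w hw ⟨L, hG⟩
  have hH := hG.autMalnormal hk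
  exact hw ⟨hH, RandomSubgroup.eq_conj_of_map_eq hH (hG.apply_ne_one ⟨0, hp⟩)
    (Subgroup.subset_closure (Set.mem_range_self _))⟩

end
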